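/- Let f₁₁,ₘ(τ) = q^{−m} + a₁₁(m,−1)q^{−1} + ∑_{n≥1} a₁₁(m,n) qⁿ (m ≥ 2) be the reduced-form basis elements for weight 0 weakly holomorphic modular forms on Γ₀(11) holomorphic away from i∞. If m = 11^α m′ ≥ 2 with α ≥ 0 and gcd(11, m′) = 1, then for all positive integers n and all β > α, a₁₁(11^α m′, 11^β n) ≡ 0 (mod 11^{β−α}). -/

import Mathlib

open scoped BigOperators

section

open UpperHalfPlane hiding I
open Complex Function
open scoped Manifold MatrixGroups Topology

namespace X11

/-- The local parameter at infinity. -/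
noncomputable def q (τ : ℍ) : ℂ := Function.Periodic.qParam 1 (τ : ℂ)

lemma q_def (τ : ℍ) : q τ = Complex.exp (2 * Real.pi * I * τ) := by
  simp [q, Function.Periodic.qParam]

lemma q_ne (τ : ℍ) : q τ ≠ 0 := Function.Periodic.qParam_ne_zero _

lemma q_lt (τ : ℍ) : ‖q τ‖ < 1 := Function.Periodic.norm_qParam_lt_one one_pos τ.im_pos

lemma q_surj {z : ℂ} (hz : ‖z‖ < 1) (h0 : z ≠ 0) : ∃ τ : ℍ, q τ = z :=
  ⟨⟨Periodic.invQParam 1 z, Periodic.im_invQParam_pos_of_norm_lt_one one_pos hz h0⟩,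
    Periodic.qParam_right_inv one_ne_zero h0⟩

lemma hs_congr {ι : Type*} {u v : ι → ℂ} {a b : ℂ} (h : HasSum u a) (e1 : ∀ n, v n = u n)
    (e2 : b = a) : HasSum v b := by
  rw [e2, show v = u from funext e1]; exact h

/-- `f = q^e * P(q)` as a convergent series on the upper half plane. -/
def Rep (e : ℤ) (P : PowerSeries ℂ) (f : ℍ → ℂ) : Prop :=
  ∀ τ, HasSum (fun n => PowerSeries.coeff n P * q τ ^ n) (f τ * q τ ^ (-e))

variable {e e' : ℤ} {P Q : PowerSeries ℂ} {f g : ℍ → ℂ}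

lemma Rep.add (hf : Rep e P f) (hg : Rep e Q g) : Rep e (P + Q) (f + g) := by
  intro τ
  convert (hf τ).add (hg τ) using 1
  · ext n; simp [add_mul]
  · simp [add_mul]

lemma Rep.smul (hf : Rep e P f) (c : ℂ) : Rep e (c • P) (c • f) := by
  intro τ
  refine hs_congr ((hf τ).mul_left c) ?_ ?_
  · intro n; simp [mul_assoc]
  · simp [mul_assoc]

lemma Rep.neg (hf : Rep e P f) : Rep e (-P) (-f) := by
  simpa using hf.smul (-1)

lemma Rep.sub (hf : Rep e P f) (hg : Rep e Q g) : Rep e (P - Q) (f - g) := by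
  simpa [sub_eq_add_neg] using hf.add hg.neg

lemma Rep.mul (hf : Rep e P f) (hg : Rep e' Q g) : Rep (e + e') (P * Q) (f * g) := by
  intro τ
  have h1 := (hf τ).summable.norm
  have h2 := (hg τ).summable.norm
  have h3 := (summable_norm_sum_mul_antidiagonal_of_summable_norm h1 h2).of_norm.hasSum
  rw [← tsum_mul_tsum_eq_tsum_sum_antidiagonal_of_summable_norm h1 h2, (hf τ).tsum_eq,
    (hg τ).tsum_eq] at h3
  refine hs_congr h3 ?_ ?_
  · intro n
    rw [PowerSeries.coeff_mul, Finset.sum_mul]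
    refine Finset.sum_congr rfl fun x hx => ?_
    rw [← Finset.HasAntidiagonal.mem_antidiagonal.1 hx, pow_add]; ring
  · rw [Pi.mul_apply, neg_add, zpow_add₀ (q_ne τ)]; ring

lemma rep_const (c : ℂ) : Rep 0 (PowerSeries.C c) (fun _ => c) := by
  intro τ
  convert hasSum_ite_eq (0 : ℕ) c using 2 with n
  · rw [PowerSeries.coeff_C]; split_ifs with h <;> simp [h]
  · simp

lemma rep_one : Rep 0 1 (1 : ℍ → ℂ) := by
  have := rep_const 1
  rw [map_one] at this
  exact this

lemma rep_qpow (e : ℤ) : Rep e 1 (fun τ => q τ ^ e) := by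
  intro τ
  convert hasSum_ite_eq (0 : ℕ) (1 : ℂ) using 2 with n
  · rw [PowerSeries.coeff_one]; split_ifs with h <;> simp [h]
  · rw [← zpow_add₀ (q_ne τ)]; simp

lemma Rep.pow (hf : Rep e P f) (n : ℕ) : Rep (n * e) (P ^ n) (f ^ n) := by
  induction n with
  | zero => simpa using rep_one
  | succ n ih =>
    have := ih.mul hf
    rw [pow_succ, pow_succ]
    convert this using 1
    push_cast; ring

lemma rep_shift (k : ℕ) : Rep e (PowerSeries.X ^ k * P) f ↔ Rep (e + k) P f := by
  refine forall_congr' fun τ => ?_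
  have h0 := q_ne τ
  have : f τ * q τ ^ (-e) = q τ ^ k * (f τ * q τ ^ (-(e + k))) := by
    rw [← zpow_natCast, mul_left_comm, ← zpow_add₀ h0]; congr 2; ring
  rw [this]
  have h2 : (fun n => PowerSeries.coeff n (PowerSeries.X ^ k * P) * q τ ^ n) =
     fun n => if k ≤ n then q τ ^ k * (PowerSeries.coeff (n-k) P * q τ ^ (n-k)) else 0 := by
    ext n
    rw [PowerSeries.coeff_X_pow_mul']
    split_ifs with h
    · have : q τ ^ n = q τ ^ (n - k) * q τ ^ k := by rw [← pow_add, Nat.sub_add_cancel h]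
      rw [this]; ring
    · simp
  rw [h2, ← hasSum_nat_add_iff' k]
  simp only [le_add_iff_nonneg_left, zero_le, if_true, Nat.add_sub_cancel]
  rw [Finset.sum_eq_zero, sub_zero]
  · exact hasSum_mul_left_iff (pow_ne_zero _ h0)
  · intro i hi
    rw [if_neg]; simpa using hi

lemma Rep.of_le (hf : Rep e P f) (k : ℕ) : Rep (e - k) (PowerSeries.X ^ k * P) f := by
  rw [rep_shift]; simpa using hf

/-- sum of the series -/
noncomputable def psum (P : PowerSeries ℂ) (z : ℂ) : ℂ := ∑' n, PowerSeries.coeff n P * z ^ n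

lemma Rep.hasSum_psum (hf : Rep e P f) {z : ℂ} (hz : ‖z‖ < 1) :
    HasSum (fun n => PowerSeries.coeff n P * z ^ n) (psum P z) := by
  apply Summable.hasSum
  by_cases h0 : z = 0
  · subst h0
    apply summable_of_ne_finset_zero (s := {0})
    intro b hb
    simp at hb
    simp [hb]
  · obtain ⟨τ, rfl⟩ := q_surj hz h0
    exact (hf τ).summable

lemma Rep.eq_psum (hf : Rep e P f) (τ : ℍ) : f τ = q τ ^ e * psum P (q τ) := by
  have := (hf τ).unique (hf.hasSum_psum (q_lt τ))
  rw [← this, mul_comm (f τ), ← mul_assoc, ← zpow_add₀ (q_ne τ)]; simp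

lemma Rep.hasFP (hf : Rep e P f) : HasFPowerSeriesOnBall (psum P)
    (.ofScalars ℂ fun n => PowerSeries.coeff n P) 0 1 := by
  constructor
  · refine le_of_forall_lt_imp_le_of_dense fun r hr ↦ ?_
    lift r to NNReal using hr.ne_top
    apply FormalMultilinearSeries.le_radius_of_summable
    have : ‖((r : ℝ) : ℂ)‖ < 1 := by simpa using hr
    simpa [smul_eq_mul, norm_mul, mul_comm, mul_left_comm, mul_assoc] using
        (hf.hasSum_psum this).summable.norm
  · simp
  · intro y hy
    rw [← ENNReal.coe_one, Metric.eball_coe, NNReal.coe_one, mem_ball_zero_iff] at hy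
    simpa [mul_comm] using hf.hasSum_psum hy

lemma Rep.diffOn (hf : Rep e P f) : DifferentiableOn ℂ (psum P) (Metric.ball 0 1) := by
  have := hf.hasFP.differentiableOn
  rwa [← ENNReal.coe_one, Metric.eball_coe, NNReal.coe_one] at this

lemma Rep.unique (hf : Rep e P f) (hg : Rep e Q f) : P = Q := by
  have h1 := hf.hasFP.hasFPowerSeriesAt
  have h2 := hg.hasFP
  have h3 : HasFPowerSeriesOnBall (psum P) (.ofScalars ℂ fun n => PowerSeries.coeff n Q) 0 1 := by
    apply h2.congr
    intro z hz
    rw [← ENNReal.coe_one, Metric.eball_coe, NNReal.coe_one, mem_ball_zero_iff] at hz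
    have hball : Metric.ball (0:ℂ) 1 ∈ 𝓝 (0:ℂ) := Metric.ball_mem_nhds _ one_pos
    by_cases h0 : z = 0
    · subst h0
      have c1 := (hf.diffOn.differentiableAt hball).continuousAt
      have c2 := (hg.diffOn.differentiableAt hball).continuousAt
      have := (c2.eventuallyEq_nhds_iff_eventuallyEq_nhdsNE c1).mp (by
        filter_upwards [self_mem_nhdsWithin, mem_nhdsWithin_of_mem_nhds hball] with a ha hb
        obtain ⟨τ, rfl⟩ := q_surj (by simpa using hb) ha
        exact (hg.hasSum_psum (q_lt τ)).unique (hg τ) |>.trans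
          ((hf τ).unique (hf.hasSum_psum (q_lt τ))))
      exact this.eq_of_nhds
    · obtain ⟨τ, rfl⟩ := q_surj hz h0
      exact (hg.hasSum_psum (q_lt τ)).unique (hg τ) |>.trans
          ((hf τ).unique (hf.hasSum_psum (q_lt τ)))
  have := h1.eq_formalMultilinearSeries h3.hasFPowerSeriesAt
  ext n
  have h4 := congrArg (fun p => FormalMultilinearSeries.coeff p n) this
  simpa [FormalMultilinearSeries.coeff_ofScalars] using h4

lemma q_comp_ofComplex {z : ℂ} (hz : 0 < z.im) : q (ofComplex z) = Periodic.qParam 1 z := by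
  simp [q, ofComplex_apply_of_im_pos hz]

lemma hasDerivAt_qParam (z : ℂ) : HasDerivAt (Periodic.qParam 1)
    (2 * Real.pi * I * Periodic.qParam 1 z) z := by
  have : Periodic.qParam 1 = fun z : ℂ => Complex.exp (2 * Real.pi * I * z) := by
    ext z; simp [Function.Periodic.qParam]
  rw [this]
  have h := ((hasDerivAt_id z).const_mul (2 * Real.pi * I : ℂ)).cexp
  simpa [mul_comm] using h

lemma Rep.hasDerivAt (hf : Rep e P f) (τ : ℍ) : HasDerivAt (f ∘ ofComplex)
    (2 * Real.pi * I * (q τ ^ e * (e * psum P (q τ) + q τ * deriv (psum P) (q τ)))) (τ : ℂ) := by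
  have h0 : (fun z : ℂ => Periodic.qParam 1 z ^ e * psum P (Periodic.qParam 1 z))
      =ᶠ[𝓝 (τ : ℂ)] (f ∘ ofComplex) := by
    filter_upwards [isOpen_upperHalfPlaneSet.mem_nhds τ.im_pos] with z hz
    rw [Function.comp_apply, hf.eq_psum, q_comp_ofComplex hz]
  refine HasDerivAt.congr_of_eventuallyEq ?_ h0.symm
  have hq := hasDerivAt_qParam (τ : ℂ)
  have hd : HasDerivAt (psum P) (deriv (psum P) (q τ)) (Periodic.qParam 1 τ) :=
    (hf.diffOn.differentiableAt (Metric.isOpen_ball.mem_nhds (by simpa using q_lt τ))).hasDerivAt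
  have hz := (hasDerivAt_zpow e (q τ) (Or.inl (q_ne τ)))
  have h1 := (HasDerivAt.comp (τ : ℂ) hz hq).mul (HasDerivAt.comp (τ : ℂ) hd hq)
  refine h1.congr_deriv ?_
  simp only [Function.comp_apply]
  change _ * (2 * Real.pi * I * q τ) * psum P (q τ) + q τ ^ e * (_ * (2 * Real.pi * I * q τ)) = _
  rw [zpow_sub_one₀ (q_ne τ)]
  have := q_ne τ
  field_simp

lemma Rep.mdiff (hf : Rep e P f) : MDiff f := by
  rw [UpperHalfPlane.mdifferentiable_iff]
  intro z hz
  exact (hf.hasDerivAt ⟨z, hz⟩).differentiableAt.differentiableWithinAt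

lemma coeff_of_hasFP (hf : Rep e P f) (n : ℕ) :
    iteratedDeriv n (psum P) 0 = n.factorial * PowerSeries.coeff n P := by
  have h1 : HasFPowerSeriesOnBall (psum P)
      (.ofScalars ℂ fun n => (n.factorial : ℂ)⁻¹ * iteratedDeriv n (psum P) 0) 0 1 := by
    have := hf.hasFP
    have key : ∀ z : ℂ, ‖z‖ < 1 → HasSum (fun n : ℕ => (n.factorial : ℂ)⁻¹ *
       iteratedDeriv n (psum P) 0 * z ^ n) (psum P z) := by
      intro z hz
      have := hasSum_taylorSeries_on_ball hf.diffOn (z := z) (by simpa using hz)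
      simpa [mul_comm, mul_left_comm, mul_assoc] using this
    constructor
    · refine le_of_forall_lt_imp_le_of_dense fun r hr ↦ ?_
      lift r to NNReal using hr.ne_top
      apply FormalMultilinearSeries.le_radius_of_summable
      have : ‖((r : ℝ) : ℂ)‖ < 1 := by simpa using hr
      simpa [smul_eq_mul, norm_mul, mul_comm, mul_left_comm, mul_assoc] using
          (key _ this).summable.norm
    · simp
    · intro y hy
      rw [← ENNReal.coe_one, Metric.eball_coe, NNReal.coe_one, mem_ball_zero_iff] at hy
      simpa [mul_comm, mul_left_comm] using key _ hy
  have := h1.hasFPowerSeriesAt.eq_formalMultilinearSeries hf.hasFP.hasFPowerSeriesAt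
  have h4 := congrArg (fun p => FormalMultilinearSeries.coeff p n) this
  simp only [FormalMultilinearSeries.coeff_ofScalars] at h4
  rw [← h4]
  have : (n.factorial : ℂ) ≠ 0 := by exact_mod_cast n.factorial_ne_zero
  field_simp

lemma Rep.hasSum_deriv (hf : Rep e P f) {z : ℂ} (hz : ‖z‖ < 1) :
    HasSum (fun n : ℕ => n * PowerSeries.coeff n P * z ^ n) (z * deriv (psum P) z) := by
  have h1 : DifferentiableOn ℂ (deriv (psum P)) (Metric.ball 0 1) :=
    hf.diffOn.deriv Metric.isOpen_ball
  have := (hasSum_taylorSeries_on_ball h1 (z := z) (by simpa using hz)).mul_left z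
  rw [← hasSum_nat_add_iff' 1]
  simp only [Finset.range_one, Finset.sum_singleton]
  refine hs_congr this ?_ ?_
  · intro n
    rw [← iteratedDeriv_succ', coeff_of_hasFP hf, Nat.factorial_succ]
    have : (n.factorial : ℂ) ≠ 0 := by exact_mod_cast n.factorial_ne_zero
    simp only [smul_eq_mul, sub_zero]
    push_cast
    field_simp
    ring
  · simp

/-- normalized derivative -/
noncomputable def Dq (f : ℍ → ℂ) : ℍ → ℂ := Derivative.normalizedDerivOfComplex f

/-- coefficientwise derivative of `q^e P`. -/
noncomputable def dPS (e : ℤ) (P : PowerSeries ℂ) : PowerSeries ℂ :=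
  PowerSeries.mk fun n => ((e : ℂ) + n) * PowerSeries.coeff n P

lemma Rep.D (hf : Rep e P f) : Rep e (dPS e P) (Dq f) := by
  intro τ
  have h1 := ((hf.hasSum_psum (q_lt τ)).mul_left (e : ℂ)).add (hf.hasSum_deriv (q_lt τ))
  refine hs_congr h1 ?_ ?_
  · intro n; simp [dPS]; ring
  · rw [Dq, Derivative.normalizedDerivOfComplex, (hf.hasDerivAt τ).deriv]
    have : (2 * Real.pi * I : ℂ) ≠ 0 := Complex.two_pi_I_ne_zero
    rw [inv_mul_cancel_left₀ this, mul_comm (q τ ^ e), mul_assoc, ← zpow_add₀ (q_ne τ)]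
    simp

lemma q_vadd (τ : ℍ) : q ((1 : ℝ) +ᵥ τ) = q τ := by
  rw [q_def, q_def]
  have : ((((1 : ℝ) +ᵥ τ : ℍ)) : ℂ) = τ + 1 := by simp [add_comm]
  rw [this, mul_add, Complex.exp_add]; simp [Complex.exp_two_pi_mul_I]

lemma Rep.periodic (hf : Rep e P f) (τ : ℍ) : f ((1 : ℝ) +ᵥ τ) = f τ := by
  rw [hf.eq_psum, hf.eq_psum, q_vadd]

lemma Rep.bdd (hf : Rep e P f) : IsBoundedAtImInfty (fun τ => f τ * q τ ^ (-e)) :=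
  isBoundedAtImInfty_of_hasSum_qExpansion one_pos hf

lemma q_mdiff (e : ℤ) : MDiff (fun τ : ℍ => q τ ^ e) := (rep_qpow e).mdiff

lemma rep_exists (hd : MDiff f) (hp : ∀ τ : ℍ, f ((1 : ℝ) +ᵥ τ) = f τ) (e : ℤ)
    (hb : IsBoundedAtImInfty (fun τ => f τ * q τ ^ (-e))) : ∃ P, Rep e P f := by
  refine ⟨qExpansion 1 (fun τ => f τ * q τ ^ (-e)), fun τ => ?_⟩
  refine hasSum_qExpansion (f := fun τ => f τ * q τ ^ (-e)) one_pos ?_ (hd.mul (q_mdiff _)) hb τ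
  intro z
  by_cases hz : 0 < z.im
  · have h1 : 0 < (z + ((1 : ℝ) : ℂ)).im := by simpa using hz
    have h2 : ofComplex (z + ((1 : ℝ) : ℂ)) = (1 : ℝ) +ᵥ ofComplex z := by
      rw [ofComplex_apply_of_im_pos h1, ofComplex_apply_of_im_pos hz]
      apply UpperHalfPlane.ext
      simp [add_comm]
    simp only [Function.comp_apply]
    rw [h2, hp, q_vadd]
  · have h1 : ¬ 0 < (z + ((1 : ℝ) : ℂ)).im := by simpa using hz
    simp only [Function.comp_apply]
    rw [ofComplex_apply_of_im_nonpos (not_lt.1 h1), ofComplex_apply_of_im_nonpos (not_lt.1 hz)]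

end X11

end

section

open UpperHalfPlane hiding I
open Complex Function
open scoped Manifold MatrixGroups Topology

namespace X11

/-! ### The operators `V` and `U` -/

/-- `τ ↦ 11 τ` -/
noncomputable def m11 (τ : ℍ) : ℍ := ⟨11 * (τ : ℂ), by
  have := τ.im_pos
  simp only [Complex.mul_im, Complex.im_ofNat, Complex.re_ofNat, zero_mul, add_zero]
  exact mul_pos (by norm_num) this⟩

/-- `τ ↦ (τ + i) / 11` -/
noncomputable def dv (i : ℤ) (τ : ℍ) : ℍ := ⟨((τ : ℂ) + i) / 11, by
  have := τ.im_pos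
  simp only [Complex.div_ofNat_im, Complex.add_im, Complex.intCast_im, add_zero]
  exact div_pos this (by norm_num)⟩

lemma coe_m11 (τ : ℍ) : ((m11 τ : ℍ) : ℂ) = 11 * τ := rfl
lemma coe_dv (i : ℤ) (τ : ℍ) : ((dv i τ : ℍ) : ℂ) = (τ + i) / 11 := rfl

lemma q_m11 (τ : ℍ) : q (m11 τ) = q τ ^ 11 := by
  rw [q_def, q_def, ← Complex.exp_nat_mul, coe_m11]; congr 1; push_cast; ring

lemma q_dv (i : ℤ) (τ : ℍ) : q (dv i τ) = q (dv 0 τ) * Complex.exp (2 * Real.pi * I / 11) ^ i := by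
  rw [q_def, q_def, ← Complex.exp_int_mul, coe_dv, coe_dv, ← Complex.exp_add]
  congr 1; push_cast; ring

lemma q_dv_pow (i : ℤ) (τ : ℍ) : q (dv i τ) ^ 11 = q τ := by
  rw [q_def, q_def, ← Complex.exp_nat_mul, coe_dv, Complex.exp_eq_exp_iff_exists_int]
  exact ⟨i, by push_cast; ring⟩

lemma dv_add (i : ℤ) (τ : ℍ) : dv (i + 11) τ = (1 : ℝ) +ᵥ dv i τ := by
  apply UpperHalfPlane.ext
  rw [coe_dv, coe_vadd, coe_dv]; push_cast; ring

lemma m11_dv (i : ℤ) (τ : ℍ) : ((m11 (dv i τ) : ℍ) : ℂ) = τ + i := by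
  rw [coe_m11, coe_dv]; ring

/-- `V f(τ) = f(11τ)` -/
noncomputable def V (f : ℍ → ℂ) : ℍ → ℂ := fun τ => f (m11 τ)

/-- The operator `U₁₁`. -/
noncomputable def U (f : ℍ → ℂ) : ℍ → ℂ := fun τ =>
  (1 / 11) * ∑ i ∈ Finset.range 11, f (dv i τ)

variable {e e' : ℤ} {P Q : PowerSeries ℂ} {f g : ℍ → ℂ}

lemma U_add (f g : ℍ → ℂ) : U (f + g) = U f + U g := by
  ext τ; simp [U, Finset.sum_add_distrib, mul_add]

lemma U_smul (c : ℂ) (f : ℍ → ℂ) : U (c • f) = c • U f := by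
  ext τ; simp only [U, Pi.smul_apply, smul_eq_mul, ← Finset.mul_sum]; ring

lemma U_neg (f : ℍ → ℂ) : U (-f) = - U f := by
  simpa using U_smul (-1) f

lemma U_sub (f g : ℍ → ℂ) : U (f - g) = U f - U g := by
  rw [sub_eq_add_neg, U_add, U_neg, ← sub_eq_add_neg]

lemma U_const_mul (c : ℂ) (f : ℍ → ℂ) : U (fun τ => c * f τ) = fun τ => c * U f τ :=
  U_smul c f

lemma Rep.V (hf : Rep e P f) : Rep (11 * e) (PowerSeries.expand 11 (by norm_num) P) (V f) := by
  intro τ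
  have h := hf (m11 τ)
  have h2 : Injective (fun n : ℕ => 11 * n) := fun a b h => by simpa using h
  rw [← h2.hasSum_iff]
  · refine hs_congr h ?_ ?_
    · intro n
      simp only [Function.comp_apply]
      rw [PowerSeries.coeff_expand_mul, q_m11, pow_mul]
    · rw [X11.V, q_m11, ← zpow_natCast, ← zpow_mul]; simp
  · intro n hn
    rw [PowerSeries.coeff_expand_of_not_dvd, zero_mul]
    rintro ⟨k, rfl⟩
    exact hn ⟨k, rfl⟩

lemma zeta_prim : IsPrimitiveRoot (Complex.exp (2 * Real.pi * I / 11)) 11 := by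
  have := Complex.isPrimitiveRoot_exp 11 (by norm_num)
  simpa using this

lemma sum_q_dv (n : ℕ) (τ : ℍ) : ∑ i ∈ Finset.range 11, q (dv i τ) ^ n =
    if 11 ∣ n then 11 * q τ ^ (n / 11) else 0 := by
  split_ifs with h
  · obtain ⟨k, rfl⟩ := h
    simp_rw [pow_mul, q_dv_pow]
    simp
  · have h1 : ∀ i ∈ Finset.range 11, q (dv i τ) ^ n =
       q (dv 0 τ) ^ n * (Complex.exp (2 * Real.pi * I / 11) ^ n) ^ i := by
      intro i _
      rw [q_dv, mul_pow]; congr 1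
      rw [zpow_natCast, ← pow_mul, ← pow_mul, mul_comm i n]
    rw [Finset.sum_congr rfl h1, ← Finset.mul_sum]
    have h2 : Complex.exp (2 * Real.pi * I / 11) ^ n ≠ 1 := by
      rw [Ne, zeta_prim.pow_eq_one_iff_dvd]; exact h
    rw [geom_sum_eq h2, ← pow_mul, mul_comm n, pow_mul, zeta_prim.pow_eq_one]
    simp

/-- coefficients of `U` -/
noncomputable def uPS (P : PowerSeries ℂ) : PowerSeries ℂ :=
  PowerSeries.mk fun n => PowerSeries.coeff (11 * n) P

lemma Rep.U (hf : Rep (11 * e) P f) : Rep e (uPS P) (U f) := by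
  intro τ
  have h1 : HasSum (fun n => (1 / 11) * ∑ i ∈ Finset.range 11,
      PowerSeries.coeff n P * q (dv i τ) ^ n)
      ((1 / 11) * ∑ i ∈ Finset.range 11, f (dv i τ) * q (dv i τ) ^ (-(11 * e))) :=
    (hasSum_sum fun (i : ℕ) _ => hf (dv i τ)).mul_left _
  have h2 : Injective (fun n : ℕ => 11 * n) := fun a b h => by simpa using h
  rw [← h2.hasSum_iff] at h1
  · refine hs_congr h1 ?_ ?_
    · intro n
      simp only [Function.comp_apply]
      rw [← Finset.mul_sum, sum_q_dv, if_pos (by simp), uPS, PowerSeries.coeff_mk]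
      simp; ring
    · have : ∀ i ∈ Finset.range 11, f (dv i τ) * q (dv i τ) ^ (-(11 * e)) =
          f (dv i τ) * q τ ^ (-e) := by
        intro i _
        rw [← mul_neg, zpow_mul, ← q_dv_pow i τ]; norm_cast
      rw [Finset.sum_congr rfl this, ← Finset.sum_mul, X11.U]; ring
  · intro n hn
    rw [← Finset.mul_sum, sum_q_dv, if_neg, mul_zero, mul_zero]
    rintro ⟨k, rfl⟩
    exact hn ⟨k, rfl⟩

lemma U_qpow_mul (m : ℤ) : U (fun τ => q τ ^ (11 * m)) = fun τ => q τ ^ m := by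
  ext τ
  have : ∀ i ∈ Finset.range 11, q (dv i τ) ^ (11 * m) = q τ ^ m := by
    intro i _
    rw [zpow_mul, ← q_dv_pow i τ]; norm_cast
  rw [U, Finset.sum_congr rfl this]; simp

lemma U_qpow_zero {m : ℤ} (h : ¬ 11 ∣ m) : U (fun τ => q τ ^ m) = 0 := by
  ext τ
  set z := Complex.exp (2 * Real.pi * I / 11) with hz
  have h1 : ∀ i ∈ Finset.range 11, q (dv i τ) ^ m = q (dv 0 τ) ^ m * (z ^ m) ^ i := by
    intro i _
    rw [q_dv, mul_zpow]; congr 1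
    rw [← zpow_natCast, ← zpow_mul, ← zpow_mul, mul_comm (i : ℤ) m]
  rw [U, Finset.sum_congr rfl h1, ← Finset.mul_sum]
  have h2 : z ^ m ≠ 1 := by
    rw [Ne, zeta_prim.zpow_eq_one_iff_dvd]; exact_mod_cast h
  rw [geom_sum_eq h2, ← zpow_natCast, ← zpow_mul, mul_comm m, zpow_mul]
  norm_cast
  rw [zeta_prim.pow_eq_one]
  simp

lemma Rep.periodic_int (hf : Rep e P f) {σ τ : ℍ} (i : ℤ) (h : (σ : ℂ) = τ + i) : f σ = f τ := by
  rw [hf.eq_psum, hf.eq_psum]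
  have : q σ = q τ := by
    rw [q_def, q_def, h, Complex.exp_eq_exp_iff_exists_int]
    exact ⟨i, by ring⟩
  rw [this]

lemma U_V_mul (hf : Rep e P f) (g : ℍ → ℂ) : U (V f * g) = f * U g := by
  ext τ
  have : ∀ i ∈ Finset.range 11, (V f * g) (dv i τ) = f τ * g (dv i τ) := by
    intro i _
    rw [Pi.mul_apply, V, hf.periodic_int i (m11_dv i τ)]
  rw [U, Finset.sum_congr rfl this, ← Finset.mul_sum, Pi.mul_apply, U]; ring

lemma U_Dq (hf : Rep e P f) : U (Dq f) = fun τ => 11 * Dq (U f) τ := by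
  -- lower `e` to a multiple of `11`
  obtain ⟨k, hk⟩ : ∃ k : ℕ, e - k = 11 * (e / 11) :=
    ⟨(e % 11).toNat, by omega⟩
  have h := hf.of_le k
  rw [hk] at h
  set R := PowerSeries.X ^ k * P
  have h1 := h.D.U
  have h2 := h.U.D
  have : uPS (dPS (11 * (e / 11)) R) = (11 : ℂ) • dPS (e / 11) (uPS R) := by
    ext n
    simp only [uPS, dPS, PowerSeries.coeff_mk, map_smul, smul_eq_mul]
    push_cast; ring
  rw [this] at h1
  have h3 := h2.smul 11
  ext τ
  rw [h1.eq_psum, ← h3.eq_psum]; rfl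

end X11

end

section

open UpperHalfPlane hiding I
open Complex Function
open scoped Manifold MatrixGroups Topology

namespace X11

/-! ### Integrality: the ring `O = ℤ[1/10]` -/

/-- `ℤ[1/10]` inside `ℂ`. -/
def O : Subring ℂ where
  carrier := {z | ∃ (b : ℕ) (a : ℤ), (10 : ℂ) ^ b * z = a}
  one_mem' := ⟨0, 1, by simp⟩
  zero_mem' := ⟨0, 0, by simp⟩
  mul_mem' := by
    rintro x y ⟨b, a, h⟩ ⟨b', a', h'⟩
    exact ⟨b + b', a * a', by push_cast; rw [← h, ← h']; ring⟩
  add_mem' := by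
    rintro x y ⟨b, a, h⟩ ⟨b', a', h'⟩
    refine ⟨b + b', a * 10 ^ b' + a' * 10 ^ b, ?_⟩
    push_cast; rw [← h, ← h']; ring
  neg_mem' := by
    rintro x ⟨b, a, h⟩
    exact ⟨b, -a, by push_cast; rw [← h]; ring⟩

lemma mem_O {z : ℂ} : z ∈ O ↔ ∃ (b : ℕ) (a : ℤ), (10 : ℂ) ^ b * z = a := Iff.rfl

lemma int_mem_O (n : ℤ) : (n : ℂ) ∈ O := intCast_mem O n

lemma half_mem_O : (1 / 2 : ℂ) ∈ O := ⟨1, 5, by norm_num⟩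
lemma fifth_mem_O : (1 / 5 : ℂ) ∈ O := ⟨1, 2, by norm_num⟩

/-- divisibility in `O` implies divisibility in `ℤ`. -/
lemma dvd_of_O {a : ℤ} {k : ℕ} {z : ℂ} (hz : z ∈ O) (h : (a : ℂ) = 11 ^ k * z) :
    (11 : ℤ) ^ k ∣ a := by
  obtain ⟨b, c, hc⟩ := hz
  have h1 : (10 : ℤ) ^ b * a = 11 ^ k * c := by
    have : (10 : ℂ) ^ b * a = 11 ^ k * c := by rw [h, ← hc]; ring
    exact_mod_cast this
  have h2 : IsCoprime ((11 : ℤ) ^ k) (10 ^ b) := by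
    apply IsCoprime.pow
    exact ⟨1, -1, by norm_num⟩
  exact h2.dvd_of_dvd_mul_left ⟨c, h1⟩

lemma fermat_O {z : ℂ} (hz : z ∈ O) : ∃ w ∈ O, z ^ 11 - z = 11 * w := by
  obtain ⟨b, a, h⟩ := hz
  have hd : (11 : ℤ) ∣ a ^ 11 - (10 ^ b) ^ 10 * a := by
    have h4 : ((10 : ZMod 11) ^ b) ^ 10 = 1 := by
      rw [← pow_mul, mul_comm, pow_mul, show (10 : ZMod 11) ^ 10 = 1 from by decide, one_pow]
    have h3 : ∀ x : ZMod 11, x ^ 11 = x := by decide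
    have := (ZMod.intCast_zmod_eq_zero_iff_dvd (a ^ 11 - (10 ^ b) ^ 10 * a) 11).1 (by
      push_cast; rw [h3, h4]; ring)
    exact_mod_cast this
  obtain ⟨c, hc⟩ := hd
  have h10 : (10 : ℂ) ^ b ≠ 0 := pow_ne_zero _ (by norm_num)
  refine ⟨c / (10 ^ b) ^ 11, ⟨b * 11, c, ?_⟩, ?_⟩
  · rw [pow_mul]; field_simp
  · have hc' : (a : ℂ) ^ 11 - (10 ^ b) ^ 10 * a = 11 * c := by exact_mod_cast hc
    rw [← h] at hc'
    field_simp
    linear_combination hc'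

/-! ### Integral power series -/

/-- power series with coefficients in `O`. -/
noncomputable def IntP : Subring (PowerSeries ℂ) := (PowerSeries.map O.subtype).range

lemma mem_IntP {P : PowerSeries ℂ} : P ∈ IntP ↔ ∀ n, PowerSeries.coeff n P ∈ O := by
  constructor
  · rintro ⟨R, rfl⟩ n
    simp
  · intro h
    refine ⟨PowerSeries.mk fun n => ⟨_, h n⟩, ?_⟩
    ext n; simp

lemma IntP_X : (PowerSeries.X : PowerSeries ℂ) ∈ IntP := ⟨PowerSeries.X, by simp⟩
lemma IntP_C {c : ℂ} (hc : c ∈ O) : PowerSeries.C c ∈ IntP := ⟨PowerSeries.C ⟨c, hc⟩, by simp⟩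

lemma IntP_inv {P : PowerSeries ℂ} (h : P ∈ IntP) (h1 : PowerSeries.coeff 0 P = 1) :
    P⁻¹ ∈ IntP := by
  obtain ⟨R, rfl⟩ := h
  have h2 : PowerSeries.constantCoeff R = ((1 : Oˣ) : O) := by
    apply Subtype.ext
    simpa using h1
  refine ⟨PowerSeries.invOfUnit R 1, ?_⟩
  have := congrArg (PowerSeries.map O.subtype) (PowerSeries.mul_invOfUnit R 1 h2)
  rw [map_mul, map_one] at this
  rw [PowerSeries.eq_inv_iff_mul_eq_one, mul_comm, this]
  rw [← PowerSeries.coeff_zero_eq_constantCoeff_apply, h1]; exact one_ne_zero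

lemma IntP_of_X_mul {P : PowerSeries ℂ} {k : ℕ} (h : PowerSeries.X ^ k * P ∈ IntP) : P ∈ IntP := by
  rw [mem_IntP] at h ⊢
  intro n
  have := h (n + k)
  rwa [PowerSeries.coeff_X_pow_mul] at this

variable {e e' : ℤ} {P Q : PowerSeries ℂ} {f g : ℍ → ℂ} {c c' : ℂ}

/-- integral expansion of order at least `e` -/
def Lo (e : ℤ) (f : ℍ → ℂ) : Prop := ∃ P ∈ IntP, Rep e P f
/-- integral expansion `c q^e + ...` -/
def Lc (e : ℤ) (c : ℂ) (f : ℍ → ℂ) : Prop := ∃ P ∈ IntP, PowerSeries.coeff 0 P = c ∧ Rep e P f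

lemma Lc.lo (h : Lc e c f) : Lo e f := by obtain ⟨P, h1, _, h2⟩ := h; exact ⟨P, h1, h2⟩
lemma Lo.lc (h : Lo e f) : ∃ c ∈ O, Lc e c f := by
  obtain ⟨P, h1, h2⟩ := h; exact ⟨_, mem_IntP.1 h1 0, P, h1, rfl, h2⟩
lemma Lo.of_le (h : Lo e f) (h' : e' ≤ e) : Lo e' f := by
  obtain ⟨P, h1, h2⟩ := h
  obtain ⟨k, rfl⟩ := Int.exists_add_of_le h'
  refine ⟨PowerSeries.X ^ k * P, IntP.mul_mem (IntP.pow_mem IntP_X _) h1, ?_⟩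
  have := h2.of_le k
  simpa using this
lemma Lo.lc_zero (h : Lo e f) (h' : e' < e) : Lc e' 0 f := by
  obtain ⟨P, h1, h2⟩ := h.of_le (show e' + 1 ≤ e by omega)
  refine ⟨PowerSeries.X ^ 1 * P, IntP.mul_mem (IntP.pow_mem IntP_X _) h1, ?_, ?_⟩
  · simp
  · rw [rep_shift]; simpa using h2
lemma Lc.lo_succ (h : Lc e 0 f) : Lo (e + 1) f := by
  obtain ⟨P, h1, h0, h2⟩ := h
  obtain ⟨R, rfl⟩ := (PowerSeries.X_dvd_iff).2 (by simpa using h0)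
  rw [← pow_one PowerSeries.X, rep_shift] at h2
  rw [← pow_one PowerSeries.X] at h1
  exact ⟨R, IntP_of_X_mul h1, by simpa using h2⟩
lemma Lo.add (h : Lo e f) (h' : Lo e g) : Lo e (f + g) := by
  obtain ⟨P, h1, h2⟩ := h
  obtain ⟨Q, h3, h4⟩ := h'
  exact ⟨_, IntP.add_mem h1 h3, h2.add h4⟩
lemma Lc.add (h : Lc e c f) (h' : Lc e c' g) : Lc e (c + c') (f + g) := by
  obtain ⟨P, h1, rfl, h2⟩ := h
  obtain ⟨Q, h3, rfl, h4⟩ := h'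
  exact ⟨_, IntP.add_mem h1 h3, by simp, h2.add h4⟩
lemma Lc.mul (h : Lc e c f) (h' : Lc e' c' g) : Lc (e + e') (c * c') (f * g) := by
  obtain ⟨P, h1, rfl, h2⟩ := h
  obtain ⟨Q, h3, rfl, h4⟩ := h'
  exact ⟨_, IntP.mul_mem h1 h3, by simp, h2.mul h4⟩
lemma Lo.mul (h : Lo e f) (h' : Lo e' g) : Lo (e + e') (f * g) := by
  obtain ⟨_, _, h1⟩ := h.lc
  obtain ⟨_, _, h2⟩ := h'.lc
  exact (h1.mul h2).lo
lemma Lc.neg (h : Lc e c f) : Lc e (-c) (-f) := by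
  obtain ⟨P, h1, rfl, h2⟩ := h
  exact ⟨_, IntP.neg_mem h1, by simp, h2.neg⟩
lemma Lo.neg (h : Lo e f) : Lo e (-f) := by
  obtain ⟨_, _, h1⟩ := h.lc
  exact h1.neg.lo
lemma Lo.sub (h : Lo e f) (h' : Lo e g) : Lo e (f - g) := by
  rw [sub_eq_add_neg]; exact h.add h'.neg
lemma Lc.sub (h : Lc e c f) (h' : Lc e c' g) : Lc e (c - c') (f - g) := by
  rw [sub_eq_add_neg, sub_eq_add_neg]; exact h.add h'.neg
lemma Lc.smul (h : Lc e c f) (hc : c' ∈ O) : Lc e (c' * c) (c' • f) := by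
  obtain ⟨P, h1, rfl, h2⟩ := h
  refine ⟨c' • P, ?_, by simp, h2.smul c'⟩
  rw [PowerSeries.smul_eq_C_mul]; exact IntP.mul_mem (IntP_C hc) h1
lemma Lo.smul (h : Lo e f) (hc : c' ∈ O) : Lo e (c' • f) := by
  obtain ⟨_, _, h1⟩ := h.lc
  exact (h1.smul hc).lo
lemma lc_one : Lc 0 1 (1 : ℍ → ℂ) := ⟨1, IntP.one_mem, by simp, rep_one⟩
lemma Lc.pow (h : Lc e 1 f) (n : ℕ) : Lc (n * e) 1 (f ^ n) := by
  obtain ⟨P, h1, h0, h2⟩ := h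
  exact ⟨_, IntP.pow_mem h1 n, by
    rw [PowerSeries.coeff_zero_eq_constantCoeff_apply] at h0 ⊢; rw [map_pow, h0, one_pow], h2.pow n⟩
lemma Lo.zero (e : ℤ) : Lo e 0 := ⟨0, IntP.zero_mem, fun τ => by simp⟩
lemma lo_const (hc : c ∈ O) : Lo 0 (fun _ => c) := ⟨_, IntP_C hc, rep_const c⟩

lemma Lo.D (h : Lo e f) : Lo e (Dq f) := by
  obtain ⟨P, h1, h2⟩ := h
  refine ⟨_, ?_, h2.D⟩
  rw [mem_IntP] at h1 ⊢
  intro n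
  rw [dPS, PowerSeries.coeff_mk]
  refine O.mul_mem ?_ (h1 n)
  have := int_mem_O (e + n)
  push_cast at this
  exact this
lemma Lc.D (h : Lc e c f) : Lc e (e * c) (Dq f) := by
  obtain ⟨P, h1, rfl, h2⟩ := h
  obtain ⟨Q, h3, h4⟩ := Lo.D ⟨P, h1, h2⟩
  refine ⟨Q, h3, ?_, h4⟩
  rw [h4.unique h2.D, dPS, PowerSeries.coeff_mk]; simp

lemma Lc.V (h : Lc e c f) : Lc (11 * e) c (V f) := by
  obtain ⟨P, h1, rfl, h2⟩ := h
  refine ⟨_, ?_, ?_, h2.V⟩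
  · obtain ⟨R, rfl⟩ := h1
    exact ⟨PowerSeries.expand 11 (by norm_num) R, PowerSeries.map_expand _ _ _ _⟩
  · simp
lemma Lo.V (h : Lo e f) : Lo (11 * e) (V f) := by
  obtain ⟨_, _, h1⟩ := h.lc
  exact h1.V.lo
lemma Lc.U (h : Lc (11 * e) c f) : Lc e c (U f) := by
  obtain ⟨P, h1, rfl, h2⟩ := h
  refine ⟨_, ?_, ?_, h2.U⟩
  · rw [mem_IntP] at h1 ⊢
    intro n; rw [uPS, PowerSeries.coeff_mk]; exact h1 _
  · rw [uPS, PowerSeries.coeff_mk]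
lemma Lo.U (h : Lo e f) : Lo (e / 11) (U f) := by
  obtain ⟨_, _, h1⟩ := (h.of_le (show 11 * (e / 11) ≤ e by omega)).lc
  exact h1.U.lo
lemma Lo.U_one (h : Lo 1 f) : Lo 1 (X11.U f) := by
  have h1 : Lc (11 * 0) 0 f := h.lc_zero (by norm_num)
  exact h1.U.lo_succ

/-- Laurent series with coefficients in `O`. -/
noncomputable def 𝓛 : Subring (ℍ → ℂ) where
  carrier := {f | ∃ e, Lo e f}
  one_mem' := ⟨0, lc_one.lo⟩
  zero_mem' := ⟨0, Lo.zero 0⟩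
  mul_mem' := by
    rintro f g ⟨e, h⟩ ⟨e', h'⟩
    exact ⟨_, h.mul h'⟩
  add_mem' := by
    rintro f g ⟨e, h⟩ ⟨e', h'⟩
    exact ⟨min e e', (h.of_le (min_le_left _ _)).add (h'.of_le (min_le_right _ _))⟩
  neg_mem' := by
    rintro f ⟨e, h⟩
    exact ⟨e, h.neg⟩

lemma Lo.mem (h : Lo e f) : f ∈ 𝓛 := ⟨e, h⟩
lemma Lc.mem (h : Lc e c f) : f ∈ 𝓛 := ⟨e, h.lo⟩

lemma mem_L {f : ℍ → ℂ} : f ∈ 𝓛 ↔ ∃ e, Lo e f := Iff.rfl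

lemma smul_mem_L (hc : c ∈ O) (h : f ∈ 𝓛) : c • f ∈ 𝓛 := by
  obtain ⟨e, h⟩ := h
  exact ⟨e, h.smul hc⟩

lemma int_of_rep (h : f ∈ 𝓛) (hf : Rep e Q f) : Q ∈ IntP := by
  obtain ⟨e', P, h1, h2⟩ := h
  have h3 := hf.of_le (e - min e e').toNat
  have h4 := h2.of_le (e' - min e e').toNat
  rw [show e - ((e - min e e').toNat : ℤ) = min e e' by omega] at h3
  rw [show e' - ((e' - min e e').toNat : ℤ) = min e e' by omega] at h4
  have := h3.unique h4
  apply IntP_of_X_mul (k := (e - min e e').toNat)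
  rw [this]
  exact IntP.mul_mem (IntP.pow_mem IntP_X _) h1

lemma lo_of_rep (h : f ∈ 𝓛) (hf : Rep e Q f) : Lo e f := ⟨Q, int_of_rep h hf, hf⟩

lemma lc_unique (h : Lc e c f) (h' : Lc e c' f) : c = c' := by
  obtain ⟨P, h1, rfl, h2⟩ := h
  obtain ⟨Q, h3, rfl, h4⟩ := h'
  rw [h2.unique h4]

lemma lo_div {b : ℤ} (hf : Lc e 1 f) (hg : Rep e' Q g) (hfg : Lc b c (f * g)) :
    Lc (b - e) c g := by
  obtain ⟨P, h1, h0, h2⟩ := hf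
  obtain ⟨R, h3, rfl, h4⟩ := hfg
  set m := min e' (b - e)
  have h5 := hg.of_le (e' - m).toNat
  rw [show e' - ((e' - m).toNat : ℤ) = m by omega] at h5
  have h6 := h4.of_le (b - e - m).toNat
  rw [show b - ((b - e - m).toNat : ℤ) = e + m by omega] at h6
  have h7 := (h2.mul h5).unique h6
  have hP : PowerSeries.constantCoeff P ≠ 0 := by
    rw [← PowerSeries.coeff_zero_eq_constantCoeff_apply, h0]; exact one_ne_zero
  have h8 : PowerSeries.X ^ (e' - m).toNat * Q =
      PowerSeries.X ^ (b - e - m).toNat * (P⁻¹ * R) := by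
    have := congrArg (P⁻¹ * ·) h7
    simp only [← mul_assoc, PowerSeries.inv_mul_cancel P hP, one_mul] at this
    rw [← mul_assoc, this]; ring
  rw [h8, rep_shift, show m + ((b - e - m).toNat : ℤ) = b - e by omega] at h5
  refine ⟨_, IntP.mul_mem (IntP_inv h1 h0) h3, ?_, h5⟩
  simp at h0
  simp [h0]

lemma mem_of_mul_mem (hf : Lc e 1 f) (hg : Rep e' Q g) (hfg : f * g ∈ 𝓛) : g ∈ 𝓛 := by
  obtain ⟨b, h⟩ := hfg
  obtain ⟨c, _, h⟩ := h.lc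
  exact (lo_div hf hg h).mem

lemma q_tendsto : Filter.Tendsto q atImInfty (𝓝 0) := by
  have := UpperHalfPlane.qParam_tendsto_atImInfty (h := 1) one_pos
  exact this

lemma Rep.tendsto (hf : Rep e P f) : Filter.Tendsto (fun τ => f τ * q τ ^ (-e)) atImInfty
    (𝓝 (PowerSeries.coeff 0 P)) := by
  have hball : Metric.ball (0:ℂ) 1 ∈ 𝓝 (0:ℂ) := Metric.ball_mem_nhds _ one_pos
  have c1 := (hf.diffOn.differentiableAt hball).continuousAt
  have h0 : psum P 0 = PowerSeries.coeff 0 P := by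
    have := hf.hasSum_psum (z := 0) (by simp)
    refine this.unique ?_
    refine hs_congr (hasSum_ite_eq (0 : ℕ) (PowerSeries.coeff 0 P)) ?_ rfl
    intro n
    split_ifs with h <;> simp [h]
  have := c1.tendsto.comp q_tendsto
  rw [h0] at this
  refine this.congr fun τ => ?_
  exact (hf.hasSum_psum (q_lt τ)).unique (hf τ)

lemma lc_inv (hf : Lc e 1 f) (hne : ∀ τ, f τ ≠ 0) : Lc (-e) 1 (f⁻¹) := by
  obtain ⟨P, h1, h0, h2⟩ := hf
  have hm : MDiff (f⁻¹) := by
    have := h2.mdiff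
    rw [UpperHalfPlane.mdifferentiable_iff] at this ⊢
    exact this.inv fun z hz => hne _
  obtain ⟨Q, hQ⟩ := rep_exists (f := f⁻¹) hm (fun τ => by simp [h2.periodic]) (-e) (by
    have h3 := h2.tendsto
    rw [h0] at h3
    have h4 := h3.inv₀ one_ne_zero
    have := h4.isBigO_one ℝ
    rw [UpperHalfPlane.IsBoundedAtImInfty, Filter.BoundedAtFilter]
    refine this.congr_left fun τ => ?_
    simp [mul_comm])
  have := lo_div (b := 0) ⟨P, h1, h0, h2⟩ hQ (c := 1) (by
    rw [show f * f⁻¹ = 1 from by ext τ; simp [hne τ]]; exact lc_one)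
  simpa using this

/-! ### Frobenius -/

lemma frob_PS {P : PowerSeries ℂ} (hP : P ∈ IntP) :
    ∃ R ∈ IntP, PowerSeries.expand 11 (by norm_num) P - P ^ 11 = (11 : ℂ) • R := by
  obtain ⟨P, rfl⟩ := hP
  let J : Ideal O := Ideal.span {(11 : O)}
  let π := Ideal.Quotient.mk J
  have h11 : (11 : O ⧸ J) = 0 := by
    have : π (11 : O) = 0 := Ideal.Quotient.eq_zero_iff_mem.2 (Ideal.subset_span rfl)
    rwa [map_ofNat] at this
  have hnt : Nontrivial (O ⧸ J) := by
    apply Ideal.Quotient.nontrivial_iff.2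
    rw [Ne, Ideal.eq_top_iff_one, Ideal.mem_span_singleton]
    rintro ⟨w, hw⟩
    have h2 : ((1 : ℤ) : ℂ) = 11 ^ 1 * (w : ℂ) := by
      have := congrArg (Subtype.val) hw
      rw [Int.cast_one, pow_one]; exact this
    have := dvd_of_O w.2 h2
    norm_num at this
  have hch : CharP (O ⧸ J) 11 := by
    have := Fact.mk (show Nat.Prime 11 by norm_num)
    obtain ⟨c, hc⟩ := CharP.exists (O ⧸ J)
    have h3 : c ∣ 11 := (CharP.cast_eq_zero_iff (O ⧸ J) c 11).1 (by exact_mod_cast h11)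
    rcases (Nat.dvd_prime (by norm_num)).1 h3 with rfl | rfl
    · exact absurd hc (CharP.char_ne_one (O ⧸ J) 1 |> fun h => absurd rfl h)
    · exact hc
  have : ExpChar (O ⧸ J) 11 := ExpChar.prime (by norm_num)
  have hfr : frobenius (O ⧸ J) 11 = RingHom.id _ := by
    apply RingHom.ext
    intro x
    obtain ⟨x, rfl⟩ := Ideal.Quotient.mk_surjective x
    obtain ⟨w, hw, h⟩ := fermat_O x.2
    rw [frobenius_def, RingHom.id_apply, ← map_pow, Ideal.Quotient.eq, Ideal.mem_span_singleton]
    exact ⟨⟨w, hw⟩, Subtype.ext h⟩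
  have key : PowerSeries.map π (PowerSeries.expand 11 (by norm_num) P - P ^ 11) = 0 := by
    rw [map_sub, map_pow, PowerSeries.map_expand]
    have h5 := MvPowerSeries.map_frobenius_expand 11 (by norm_num) (f := PowerSeries.map π P)
    rw [hfr, MvPowerSeries.map_id] at h5
    rw [← h5]; exact sub_self _
  have hc : ∀ n, ∃ w : O, PowerSeries.coeff n (PowerSeries.expand 11 (by norm_num) P - P ^ 11)
      = 11 * w := by
    intro n
    have := congrArg (PowerSeries.coeff n) key
    rw [PowerSeries.coeff_map, map_zero, Ideal.Quotient.eq_zero_iff_mem,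
      Ideal.mem_span_singleton] at this
    exact this
  choose w hw using hc
  refine ⟨PowerSeries.map O.subtype (PowerSeries.mk w), ⟨_, rfl⟩, ?_⟩
  rw [← map_pow, ← PowerSeries.map_expand, ← map_sub]
  ext n
  rw [PowerSeries.coeff_map, hw, map_smul, PowerSeries.coeff_map, PowerSeries.coeff_mk, map_mul,
    map_ofNat, smul_eq_mul]

lemma frob_L (hf : f ∈ 𝓛) : ∃ h ∈ 𝓛, V f - f ^ 11 = (11 : ℂ) • h := by
  obtain ⟨e, P, h1, h2⟩ := hf
  obtain ⟨R, hR, h⟩ := frob_PS h1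
  have h3 := h2.V.sub (h2.pow 11)
  rw [h] at h3
  have h4 := h3.smul (1 / 11)
  rw [smul_smul, one_div, inv_mul_cancel₀ (by norm_num), one_smul] at h4
  refine ⟨_, ⟨_, R, hR, h4⟩, ?_⟩
  rw [smul_smul, mul_inv_cancel₀ (by norm_num), one_smul]

lemma L_U (hf : f ∈ 𝓛) : U f ∈ 𝓛 := by obtain ⟨e, h⟩ := hf; exact ⟨_, h.U⟩
lemma L_V (hf : f ∈ 𝓛) : V f ∈ 𝓛 := by obtain ⟨e, h⟩ := hf; exact ⟨_, h.V⟩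
lemma L_D (hf : f ∈ 𝓛) : Dq f ∈ 𝓛 := by obtain ⟨e, h⟩ := hf; exact ⟨_, h.D⟩

/-- If a combination of functions with leading terms `q^e` is integral then the
coefficients are integral. -/
lemma coeff_int {h : ℕ → ℍ → ℂ} (hh : ∀ e : ℕ, Lc e 1 (h e)) (d : ℕ → ℂ) (k : ℕ) : ∀ a : ℕ,
    (∑ i ∈ Finset.range k, d (a + i) • h (a + i)) ∈ 𝓛 → ∀ i < k, d (a + i) ∈ O := by
  induction k with
  | zero => intro a _ i hi; omega
  | succ k ih =>
    intro a hs
    have h1 : ∀ j (b : ℕ), ∃ P, Rep b P (∑ i ∈ Finset.range j, d (b + i) • h (b + i)) := by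
      intro j b
      induction j with
      | zero => exact ⟨0, fun τ => by simp⟩
      | succ j ihj =>
        obtain ⟨P, hP⟩ := ihj
        obtain ⟨R, hR⟩ := (hh (b + j)).lo.of_le (show (b : ℤ) ≤ (b + j : ℕ) by push_cast; omega)
        rw [Finset.sum_range_succ]
        exact ⟨_, hP.add (hR.2.smul _)⟩
    rw [Finset.sum_range_succ'] at hs
    have e1 : ∀ i, a + (i + 1) = (a + 1) + i := fun i => by ring
    rw [Finset.sum_congr rfl (fun i _ => by rw [e1 i]), add_zero] at hs
    obtain ⟨P, hP⟩ := h1 k (a + 1)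
    have h2 : Rep a (PowerSeries.X ^ 1 * P)
        (∑ i ∈ Finset.range k, d (a + 1 + i) • h (a + 1 + i)) := by
      rw [rep_shift]; exact_mod_cast hP
    obtain ⟨Q, hQ, hQ0, hQr⟩ := hh a
    have h3 := h2.add (hQr.smul (d a))
    have h4 := mem_IntP.1 (int_of_rep hs h3) 0
    have hd : d a ∈ O := by
      rw [map_add, map_smul, hQ0] at h4
      simpa using h4
    have h5 : ∑ i ∈ Finset.range k, d (a + 1 + i) • h (a + 1 + i) ∈ 𝓛 := by
      have := 𝓛.sub_mem hs (smul_mem_L hd (hh a).mem)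
      rwa [add_sub_cancel_right] at this
    intro i hi
    rcases i with _ | i
    · simpa using hd
    · rw [e1]; exact ih (a + 1) h5 i (by omega)

end X11

end

section

open UpperHalfPlane hiding I
open Complex Function
open scoped Manifold MatrixGroups Topology ModularForm

namespace X11

/-! ### Modular functions for `Γ₀(11)` -/

/-- `σ = γ τ` -/
def Rel (A B C D : ℤ) (σ τ : ℍ) : Prop := (σ : ℂ) * (C * τ + D) = A * τ + B

lemma denom_ne {A B C D : ℤ} (h : A * D - B * C = 1) (τ : ℍ) : (C : ℂ) * τ + D ≠ 0 := by
  intro h0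
  have h1 := congrArg Complex.im h0
  have h2 := congrArg Complex.re h0
  simp at h1 h2
  have hC : C = 0 := by
    rcases h1 with h1 | h1
    · exact h1
    · exact absurd h1 τ.im_pos.ne'
  subst hC
  simp at h2
  subst h2
  simp at h

lemma rel_smul (γ : SL(2, ℤ)) (τ : ℍ) : Rel (γ 0 0) (γ 0 1) (γ 1 0) (γ 1 1) (γ • τ) τ := by
  have hd := γ.2
  rw [Matrix.det_fin_two] at hd
  rw [Rel, coe_specialLinearGroup_apply]
  have := denom_ne hd τ
  simp only [algebraMap_int_eq, eq_intCast, Complex.ofReal_intCast]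
  rw [div_mul_cancel₀ _ this]

/-- matrix from entries -/
def mkSL (A B C D : ℤ) (h : A * D - B * C = 1) : SL(2, ℤ) :=
  ⟨!![A, B; C, D], by rw [Matrix.det_fin_two_of]; exact h⟩

lemma Rel.eq_smul {A B C D : ℤ} (h : A * D - B * C = 1) {σ τ : ℍ} (hr : Rel A B C D σ τ) :
    σ = mkSL A B C D h • τ := by
  apply UpperHalfPlane.ext
  have h2 : _ * ((C : ℂ) * τ + D) = A * τ + B := rel_smul (mkSL A B C D h) τ
  rw [Rel] at hr
  have := denom_ne h τ
  rw [← h2] at hr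
  exact mul_right_cancel₀ this hr

/-- invariance under `Γ₀(11)` -/
structure Mod (f : ℍ → ℂ) : Prop where
  md : MDiff f
  inv : ∀ A B C D : ℤ, A * D - B * C = 1 → 11 ∣ C → ∀ σ τ, Rel A B C D σ τ → f σ = f τ

/-- `τ ↦ -1/(11τ)` -/
noncomputable def wf (τ : ℍ) : ℍ := ⟨-1 / (11 * (τ : ℂ)), by
  have h := UpperHalfPlane.im_inv_neg_coe_pos (m11 τ)
  rw [coe_m11] at h
  rwa [neg_div, ← one_div, ← div_neg, one_div] at *⟩

lemma coe_wf (τ : ℍ) : ((wf τ : ℍ) : ℂ) = -1 / (11 * (τ : ℂ)) := rfl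

lemma wf_wf (τ : ℍ) : wf (wf τ) = τ := by
  apply UpperHalfPlane.ext
  have := τ.ne_zero
  rw [coe_wf, coe_wf]; field_simp

/-- The Fricke involution -/
noncomputable def W (f : ℍ → ℂ) : ℍ → ℂ := fun τ => f (wf τ)

lemma W_W (f : ℍ → ℂ) : W (W f) = f := by ext τ; simp [W, wf_wf]

variable {f g : ℍ → ℂ} {e : ℤ} {P : PowerSeries ℂ}

lemma mdiff_comp {u : ℍ → ℍ} {G : ℂ → ℂ} (hf : MDiff f) (hu : ∀ τ : ℍ, ((u τ : ℍ) : ℂ) = G τ)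
    (hG : ∀ τ : ℍ, DifferentiableAt ℂ G τ) : MDiff (fun τ => f (u τ)) := by
  rw [UpperHalfPlane.mdifferentiable_iff] at hf ⊢
  have h1 : Set.EqOn ((fun τ => f (u τ)) ∘ ofComplex) ((f ∘ ofComplex) ∘ G) upperHalfPlaneSet := by
    intro z hz
    simp only [Function.comp_apply]
    have : G z = u (ofComplex z) := by rw [hu, ofComplex_apply_of_im_pos hz]
    rw [this, ofComplex_apply]
  refine DifferentiableOn.congr ?_ h1
  refine hf.comp (fun z hz => (hG ⟨z, hz⟩).differentiableWithinAt) ?_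
  intro z hz
  have : G z = u ⟨z, hz⟩ := by rw [hu]
  rw [this]; exact (u ⟨z, hz⟩).im_pos

lemma Dq_comp {u : ℍ → ℍ} {G : ℂ → ℂ} {G' : ℂ} (hf : MDiff f)
    (hu : ∀ τ : ℍ, ((u τ : ℍ) : ℂ) = G τ) (τ : ℍ)
    (hG : HasDerivAt G G' τ) : Dq (fun τ => f (u τ)) τ = Dq f (u τ) * G' := by
  rw [UpperHalfPlane.mdifferentiable_iff] at hf
  have h1 : ((fun τ => f (u τ)) ∘ ofComplex) =ᶠ[𝓝 (τ : ℂ)] ((f ∘ ofComplex) ∘ G) := by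
    filter_upwards [isOpen_upperHalfPlaneSet.mem_nhds τ.im_pos] with z hz
    simp only [Function.comp_apply]
    have : G z = u (ofComplex z) := by rw [hu, ofComplex_apply_of_im_pos hz]
    rw [this, ofComplex_apply]
  have h2 : HasDerivAt (f ∘ ofComplex) (deriv (f ∘ ofComplex) (u τ)) (G τ) := by
    rw [← hu]
    exact (hf.differentiableAt (isOpen_upperHalfPlaneSet.mem_nhds (u τ).im_pos)).hasDerivAt
  have h3 := (HasDerivAt.comp (τ : ℂ) h2 hG).congr_of_eventuallyEq h1
  simp only [Dq, Derivative.normalizedDerivOfComplex]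
  rw [h3.deriv]; ring

lemma W_mdiff (hf : MDiff f) : MDiff (W f) :=
  mdiff_comp (f := f) (u := wf) (G := fun z => -1 / (11 * z)) hf coe_wf (fun τ => by
    have := τ.ne_zero
    refine DifferentiableAt.div (by fun_prop) (by fun_prop) ?_
    exact mul_ne_zero (by norm_num) this)

lemma dv_mdiff (hf : MDiff f) (i : ℤ) : MDiff (fun τ => f (dv i τ)) :=
  mdiff_comp (G := fun z => (z + i) / 11) hf (coe_dv i) (fun τ => by fun_prop)

lemma V_mdiff (hf : MDiff f) : MDiff (V f) :=
  mdiff_comp (f := f) (u := m11) (G := fun z => 11 * z) hf coe_m11 (fun τ => by fun_prop)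

lemma U_mdiff (hf : MDiff f) : MDiff (U f) := by
  have : ∀ n : ℕ, MDiff (fun τ => ∑ i ∈ Finset.range n, f (dv i τ)) := by
    intro n
    induction n with
    | zero => simpa using mdifferentiable_const
    | succ n ih => simp_rw [Finset.sum_range_succ]; exact ih.add (dv_mdiff hf n)
  exact mdifferentiable_const.mul (this 11)

lemma Mod.periodic (hf : Mod f) (i : ℤ) {σ τ : ℍ} (h : (σ : ℂ) = τ + i) : f σ = f τ :=
  hf.inv 1 i 0 1 (by ring) (by simp) σ τ (by rw [Rel, h]; push_cast; ring)

lemma Mod.vadd (hf : Mod f) (τ : ℍ) : f ((1 : ℝ) +ᵥ τ) = f τ :=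
  hf.periodic 1 (by rw [coe_vadd]; push_cast; ring)

lemma Mod.add (hf : Mod f) (hg : Mod g) : Mod (f + g) :=
  ⟨hf.md.add hg.md, fun A B C D h h' σ τ hr => by
    simp [hf.inv A B C D h h' σ τ hr, hg.inv A B C D h h' σ τ hr]⟩
lemma Mod.mul (hf : Mod f) (hg : Mod g) : Mod (f * g) :=
  ⟨hf.md.mul hg.md, fun A B C D h h' σ τ hr => by
    simp [hf.inv A B C D h h' σ τ hr, hg.inv A B C D h h' σ τ hr]⟩
lemma mod_const (c : ℂ) : Mod (fun _ => c) := ⟨mdifferentiable_const, fun _ _ _ _ _ _ _ _ _ => rfl⟩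
lemma mod_one : Mod 1 := mod_const 1
lemma Mod.smul (hf : Mod f) (c : ℂ) : Mod (c • f) := (mod_const c).mul hf
lemma Mod.neg (hf : Mod f) : Mod (-f) := by simpa using hf.smul (-1)
lemma Mod.sub (hf : Mod f) (hg : Mod g) : Mod (f - g) := by
  rw [sub_eq_add_neg]; exact hf.add hg.neg
lemma Mod.pow (hf : Mod f) (n : ℕ) : Mod (f ^ n) := by
  induction n with
  | zero => simpa using mod_one
  | succ n ih => rw [pow_succ]; exact ih.mul hf
lemma Mod.inv' (hf : Mod f) (hne : ∀ τ, f τ ≠ 0) : Mod (f⁻¹) := by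
  refine ⟨?_, fun A B C D h h' σ τ hr => by simp [hf.inv A B C D h h' σ τ hr]⟩
  have := hf.md
  rw [UpperHalfPlane.mdifferentiable_iff] at this ⊢
  exact this.inv fun z hz => hne _

lemma Mod.W (hf : Mod f) : Mod (W f) := by
  refine ⟨W_mdiff hf.md, ?_⟩
  rintro A B C D h ⟨C', rfl⟩ σ τ hr
  refine hf.inv D (-C') (-(11 * B)) A (by linear_combination h) ⟨-B, by ring⟩ _ _ ?_
  have h1 := σ.ne_zero
  have h2 := τ.ne_zero
  rw [Rel] at hr ⊢
  rw [coe_wf, coe_wf]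
  push_cast at hr ⊢
  field_simp
  linear_combination hr

lemma Mod.dv_congr (hf : Mod f) {i j : ℤ} (h : (11 : ℤ) ∣ i - j) (τ : ℍ) :
    f (dv i τ) = f (dv j τ) := by
  obtain ⟨k, hk⟩ := h
  refine hf.periodic k ?_
  rw [coe_dv, coe_dv, show i = j + 11 * k by omega]
  push_cast; ring

lemma sum_zmod (u : ℤ → ℂ) : ∑ i ∈ Finset.range 11, u i = ∑ z : ZMod 11, u (z.val : ℤ) := by
  rw [Finset.sum_range fun i : ℕ => u i]; rfl

lemma Mod.U (hf : Mod f) : Mod (U f) := by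
  refine ⟨U_mdiff hf.md, ?_⟩
  rintro A B C D h ⟨C', rfl⟩ σ τ hr
  rw [X11.U, X11.U, sum_zmod (fun i => f (dv i σ)), sum_zmod (fun i => f (dv i τ))]
  congr 1
  have hAD : (A : ZMod 11) * D = 1 := by
    have := congrArg (Int.cast : ℤ → ZMod 11) h
    push_cast at this
    have h11 : (11 : ZMod 11) = 0 := by decide
    rw [h11] at this
    linear_combination this
  have hb : Function.Bijective (fun z : ZMod 11 => (D : ZMod 11) * (B + z * D)) := by
    apply Function.Injective.bijective_of_finite
    intro z w hzw
    simp only at hzw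
    linear_combination (A : ZMod 11) ^ 2 * hzw + (w - z) * (A * D + 1) * hAD
  rw [← hb.sum_comp fun z : ZMod 11 => f (dv (z.val : ℤ) τ)]
  refine Finset.sum_congr rfl fun z _ => ?_
  set i : ℤ := (z.val : ℤ)
  set j : ℤ := (((D : ZMod 11) * (B + z * D)).val : ℤ)
  have hi : (i : ZMod 11) = z := by simp [i]
  have hj : (j : ZMod 11) = (D : ZMod 11) * (B + z * D) := by simp [j]
  have hd : (11 : ℤ) ∣ B + i * D - j * (A + i * (11 * C')) := by
    have := (ZMod.intCast_zmod_eq_zero_iff_dvd (B + i * D - j * (A + i * (11 * C'))) 11).1 (by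
      push_cast
      have h11 : (11 : ZMod 11) = 0 := by decide
      rw [hi, hj, h11]
      linear_combination -(B + z * D) * hAD)
    exact_mod_cast this
  obtain ⟨k, hk⟩ := hd
  refine hf.inv (A + i * (11 * C')) k (11 * (11 * C')) (D - 11 * C' * j) ?_ ⟨_, rfl⟩ _ _ ?_
  · linear_combination h + C' * hk * 11
  · rw [Rel] at hr ⊢
    have hk' : (B : ℂ) + i * D - j * (A + i * (11 * C')) = 11 * k := by exact_mod_cast hk
    rw [coe_dv, coe_dv]
    push_cast at hr ⊢
    field_simp
    linear_combination hr + hk'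

lemma key_identity (hf : Mod f) (τ : ℍ) :
    11 * W (U f) τ = V (W f) τ + 11 * V (U f) τ - f τ := by
  simp only [W, V, U]
  rw [sum_zmod (fun i => f (dv i (wf τ))), sum_zmod (fun i => f (dv i (m11 τ)))]
  have hb : Function.Bijective (fun z : ZMod 11 => - z⁻¹) := by
    have : Fact (Nat.Prime 11) := ⟨by norm_num⟩
    exact Function.Involutive.bijective fun z => by simp
  rw [← hb.sum_comp fun z : ZMod 11 => f (dv (z.val : ℤ) (m11 τ))]
  rw [← Finset.add_sum_erase _ _ (Finset.mem_univ (0 : ZMod 11)),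
    ← Finset.add_sum_erase _ (fun z : ZMod 11 => f (dv ((-z⁻¹).val : ℤ) (m11 τ)))
      (Finset.mem_univ (0 : ZMod 11))]
  have h1 : f (dv ((0 : ZMod 11).val : ℤ) (wf τ)) = f (wf (m11 τ)) := by
    congr 1
    apply UpperHalfPlane.ext
    rw [coe_dv, coe_wf, coe_wf, coe_m11]
    simp; ring
  have h2 : f (dv ((-(0 : ZMod 11)⁻¹).val : ℤ) (m11 τ)) = f τ := by
    congr 1
    apply UpperHalfPlane.ext
    rw [coe_dv, coe_m11, show -(0 : ZMod 11)⁻¹ = 0 by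
      have : Fact (Nat.Prime 11) := ⟨by norm_num⟩
      simp]
    simp
  rw [h1, h2]
  have h3 : ∑ x ∈ Finset.univ.erase (0 : ZMod 11), f (dv (x.val : ℤ) (wf τ)) =
      ∑ x ∈ Finset.univ.erase (0 : ZMod 11), f (dv ((-x⁻¹).val : ℤ) (m11 τ)) := by
    refine Finset.sum_congr rfl fun z hz => ?_
    have hz0 : z ≠ 0 := by simpa using hz
    set i : ℤ := (z.val : ℤ)
    set j : ℤ := ((-z⁻¹).val : ℤ)
    have hi : (i : ZMod 11) = z := by simp [i]
    have hj : (j : ZMod 11) = -z⁻¹ := by simp [j]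
    have hd : (11 : ℤ) ∣ i * j + 1 := by
      have := (ZMod.intCast_zmod_eq_zero_iff_dvd (i * j + 1) 11).1 (by
        push_cast
        rw [hi, hj]
        have : Fact (Nat.Prime 11) := ⟨by norm_num⟩
        field_simp; ring)
      exact_mod_cast this
    obtain ⟨k, hk⟩ := hd
    refine hf.inv i (-k) 11 (-j) (by linear_combination -hk) dvd_rfl _ _ ?_
    have hk' : (i : ℂ) * j + 1 = 11 * k := by exact_mod_cast hk
    have := τ.ne_zero
    rw [Rel, coe_dv, coe_dv, coe_wf, coe_m11]
    push_cast
    field_simp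
    linear_combination (-11 * (τ : ℂ)) * hk'
  rw [h3]; ring

lemma im_dv (i : ℤ) (τ : ℍ) : (dv i τ).im = τ.im / 11 := by
  rw [← coe_im, coe_dv]; simp

lemma bdd_dv (h : IsBoundedAtImInfty f) (i : ℤ) : IsBoundedAtImInfty (fun τ => f (dv i τ)) := by
  rw [isBoundedAtImInfty_iff] at h ⊢
  obtain ⟨M, A, h⟩ := h
  refine ⟨M, 11 * A, fun τ hτ => h _ ?_⟩
  rw [im_dv]; linarith

/-- A function on `X₀(11)` without poles is constant. -/
lemma const_of_bdd (hf : Mod f) (h1 : IsBoundedAtImInfty f) (h2 : IsBoundedAtImInfty (W f)) :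
    ∃ c, f = fun _ => c := by
  have hinv : ∀ γ : SL(2, ℤ), γ ∈ CongruenceSubgroup.Gamma0 11 → ∀ τ, f (γ • τ) = f τ := by
    intro γ hγ τ
    have hd := γ.2
    rw [Matrix.det_fin_two] at hd
    refine hf.inv _ _ _ _ hd ?_ _ _ (rel_smul γ τ)
    rw [CongruenceSubgroup.Gamma0_mem] at hγ
    have := (ZMod.intCast_zmod_eq_zero_iff_dvd (γ 1 0) 11).1 hγ
    exact_mod_cast this
  have hbd : ∀ γ : SL(2, ℤ), IsBoundedAtImInfty (fun τ => f (γ • τ)) := by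
    intro γ
    by_cases hc : (11 : ℤ) ∣ γ 1 0
    · have : (fun τ => f (γ • τ)) = f := by
        ext τ
        refine hinv γ ?_ τ
        rw [CongruenceSubgroup.Gamma0_mem]
        exact (ZMod.intCast_zmod_eq_zero_iff_dvd (γ 1 0) 11).2 (by exact_mod_cast hc)
      rw [this]; exact h1
    · have hd := γ.2
      rw [Matrix.det_fin_two] at hd
      set a := γ 0 0
      set b := γ 0 1
      set c := γ 1 0
      set d := γ 1 1
      have hcop : IsCoprime (11 : ℤ) c := by
        refine (Int.isCoprime_iff_gcd_eq_one).2 ?_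
        rcases (Nat.coprime_or_dvd_of_prime (show Nat.Prime 11 by norm_num) c.natAbs) with h | h
        · exact h
        · exact absurd (Int.natCast_dvd.2 h) hc
      obtain ⟨u, v, huv⟩ := hcop
      set k := v * d
      have : (fun τ => f (γ • τ)) = fun τ => W f (dv k τ) := by
        ext τ
        refine hf.inv (b - a * k) (-a) (d - c * k) (-c) (by linear_combination hd)
          ⟨u * d, by linear_combination -d * huv⟩ _ _ ?_
        have hr := rel_smul γ τ
        rw [Rel] at hr ⊢
        have e1 : ((wf (dv k τ) : ℍ) : ℂ) = -1 / (τ + k) := by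
          rw [coe_wf, coe_dv]; congr 1; ring
        have e2 : (τ : ℂ) + k ≠ 0 := by
          have := (denom_ne (A := 0) (B := -1) (C := 1) (D := k) (by ring) τ)
          simpa using this
        rw [e1]
        push_cast
        field_simp
        change _ * ((c : ℂ) * τ + d) = a * τ + b at hr
        linear_combination -hr
      rw [this]; exact bdd_dv h2 k
  let F : ModularForm ((CongruenceSubgroup.Gamma0 11 : Subgroup SL(2, ℤ)) :
      Subgroup (GL (Fin 2) ℝ)) 0 :=
    { toFun := f
      slash_action_eq' := by
        rintro _ ⟨γ, hγ, rfl⟩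
        ext τ
        have := hinv γ hγ τ
        change (f ∣[(0 : ℤ)] γ) τ = f τ
        rw [ModularForm.SL_slash_apply]
        simpa using this
      holo' := hf.md
      bdd_at_cusps' := by
        intro c hc
        have hc' : IsCusp c 𝒮ℒ := by
          exact hc.mono (Subgroup.map_le_range _ _)
        rw [OnePoint.isBoundedAt_iff_forall_SL2Z hc']
        intro γ _
        have : f ∣[(0 : ℤ)] γ = fun τ => f (γ • τ) := by
          ext τ
          rw [ModularForm.SL_slash_apply]; simp
        rw [this]; exact hbd γ }
  obtain ⟨c, hc⟩ := ModularForm.eq_const_of_weight_zero F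
  exact ⟨c, hc⟩

end X11

end

section

open UpperHalfPlane hiding I
open Complex Function
open scoped Manifold MatrixGroups Topology ModularForm

namespace X11

/-! ### The Euler product -/

/-- weight of a partition into distinct parts -/
def wt (s : Finset ℕ) : ℕ := ∑ i ∈ s, (i + 1)

/-- coefficients of the Euler product -/
def ppc (n : ℕ) : ℤ := ∑ s ∈ (Finset.range n).powerset with wt s = n, (-1) ^ s.card

lemma wt_fiber (n : ℕ) : wt ⁻¹' {n} = (((Finset.range n).powerset.filter (wt · = n) : Finset (Finset ℕ)) : Set (Finset ℕ)) := by
  ext s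
  simp only [Set.mem_preimage, Set.mem_singleton_iff, Finset.coe_filter, Finset.mem_powerset, Set.mem_ofPred_eq,
    iff_and_self]
  intro h i hi
  rw [Finset.mem_range, ← h]
  exact lt_of_lt_of_le (Nat.lt_succ_self i) (Finset.single_le_sum (f := fun i => i + 1) (fun _ _ => Nat.zero_le _) hi)

/-- the Euler product -/
noncomputable def PP (τ : ℍ) : ℂ := ∏' n : ℕ, (1 - q τ ^ (n + 1))

lemma PP_ne (τ : ℍ) : PP τ ≠ 0 := ModularForm.eta_tprod_ne_zero τ.2

lemma rep_PP : Rep 0 (PowerSeries.mk fun n => (ppc n : ℂ)) PP := by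
  intro τ
  have h0 : Summable fun n : ℕ => ‖-q τ ^ (n + 1)‖ := ModularForm.summable_eta_q τ
  have h1 := summable_finsetProd_of_summable_norm h0
  have h2 := tprod_one_add h1
  have h3 := h1.hasSum
  rw [← h2] at h3
  have h4 := h3.tsum_fiberwise wt
  refine hs_congr h4 (fun n => ?_) (by simp [PP, sub_eq_add_neg])
  rw [wt_fiber, Finset.tsum_subtype' _ (fun s => ∏ i ∈ s, -q τ ^ (i + 1)), PowerSeries.coeff_mk, ppc, Int.cast_sum,
    Finset.sum_mul]
  refine Finset.sum_congr rfl fun s hs => ?_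
  have hw : wt s = n := (Finset.mem_filter.mp hs).2
  subst hw
  rw [Finset.prod_neg, Finset.prod_pow_eq_pow_sum]
  push_cast
  rfl

lemma ppc_vals : ppc 0 = 1 ∧ ppc 1 = -1 ∧ ppc 2 = -1 ∧ ppc 3 = 0 ∧ ppc 4 = 0 := by
  refine ⟨?_, ?_, ?_, ?_, ?_⟩ <;> decide

lemma lc_PP : Lc 0 1 PP := by
  refine ⟨_, ?_, ?_, rep_PP⟩
  · rw [mem_IntP]; intro n; rw [PowerSeries.coeff_mk]; exact int_mem_O _
  · rw [PowerSeries.coeff_mk, ppc_vals.1]; simp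

/-- Euler product at `11τ` -/
noncomputable def P11 : ℍ → ℂ := V PP

lemma P11_ne (τ : ℍ) : P11 τ ≠ 0 := PP_ne _

lemma lc_P11 : Lc 0 1 P11 := by simpa [P11] using lc_PP.V

/-- `η²` -/
noncomputable def Hf (τ : ℍ) : ℂ := ModularForm.eta (τ : ℂ) ^ 2

lemma Hf_ne (τ : ℍ) : Hf τ ≠ 0 := pow_ne_zero _ (ModularForm.eta_ne_zero τ.2)

lemma Hf_eq (τ : ℍ) : Hf τ = Complex.exp (2 * Real.pi * I * τ / 12) * PP τ ^ 2 := by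
  rw [Hf, ModularForm.eta, mul_pow]
  congr 1
  rw [Periodic.qParam, ← Complex.exp_nsmul]
  congr 1
  push_cast
  simp
  ring

/-- twelfth root of unity -/
noncomputable def z12 : ℂ := Complex.exp (2 * Real.pi * I / 12)

lemma z12_ne : z12 ≠ 0 := Complex.exp_ne_zero _

lemma z12_pow : z12 ^ 12 = 1 := by
  rw [z12, ← Complex.exp_nsmul, ← Complex.exp_two_pi_mul_I]
  congr 1
  simp
  ring

lemma z12_three : z12 ^ 3 = I := by
  rw [z12, ← Complex.exp_nsmul, ← Complex.exp_pi_div_two_mul_I]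
  congr 1
  simp
  ring

lemma Hf_T (τ : ℍ) : Hf ((1 : ℝ) +ᵥ τ) = z12 * Hf τ := by
  rw [Hf_eq, Hf_eq, ← mul_assoc, z12, ← Complex.exp_add]
  have h1 : PP ((1 : ℝ) +ᵥ τ) = PP τ := by
    unfold PP; simp only [q_vadd]
  rw [h1]
  congr 2
  rw [UpperHalfPlane.coe_vadd]
  push_cast
  ring

lemma csqrt_sq {z : ℂ} (hz : z ≠ 0) : Complex.sqrt z ^ 2 = z := by
  rw [sqrt_eq_exp hz, ← Complex.exp_nat_mul]
  push_cast
  rw [mul_div_cancel₀ _ two_ne_zero, Complex.exp_log hz]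

lemma Hf_S {σ τ : ℍ} (h : (σ : ℂ) = -1 / τ) : Hf σ = -I * τ * Hf τ := by
  have h1 := ModularForm.eta_comp_eq_csqrt_I_inv (x := (τ : ℂ)) τ.2
  simp only [Function.comp_apply, Pi.smul_apply, Pi.mul_apply, smul_eq_mul] at h1
  rw [Hf, h, h1, Hf, mul_pow, mul_pow, inv_pow, csqrt_sq Complex.I_ne_zero, csqrt_sq τ.ne_zero, Complex.inv_I]
  ring

/-- exponent of the `η²` multiplier -/
def psi (a b c d : ℤ) : ℤ := (1 - c ^ 2) * (b * d + 3 * (c - 1) * d + c + 3) + c * (a + d - 3)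

lemma twelve_dvd {x : ℤ} (h3 : (x : ZMod 3) = 0) (h4 : (x : ZMod 4) = 0) : 12 ∣ x := by
  rw [ZMod.intCast_zmod_eq_zero_iff_dvd] at h3 h4
  push_cast at h3 h4
  omega

lemma psi_T (a b c d : ℤ) (h : a * d - b * c = 1) : 12 ∣ psi a (a + b) c (c + d) - (psi a b c d + 1) := by
  have k3 : ∀ a b c d : ZMod 3, a * d - b * c = 1 → ((1 - c ^ 2) * ((a + b) * (c + d) + 3 * (c - 1) * (c + d) + c + 3) + c * (a + (c + d) - 3)) -
     ((1 - c ^ 2) * (b * d + 3 * (c - 1) * d + c + 3) + c * (a + d - 3) + 1) = 0 := by decide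
  have k4 : ∀ a b c d : ZMod 4, a * d - b * c = 1 → ((1 - c ^ 2) * ((a + b) * (c + d) + 3 * (c - 1) * (c + d) + c + 3) + c * (a + (c + d) - 3)) -
     ((1 - c ^ 2) * (b * d + 3 * (c - 1) * d + c + 3) + c * (a + d - 3) + 1) = 0 := by decide
  refine twelve_dvd ?_ ?_
  · have := k3 a b c d (by exact_mod_cast congrArg (Int.cast : ℤ → ZMod 3) h)
    rw [← this, psi, psi]; push_cast; rfl
  · have := k4 a b c d (by exact_mod_cast congrArg (Int.cast : ℤ → ZMod 4) h)
    rw [← this, psi, psi]; push_cast; rfl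

lemma psi_S (a b c d : ℤ) (h : a * d - b * c = 1) : 12 ∣ psi b (-a) d (-c) - (psi a b c d - 3) := by
  have k3 : ∀ a b c d : ZMod 3, a * d - b * c = 1 → ((1 - d ^ 2) * ((-a) * (-c) + 3 * (d - 1) * (-c) + d + 3) + d * (b + (-c) - 3)) -
     ((1 - c ^ 2) * (b * d + 3 * (c - 1) * d + c + 3) + c * (a + d - 3) - 3) = 0 := by decide
  have k4 : ∀ a b c d : ZMod 4, a * d - b * c = 1 → ((1 - d ^ 2) * ((-a) * (-c) + 3 * (d - 1) * (-c) + d + 3) + d * (b + (-c) - 3)) -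
     ((1 - c ^ 2) * (b * d + 3 * (c - 1) * d + c + 3) + c * (a + d - 3) - 3) = 0 := by decide
  refine twelve_dvd ?_ ?_
  · have := k3 a b c d (by exact_mod_cast congrArg (Int.cast : ℤ → ZMod 3) h)
    rw [← this, psi, psi]; push_cast; rfl
  · have := k4 a b c d (by exact_mod_cast congrArg (Int.cast : ℤ → ZMod 4) h)
    rw [← this, psi, psi]; push_cast; rfl

lemma psi_11 (a b c d : ℤ) (h : a * d - b * (11 * c) = 1) : 12 ∣ psi a b (11 * c) d + psi a (11 * b) c d := by
  have k3 : ∀ a b c d : ZMod 3, a * d - b * (11 * c) = 1 → ((1 - (11 * c) ^ 2) * (b * d + 3 * ((11 * c) - 1) * d + (11 * c) + 3) + (11 * c) * (a + d - 3)) +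
     ((1 - c ^ 2) * ((11 * b) * d + 3 * (c - 1) * d + c + 3) + c * (a + d - 3)) = 0 := by decide
  have k4 : ∀ a b c d : ZMod 4, a * d - b * (11 * c) = 1 → ((1 - (11 * c) ^ 2) * (b * d + 3 * ((11 * c) - 1) * d + (11 * c) + 3) + (11 * c) * (a + d - 3)) +
     ((1 - c ^ 2) * ((11 * b) * d + 3 * (c - 1) * d + c + 3) + c * (a + d - 3)) = 0 := by decide
  refine twelve_dvd ?_ ?_
  · have := k3 a b c d (by exact_mod_cast congrArg (Int.cast : ℤ → ZMod 3) h)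
    rw [← this, psi, psi]; push_cast; rfl
  · have := k4 a b c d (by exact_mod_cast congrArg (Int.cast : ℤ → ZMod 4) h)
    rw [← this, psi, psi]; push_cast; rfl

lemma z12_congr {a b : ℤ} (h : 12 ∣ a - b) : z12 ^ a = z12 ^ b := by
  obtain ⟨k, hk⟩ := h
  have : a = 12 * k + b := by omega
  rw [this, zpow_add₀ z12_ne, zpow_mul, show z12 ^ (12 : ℤ) = 1 from z12_pow, one_zpow, one_mul]

/-- transformation law of `η²` for one matrix -/
def HT (γ : SL(2, ℤ)) : Prop :=
  ∀ τ : ℍ, Hf (γ • τ) = z12 ^ psi (γ 0 0) (γ 0 1) (γ 1 0) (γ 1 1) * ((γ 1 0 : ℤ) * τ + (γ 1 1 : ℤ)) * Hf τ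

lemma det4 (γ : SL(2, ℤ)) : γ 0 0 * γ 1 1 - γ 0 1 * γ 1 0 = 1 := by
  have hd := γ.2
  rwa [Matrix.det_fin_two] at hd

lemma HT.T {γ : SL(2, ℤ)} (h : HT γ) : HT (γ * ModularGroup.T) := by
  intro τ
  have e00 : (γ * ModularGroup.T) 0 0 = γ 0 0 := by
    rw [Matrix.SpecialLinearGroup.coe_mul, ModularGroup.coe_T]; simp [Matrix.mul_apply, Fin.sum_univ_two]
  have e01 : (γ * ModularGroup.T) 0 1 = γ 0 0 + γ 0 1 := by
    rw [Matrix.SpecialLinearGroup.coe_mul, ModularGroup.coe_T]; simp [Matrix.mul_apply, Fin.sum_univ_two]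
  have e10 : (γ * ModularGroup.T) 1 0 = γ 1 0 := by
    rw [Matrix.SpecialLinearGroup.coe_mul, ModularGroup.coe_T]; simp [Matrix.mul_apply, Fin.sum_univ_two]
  have e11 : (γ * ModularGroup.T) 1 1 = γ 1 0 + γ 1 1 := by
    rw [Matrix.SpecialLinearGroup.coe_mul, ModularGroup.coe_T]; simp [Matrix.mul_apply, Fin.sum_univ_two]
  rw [e00, e01, e10, e11, mul_smul, h, z12_congr (psi_T _ _ _ _ (det4 γ)), UpperHalfPlane.modular_T_smul, Hf_T,
    zpow_add₀ z12_ne, zpow_one, UpperHalfPlane.coe_vadd]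
  push_cast
  ring

lemma HT.T' {γ : SL(2, ℤ)} (h : HT γ) : HT (γ * ModularGroup.T⁻¹) := by
  intro τ
  obtain ⟨γ', hγ⟩ : ∃ γ', γ' * ModularGroup.T = γ := ⟨γ * ModularGroup.T⁻¹, by simp⟩
  obtain ⟨τ', hτ⟩ : ∃ τ', ModularGroup.T • τ' = τ := ⟨ModularGroup.T⁻¹ • τ, by simp⟩
  subst hγ hτ
  have hh := h τ'
  have e00 : (γ' * ModularGroup.T) 0 0 = γ' 0 0 := by
    rw [Matrix.SpecialLinearGroup.coe_mul, ModularGroup.coe_T]; simp [Matrix.mul_apply, Fin.sum_univ_two]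
  have e01 : (γ' * ModularGroup.T) 0 1 = γ' 0 0 + γ' 0 1 := by
    rw [Matrix.SpecialLinearGroup.coe_mul, ModularGroup.coe_T]; simp [Matrix.mul_apply, Fin.sum_univ_two]
  have e10 : (γ' * ModularGroup.T) 1 0 = γ' 1 0 := by
    rw [Matrix.SpecialLinearGroup.coe_mul, ModularGroup.coe_T]; simp [Matrix.mul_apply, Fin.sum_univ_two]
  have e11 : (γ' * ModularGroup.T) 1 1 = γ' 1 0 + γ' 1 1 := by
    rw [Matrix.SpecialLinearGroup.coe_mul, ModularGroup.coe_T]; simp [Matrix.mul_apply, Fin.sum_univ_two]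
  rw [e00, e01, e10, e11, mul_smul, z12_congr (psi_T _ _ _ _ (det4 γ')), zpow_add₀ z12_ne, zpow_one] at hh
  rw [mul_inv_cancel_right, hh, UpperHalfPlane.modular_T_smul, Hf_T, UpperHalfPlane.coe_vadd]
  push_cast
  ring

lemma HT.S {γ : SL(2, ℤ)} (h : HT γ) : HT (γ * ModularGroup.S) := by
  intro τ
  have e00 : (γ * ModularGroup.S) 0 0 = γ 0 1 := by
    rw [Matrix.SpecialLinearGroup.coe_mul, ModularGroup.coe_S]; simp [Matrix.mul_apply, Fin.sum_univ_two]
  have e01 : (γ * ModularGroup.S) 0 1 = -γ 0 0 := by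
    rw [Matrix.SpecialLinearGroup.coe_mul, ModularGroup.coe_S]; simp [Matrix.mul_apply, Fin.sum_univ_two]
  have e10 : (γ * ModularGroup.S) 1 0 = γ 1 1 := by
    rw [Matrix.SpecialLinearGroup.coe_mul, ModularGroup.coe_S]; simp [Matrix.mul_apply, Fin.sum_univ_two]
  have e11 : (γ * ModularGroup.S) 1 1 = -γ 1 0 := by
    rw [Matrix.SpecialLinearGroup.coe_mul, ModularGroup.coe_S]; simp [Matrix.mul_apply, Fin.sum_univ_two]
  have hs : ((ModularGroup.S • τ : ℍ) : ℂ) = -1 / τ := by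
    rw [UpperHalfPlane.modular_S_smul, UpperHalfPlane.coe_mk, neg_div, one_div, inv_neg]
  have h3 : z12 ^ (3 : ℤ) = I := z12_three
  rw [e00, e01, e10, e11, mul_smul, h, z12_congr (psi_S _ _ _ _ (det4 γ)), Hf_S hs, zpow_sub₀ z12_ne, hs, h3]
  have := τ.ne_zero
  have hI := Complex.I_sq
  push_cast
  rw [Complex.div_I]
  field_simp
  ring

lemma HT_all (γ : SL(2, ℤ)) : HT γ := by
  have : γ ∈ Subgroup.closure {ModularGroup.S, ModularGroup.T} := by
    simp [SpecialLinearGroup.SL2Z_generators]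
  induction this using Subgroup.closure_induction_right with
  | one =>
    intro τ
    have : psi 1 0 0 1 = 0 := by decide
    simp [this]
  | mul_right x hx y hy h =>
    rcases hy with rfl | rfl
    · exact h.S
    · exact h.T
  | mul_inv_cancel x hx y hy h =>
    rcases hy with rfl | rfl
    · have e : ModularGroup.S⁻¹ = ModularGroup.S * ModularGroup.S * ModularGroup.S := by decide
      rw [e, ← mul_assoc, ← mul_assoc]
      exact h.S.S.S
    · exact h.T'

lemma Hf_rel {A B C D : ℤ} (h : A * D - B * C = 1) {σ τ : ℍ} (hr : Rel A B C D σ τ) :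
    Hf σ = z12 ^ psi A B C D * (C * τ + D) * Hf τ := by
  have := HT_all (mkSL A B C D h) τ
  rw [← hr.eq_smul] at this
  exact this

end X11

end

section

open UpperHalfPlane hiding I
open Complex Function
open scoped Manifold MatrixGroups Topology ModularForm

namespace X11

/-- weight two invariance for `Γ₀(11)` -/
def Wt2 (f : ℍ → ℂ) : Prop :=
  ∀ A B C D : ℤ, A * D - B * (11 * C) = 1 → ∀ σ τ, Rel A B (11 * C) D σ τ →
    f σ = (11 * C * τ + D) ^ 2 * f τ

lemma Rel.m11 {A B C D : ℤ} {σ τ : ℍ} (h : Rel A B (11 * C) D σ τ) :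
    Rel A (11 * B) C D (m11 σ) (m11 τ) := by
  rw [Rel] at *
  rw [coe_m11, coe_m11]
  push_cast at *
  linear_combination 11 * h

/-- the cusp form `η(τ)²η(11τ)²` -/
noncomputable def S : ℍ → ℂ := Hf * V Hf

lemma S_ne (τ : ℍ) : S τ ≠ 0 := mul_ne_zero (Hf_ne _) (Hf_ne _)

lemma VHf_rel {A B C D : ℤ} (h : A * D - B * (11 * C) = 1) {σ τ : ℍ} (hr : Rel A B (11 * C) D σ τ) :
    V Hf σ = z12 ^ psi A (11 * B) C D * (11 * C * τ + D) * V Hf τ := by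
  have := Hf_rel (by linarith) hr.m11
  rw [V, this, coe_m11]
  ring_nf
  rfl

lemma S_wt : Wt2 S := by
  intro A B C D h σ τ hr
  have h1 := Hf_rel h hr
  have h2 := VHf_rel h hr
  have h3 : z12 ^ psi A B (11 * C) D * z12 ^ psi A (11 * B) C D = 1 := by
    rw [← zpow_add₀ z12_ne]
    exact z12_congr (b := 0) (by simpa using psi_11 A B C D h)
  simp only [S, Pi.mul_apply]
  rw [h1, h2]
  push_cast
  linear_combination (11 * C * τ + D) ^ 2 * (Hf τ * V Hf τ) * h3

lemma Hf_wf (τ : ℍ) : Hf (wf τ) = -I * (11 * τ) * V Hf τ :=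
  Hf_S (τ := m11 τ) (by rw [coe_wf, coe_m11])

lemma VHf_wf (τ : ℍ) : V Hf (wf τ) = -I * τ * Hf τ :=
  Hf_S (by
    rw [coe_m11, coe_wf]
    have := τ.ne_zero
    field_simp)

lemma S_wf (τ : ℍ) : S (wf τ) = -11 * τ ^ 2 * S τ := by
  simp only [S, Pi.mul_apply]
  rw [Hf_wf, VHf_wf]
  linear_combination 11 * τ ^ 2 * (Hf τ * V Hf τ) * Complex.I_sq

lemma VHf_eq (τ : ℍ) : V Hf τ = Complex.exp (2 * Real.pi * I * (11 * τ) / 12) * P11 τ ^ 2 := by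
  rw [V, Hf_eq, coe_m11]; rfl

lemma S_eq : S = (fun τ => q τ ^ (1 : ℤ)) * (PP ^ 2 * P11 ^ 2) := by
  ext τ
  simp only [S, Pi.mul_apply, Pi.pow_apply]
  rw [Hf_eq, VHf_eq, q_def, zpow_one]
  have : Complex.exp (2 * Real.pi * I * τ) = Complex.exp (2 * Real.pi * I * τ / 12) * Complex.exp (2 * Real.pi * I * (11 * τ) / 12) := by
    rw [← Complex.exp_add]; congr 1; ring
  rw [this]; ring

lemma lc_qpow (e : ℤ) : Lc e 1 (fun τ => q τ ^ e) := ⟨1, IntP.one_mem, by simp, rep_qpow e⟩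

lemma lc_S : Lc 1 1 S := by
  rw [S_eq]
  simpa using (lc_qpow 1).mul ((lc_PP.pow 2).mul (lc_P11.pow 2))

/-- `(η(τ)/η(11τ))^12` -/
noncomputable def phi : ℍ → ℂ := (Hf * (V Hf)⁻¹) ^ 6

/-- `(η(11τ)/η(τ))^12` -/
noncomputable def tt : ℍ → ℂ := phi⁻¹

lemma phi_ne (τ : ℍ) : phi τ ≠ 0 := pow_ne_zero _ (mul_ne_zero (Hf_ne _) (inv_ne_zero (Hf_ne _)))

lemma phi_tt : phi * tt = 1 := by
  ext τ
  simp [tt, phi_ne]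

lemma phi_eq : phi = (fun τ => q τ ^ (-5 : ℤ)) * (PP ^ 12 * (P11 ^ 12)⁻¹) := by
  ext τ
  simp only [phi, Pi.mul_apply, Pi.pow_apply, Pi.inv_apply]
  rw [Hf_eq, VHf_eq, q_def, ← Complex.exp_int_mul]
  have : Complex.exp (2 * Real.pi * I * τ / 12) ^ 6 = Complex.exp (((-5 : ℤ) : ℂ) * (2 * Real.pi * I * τ)) * Complex.exp (2 * Real.pi * I * (11 * τ) / 12) ^ 6 := by
    rw [← Complex.exp_nsmul, ← Complex.exp_nsmul, ← Complex.exp_add]; congr 1; push_cast; simp; ring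
  rw [mul_pow, mul_pow, this]
  have := Complex.exp_ne_zero (2 * Real.pi * I * (11 * τ) / 12)
  have := P11_ne τ
  field_simp

lemma lc_phi : Lc (-5) 1 phi := by
  rw [phi_eq]
  have h := lc_inv (lc_P11.pow 12) (fun τ => pow_ne_zero _ (P11_ne τ))
  simpa using (lc_qpow (-5)).mul ((lc_PP.pow 12).mul h)

lemma lc_tt : Lc 5 1 tt := by simpa [tt] using lc_inv lc_phi phi_ne

lemma mod_phi : Mod phi := by
  obtain ⟨P, -, -, hP⟩ := lc_phi
  refine ⟨hP.mdiff, fun A B C D h hC σ τ hr => ?_⟩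
  obtain ⟨C, rfl⟩ := hC
  have h1 := Hf_rel h hr
  have h2 := VHf_rel h hr
  have h3 : (z12 ^ psi A B (11 * C) D) ^ 6 = (z12 ^ psi A (11 * B) C D) ^ 6 := by
    rw [← zpow_natCast, ← zpow_natCast, ← zpow_mul, ← zpow_mul]
    apply z12_congr
    have := psi_11 A B C D h
    push_cast
    omega
  have h4 := denom_ne h τ
  push_cast at h4 h1
  simp only [phi, Pi.mul_apply, Pi.pow_apply, Pi.inv_apply]
  rw [h1, h2]
  have h5 := zpow_ne_zero (psi A (11 * B) C D) z12_ne
  have h6 : V Hf τ ≠ 0 := Hf_ne _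
  rw [mul_pow, mul_pow, mul_pow, h3]
  field_simp

lemma mod_tt : Mod tt := mod_phi.inv' phi_ne

lemma W_phi : W phi = (11 ^ 6 : ℂ) • tt := by
  ext τ
  have h6 : V Hf τ ≠ 0 := Hf_ne _
  have h5 : Hf τ ≠ 0 := Hf_ne _
  have := τ.ne_zero
  have := Complex.I_ne_zero
  simp only [W, phi, tt, Pi.mul_apply, Pi.pow_apply, Pi.inv_apply, Pi.smul_apply, smul_eq_mul]
  rw [Hf_wf, VHf_wf]
  field_simp

lemma W_mul (f g : ℍ → ℂ) : W (f * g) = W f * W g := rfl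
lemma W_add (f g : ℍ → ℂ) : W (f + g) = W f + W g := rfl
lemma W_sub (f g : ℍ → ℂ) : W (f - g) = W f - W g := rfl
lemma W_smul (c : ℂ) (f : ℍ → ℂ) : W (c • f) = c • W f := rfl
lemma W_pow (f : ℍ → ℂ) (n : ℕ) : W (f ^ n) = W f ^ n := rfl
lemma W_one : W 1 = 1 := rfl

/-! ### The Eisenstein series -/

/-- the constant in the transformation law of `E2` -/
noncomputable def kap : ℂ := 1 / (2 * riemannZeta 2) * (2 * Real.pi * I)

lemma E2_rel {A B C D : ℤ} (h : A * D - B * C = 1) {σ τ : ℍ} (hr : Rel A B C D σ τ) :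
    EisensteinSeries.E2 σ = (C * τ + D) ^ 2 * EisensteinSeries.E2 τ - kap * C * (C * τ + D) := by
  have h1 := congrFun (EisensteinSeries.E2_slash_action (mkSL A B C D h)) τ
  rw [ModularForm.SL_slash_apply, ← hr.eq_smul h] at h1
  have h2 := denom_ne h τ
  have h3 : denom (mkSL A B C D h) τ = C * τ + D := by
    rw [UpperHalfPlane.denom]
    change ((C : ℝ) : ℂ) * τ + ((D : ℝ) : ℂ) = _
    simp
  simp only [Pi.sub_apply, Pi.smul_apply, EisensteinSeries.D2, smul_eq_mul] at h1
  rw [h3] at h1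
  have h4 : ((mkSL A B C D h) 1 0 : ℤ) = C := rfl
  rw [h4] at h1
  rw [kap]
  rw [zpow_neg, ← div_eq_mul_inv, div_eq_iff (zpow_ne_zero _ h2)] at h1
  rw [h1]
  rw [show ((C : ℂ) * τ + D) ^ (2 : ℤ) = (C * τ + D) ^ 2 from rfl]
  field_simp

/-- weight two Eisenstein series -/
noncomputable def Ef : ℍ → ℂ := (1 / 10 : ℂ) • ((11 : ℂ) • V EisensteinSeries.E2 - EisensteinSeries.E2)

lemma E_wt : Wt2 Ef := by
  intro A B C D h σ τ hr
  have h1 := E2_rel h hr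
  have h2 := E2_rel (by linarith) hr.m11
  rw [coe_m11] at h2
  simp only [Ef, V, Pi.smul_apply, Pi.sub_apply, smul_eq_mul]
  rw [h1, h2]
  push_cast
  ring

lemma E_wf (τ : ℍ) : Ef (wf τ) = -11 * τ ^ 2 * Ef τ := by
  have := τ.ne_zero
  have h1 := E2_rel (A := 0) (B := -1) (C := 1) (D := 0) (by norm_num) (σ := wf τ) (τ := m11 τ) (by
    rw [Rel, coe_wf, coe_m11]; push_cast; field_simp; ring)
  have h2 := E2_rel (A := 0) (B := -1) (C := 1) (D := 0) (by norm_num) (σ := m11 (wf τ)) (τ := τ) (by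
    rw [Rel, coe_m11, coe_wf]; push_cast; field_simp; ring)
  rw [coe_m11] at h1
  simp only [Ef, V, Pi.smul_apply, Pi.sub_apply, smul_eq_mul]
  rw [h1, h2]
  push_cast
  ring

/-- the q-expansion of `E2` -/
noncomputable def E2ps : PowerSeries ℂ :=
  PowerSeries.mk fun n => if n = 0 then 1 else -24 * (ArithmeticFunction.sigma 1 n : ℂ)

lemma rep_E2 : Rep 0 E2ps EisensteinSeries.E2 := by
  intro τ
  refine hs_congr (EisensteinSeries.hasSum_qExpansion_E2 τ) (fun n => ?_) (by simp)
  rw [E2ps, PowerSeries.coeff_mk, q_def]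
  rfl

lemma lo_E2 : Lo 0 EisensteinSeries.E2 := by
  refine ⟨_, ?_, rep_E2⟩
  rw [mem_IntP]
  intro n
  rw [E2ps, PowerSeries.coeff_mk]
  split_ifs
  · exact O.one_mem
  · exact_mod_cast int_mem_O (-24 * (ArithmeticFunction.sigma 1 n : ℤ))

lemma O_tenth : (1 / 10 : ℂ) ∈ O := ⟨1, 1, by norm_num⟩
lemma O_num (n : ℕ) [n.AtLeastTwo] : (OfNat.ofNat n : ℂ) ∈ O := by exact_mod_cast int_mem_O (n : ℤ)

lemma lo_E : Lo 0 Ef := by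
  have h := lo_E2.V
  rw [mul_zero] at h
  exact ((h.smul (O_num 11)).sub lo_E2).smul O_tenth

end X11

end

section

open UpperHalfPlane hiding I
open Complex Function
open scoped Manifold MatrixGroups Topology ModularForm

namespace X11

variable {f g : ℍ → ℂ} {e e' : ℤ} {P Q : PowerSeries ℂ}

lemma Mod.D (hf : Mod f) : Wt2 (Dq f) := by
  intro A B C D h σ τ hr
  have hd : ∀ τ : ℍ, ((11 * C : ℤ) : ℂ) * τ + D ≠ 0 := denom_ne h
  have hu : ∀ τ : ℍ, ((mkSL A B (11 * C) D h • τ : ℍ) : ℂ) = (fun z : ℂ => (A * z + B) / ((11 * C : ℤ) * z + D)) τ := by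
    intro τ
    have := rel_smul (mkSL A B (11 * C) D h) τ
    rw [Rel] at this
    exact (eq_div_iff (hd τ)).2 this
  have hG : HasDerivAt (fun z : ℂ => (A * z + B) / ((11 * C : ℤ) * z + D)) (1 / ((11 * C : ℤ) * τ + D) ^ 2) (τ : ℂ) := by
    have h1 : HasDerivAt (fun z : ℂ => (A * z + B : ℂ)) A (τ : ℂ) := by
      simpa using ((hasDerivAt_id (τ : ℂ)).const_mul (A : ℂ)).add_const (B : ℂ)
    have h2 : HasDerivAt (fun z : ℂ => (((11 * C : ℤ) : ℂ) * z + D : ℂ)) ((11 * C : ℤ) : ℂ) (τ : ℂ) := by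
      simpa using ((hasDerivAt_id (τ : ℂ)).const_mul ((11 * C : ℤ) : ℂ)).add_const (D : ℂ)
    have h3 := h1.div h2 (hd τ)
    have h4 : (A : ℂ) * D - B * ((11 * C : ℤ) : ℂ) = 1 := by exact_mod_cast h
    refine h3.congr_deriv ?_
    congr 1
    linear_combination h4
  have h5 := Dq_comp hf.md hu τ hG
  have h6 : (fun τ => f (mkSL A B (11 * C) D h • τ)) = f := by
    ext τ'
    exact hf.inv A B (11 * C) D h ⟨C, rfl⟩ _ _ (rel_smul (mkSL A B (11 * C) D h) τ')
  rw [h6, ← hr.eq_smul h] at h5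
  have h7 := hd τ
  rw [h5]
  push_cast at h7 ⊢
  field_simp

lemma Dq_W (hf : MDiff f) (τ : ℍ) : Dq (W f) τ = Dq f (wf τ) * (1 / (11 * τ ^ 2)) := by
  refine Dq_comp (u := wf) (G := fun z => -1 / (11 * z)) hf coe_wf τ ?_
  have h0 := τ.ne_zero
  have h1 : HasDerivAt (fun z : ℂ => (11 * z : ℂ)) 11 (τ : ℂ) := by
    simpa using (hasDerivAt_id (τ : ℂ)).const_mul (11 : ℂ)
  have h2 := (hasDerivAt_const (τ : ℂ) (-1 : ℂ)).div h1 (mul_ne_zero (by norm_num) h0)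
  refine h2.congr_deriv ?_
  field_simp
  ring

lemma Wt2.div_S (h : Wt2 f) (hd : MDiff (f * S⁻¹)) : Mod (f * S⁻¹) := by
  refine ⟨hd, fun A B C D hD hC σ τ hr => ?_⟩
  obtain ⟨C, rfl⟩ := hC
  have h4 := denom_ne hD τ
  push_cast at h4
  simp only [Pi.mul_apply, Pi.inv_apply]
  rw [h A B C D hD σ τ hr, S_wt A B C D hD σ τ hr]
  have := S_ne τ
  field_simp

lemma lc_Si : Lc (-1) 1 S⁻¹ := lc_inv lc_S S_ne

lemma Lo.mdiff (h : Lo e f) : MDiff f := by obtain ⟨P, _, h⟩ := h; exact h.mdiff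

/-- first Hauptmodul-like function -/
noncomputable def lam : ℍ → ℂ := Ef * S⁻¹ + fun _ => 13 / 5

lemma lo_ES : Lo (-1) (Ef * S⁻¹) := by simpa using lo_E.mul lc_Si.lo

lemma mod_lam : Mod lam := (E_wt.div_S lo_ES.mdiff).add (mod_const _)

lemma W_lam : W lam = lam := by
  ext τ
  have := S_ne τ
  have := τ.ne_zero
  simp only [W, lam, Pi.mul_apply, Pi.add_apply, Pi.inv_apply]
  rw [S_wf, E_wf]
  field_simp

lemma lo_lam : Lo (-1) lam := by
  refine lo_ES.add ((lo_const ?_).of_le (by norm_num))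
  have : (13 / 5 : ℂ) = 13 * (1 / 5) := by norm_num
  rw [this]
  exact O.mul_mem (O_num 13) fifth_mem_O

/-- `Dλ/S` -/
noncomputable def Kf : ℍ → ℂ := Dq lam * S⁻¹

lemma lo_K : Lo (-2) Kf := by simpa [Kf] using lo_lam.D.mul lc_Si.lo

lemma mod_K : Mod Kf := mod_lam.D.div_S lo_K.mdiff

lemma W_K : W Kf = -Kf := by
  ext τ
  have := S_ne τ
  have := τ.ne_zero
  have h := Dq_W mod_lam.md τ
  rw [W_lam] at h
  simp only [W, Kf, Pi.mul_apply, Pi.neg_apply, Pi.inv_apply]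
  rw [S_wf, h]
  field_simp

/-- `λ² - 12 λ - 11` -/
noncomputable def Mf : ℍ → ℂ := lam ^ 2 - (12 : ℂ) • lam - (11 : ℂ) • 1

/-- Atkin's function of order two -/
noncomputable def xx : ℍ → ℂ := (1 / 2 : ℂ) • (Mf - Kf)
/-- its image under the involution, normalised -/
noncomputable def g2 : ℍ → ℂ := (1 / 121 : ℂ) • (1 / 2 : ℂ) • (Mf + Kf)

lemma W_M : W Mf = Mf := by
  simp only [Mf, W_sub, W_smul, W_pow, W_lam, W_one]

lemma mod_M : Mod Mf := ((mod_lam.pow 2).sub (mod_lam.smul _)).sub (mod_one.smul _)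

lemma mod_xx : Mod xx := (mod_M.sub mod_K).smul _
lemma mod_g2 : Mod g2 := ((mod_M.add mod_K).smul _).smul _

lemma W_xx : W xx = (121 : ℂ) • g2 := by
  rw [xx, W_smul, W_sub, W_M, W_K, g2, smul_smul, sub_neg_eq_add]
  norm_num

lemma lo_M : Lo (-2) Mf := by
  have h1 : Lo (-2) (lam ^ 2) := by simpa [sq] using lo_lam.mul lo_lam
  have h2 := (lo_lam.of_le (e' := -2) (by norm_num)).smul (O_num 12)
  have h3 := (lc_one.lo.of_le (e' := -2) (by norm_num)).smul (O_num 11)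
  exact (h1.sub h2).sub h3

lemma lo_xx : Lo (-2) xx := (lo_M.sub lo_K).smul half_mem_O

/-! ### First five coefficients -/

/-- the first five coefficients of a power series -/
def C5 (P : PowerSeries ℂ) (a b c d e : ℂ) : Prop :=
  PowerSeries.coeff 0 P = a ∧ PowerSeries.coeff 1 P = b ∧ PowerSeries.coeff 2 P = c ∧
  PowerSeries.coeff 3 P = d ∧ PowerSeries.coeff 4 P = e

lemma C5.mul {a b c d e a' b' c' d' e' : ℂ} (h : C5 P a b c d e) (h' : C5 Q a' b' c' d' e') :
    C5 (P * Q) (a * a') (a * b' + b * a') (a * c' + b * b' + c * a') (a * d' + b * c' + c * b' + d * a')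
      (a * e' + b * d' + c * c' + d * b' + e * a') := by
  obtain ⟨h0, h1, h2, h3, h4⟩ := h
  obtain ⟨k0, k1, k2, k3, k4⟩ := h'
  refine ⟨?_, ?_, ?_, ?_, ?_⟩ <;>
  · rw [PowerSeries.coeff_mul]
    simp only [Finset.Nat.antidiagonal_succ, Finset.Nat.antidiagonal_zero, Finset.sum_cons, Finset.map_singleton,
      Finset.sum_singleton, Finset.map_cons, Function.Embedding.prodMap, Function.Embedding.coeFn_mk, Prod.map,
      Function.Embedding.refl_apply, Nat.succ_eq_add_one, Nat.zero_add, Nat.reduceAdd, h0, h1, h2, h3, h4, k0, k1, k2, k3, k4]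
    try ring

lemma C5.add {a b c d e a' b' c' d' e' : ℂ} (h : C5 P a b c d e) (h' : C5 Q a' b' c' d' e') :
    C5 (P + Q) (a + a') (b + b') (c + c') (d + d') (e + e') := by
  obtain ⟨h0, h1, h2, h3, h4⟩ := h
  obtain ⟨k0, k1, k2, k3, k4⟩ := h'
  refine ⟨?_, ?_, ?_, ?_, ?_⟩ <;> simp only [map_add, h0, h1, h2, h3, h4, k0, k1, k2, k3, k4]

lemma C5.sub {a b c d e a' b' c' d' e' : ℂ} (h : C5 P a b c d e) (h' : C5 Q a' b' c' d' e') :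
    C5 (P - Q) (a - a') (b - b') (c - c') (d - d') (e - e') := by
  obtain ⟨h0, h1, h2, h3, h4⟩ := h
  obtain ⟨k0, k1, k2, k3, k4⟩ := h'
  refine ⟨?_, ?_, ?_, ?_, ?_⟩ <;> simp only [map_sub, h0, h1, h2, h3, h4, k0, k1, k2, k3, k4]

lemma C5.smul {a b c d e : ℂ} (h : C5 P a b c d e) (z : ℂ) :
    C5 (z • P) (z * a) (z * b) (z * c) (z * d) (z * e) := by
  obtain ⟨h0, h1, h2, h3, h4⟩ := h
  refine ⟨?_, ?_, ?_, ?_, ?_⟩ <;> simp only [PowerSeries.coeff_smul, smul_eq_mul, h0, h1, h2, h3, h4]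

lemma C5.shift {a b c d e : ℂ} (h : C5 P a b c d e) :
    C5 (PowerSeries.X ^ 1 * P) 0 a b c d := by
  obtain ⟨h0, h1, h2, h3, h4⟩ := h
  rw [pow_one]
  refine ⟨?_, ?_, ?_, ?_, ?_⟩
  · simp
  · rw [← h0]; exact PowerSeries.coeff_succ_X_mul 0 P
  · rw [← h1]; exact PowerSeries.coeff_succ_X_mul 1 P
  · rw [← h2]; exact PowerSeries.coeff_succ_X_mul 2 P
  · rw [← h3]; exact PowerSeries.coeff_succ_X_mul 3 P

lemma C5.D {a b c d e : ℂ} (h : C5 P a b c d e) (k : ℤ) :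
    C5 (dPS k P) (k * a) ((k + 1) * b) ((k + 2) * c) ((k + 3) * d) ((k + 4) * e) := by
  obtain ⟨h0, h1, h2, h3, h4⟩ := h
  refine ⟨?_, ?_, ?_, ?_, ?_⟩ <;> simp [dPS, h0, h1, h2, h3, h4]

/-- expansion with given first five coefficients -/
def R5 (k : ℤ) (f : ℍ → ℂ) (a b c d e : ℂ) : Prop := ∃ P, Rep k P f ∧ C5 P a b c d e

lemma R5.mul {a b c d e a' b' c' d' e₂ : ℂ} {k l : ℤ} (h : R5 k f a b c d e) (h' : R5 l g a' b' c' d' e₂) :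
    R5 (k + l) (f * g) (a * a') (a * b' + b * a') (a * c' + b * b' + c * a') (a * d' + b * c' + c * b' + d * a')
      (a * e₂ + b * d' + c * c' + d * b' + e * a') := by
  obtain ⟨P, hP, cP⟩ := h
  obtain ⟨Q, hQ, cQ⟩ := h'
  exact ⟨_, hP.mul hQ, cP.mul cQ⟩

lemma R5.add {a b c d e a' b' c' d' e₂ : ℂ} {k : ℤ} (h : R5 k f a b c d e) (h' : R5 k g a' b' c' d' e₂) :
    R5 k (f + g) (a + a') (b + b') (c + c') (d + d') (e + e₂) := by
  obtain ⟨P, hP, cP⟩ := h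
  obtain ⟨Q, hQ, cQ⟩ := h'
  exact ⟨_, hP.add hQ, cP.add cQ⟩

lemma R5.sub {a b c d e a' b' c' d' e₂ : ℂ} {k : ℤ} (h : R5 k f a b c d e) (h' : R5 k g a' b' c' d' e₂) :
    R5 k (f - g) (a - a') (b - b') (c - c') (d - d') (e - e₂) := by
  obtain ⟨P, hP, cP⟩ := h
  obtain ⟨Q, hQ, cQ⟩ := h'
  exact ⟨_, hP.sub hQ, cP.sub cQ⟩

lemma R5.smul {a b c d e : ℂ} {k : ℤ} (h : R5 k f a b c d e) (z : ℂ) :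
    R5 k (z • f) (z * a) (z * b) (z * c) (z * d) (z * e) := by
  obtain ⟨P, hP, cP⟩ := h
  exact ⟨_, hP.smul z, cP.smul z⟩

lemma R5.shift {a b c d e : ℂ} {k : ℤ} (h : R5 k f a b c d e) : R5 (k - 1) f 0 a b c d := by
  obtain ⟨P, hP, cP⟩ := h
  exact ⟨_, by simpa using hP.of_le 1, cP.shift⟩

lemma R5.D {a b c d e : ℂ} {k : ℤ} (h : R5 k f a b c d e) :
    R5 k (Dq f) (k * a) ((k + 1) * b) ((k + 2) * c) ((k + 3) * d) ((k + 4) * e) := by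
  obtain ⟨P, hP, cP⟩ := h
  exact ⟨_, hP.D, cP.D k⟩

lemma R5.congr {a b c d e a' b' c' d' e₂ : ℂ} {k l : ℤ} (h : R5 k f a b c d e) (hk : k = l) (h1 : a = a')
    (h2 : b = b') (h3 : c = c') (h4 : d = d') (h5 : e = e₂) : R5 l f a' b' c' d' e₂ := by
  subst hk h1 h2 h3 h4 h5; exact h

lemma R5.lo {k : ℤ} (h : R5 k f 0 0 0 0 0) : ∃ Q, Rep (k + 5) Q f := by
  obtain ⟨P, hP, h0, h1, h2, h3, h4⟩ := h
  have : PowerSeries.X ^ 5 ∣ P := by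
    rw [PowerSeries.X_pow_dvd_iff]
    intro m hm
    interval_cases m <;> assumption
  obtain ⟨Q, rfl⟩ := this
  exact ⟨Q, by simpa using (rep_shift 5).1 hP⟩

end X11

end

section

open UpperHalfPlane hiding I
open Complex Function
open scoped Manifold MatrixGroups Topology ModularForm

namespace X11

variable {f g : ℍ → ℂ} {e e' : ℤ} {P Q : PowerSeries ℂ}

lemma R5.V {a b c d e : ℂ} (h : R5 0 f a b c d e) : R5 0 (V f) a 0 0 0 0 := by
  obtain ⟨P, hP, h0, h1, h2, h3, h4⟩ := h
  refine ⟨_, by simpa using hP.V, ?_, ?_, ?_, ?_, ?_⟩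
  · rw [PowerSeries.coeff_expand, if_pos (by norm_num)]; exact h0
  all_goals rw [PowerSeries.coeff_expand, if_neg (by norm_num)]

lemma r5_PP : R5 0 PP 1 (-1) (-1) 0 0 := by
  obtain ⟨h0, h1, h2, h3, h4⟩ := ppc_vals
  refine ⟨_, rep_PP, ?_, ?_, ?_, ?_, ?_⟩ <;> simp [PowerSeries.coeff_mk, h0, h1, h2, h3, h4]

lemma r5_P11 : R5 0 P11 1 0 0 0 0 := r5_PP.V

lemma r5_one (k : ℤ) : R5 k (fun τ => q τ ^ k) 1 0 0 0 0 := by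
  refine ⟨1, rep_qpow k, ?_, ?_, ?_, ?_, ?_⟩ <;> simp [PowerSeries.coeff_one]

lemma r5_S : R5 1 S 1 (-2) (-1) 2 1 := by
  rw [S_eq, sq, sq]
  refine ((r5_one 1).mul ((r5_PP.mul r5_PP).mul (r5_P11.mul r5_P11))).congr ?_ ?_ ?_ ?_ ?_ ?_ <;> norm_num

lemma r5_Si : R5 (-1) S⁻¹ 1 2 5 10 20 := by
  obtain ⟨Q, -, hQ0, hQ⟩ := lc_Si
  refine ⟨Q, hQ, ?_⟩
  obtain ⟨P, hP, hC⟩ := r5_S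
  have h1 := hP.mul hQ
  have h2 : S * S⁻¹ = 1 := by ext τ; simp [S_ne]
  rw [h2, show (1 : ℤ) + -1 = 0 by norm_num] at h1
  have h3 := h1.unique rep_one
  have h4 := hC.mul (Q := Q) ⟨rfl, rfl, rfl, rfl, rfl⟩
  rw [h3] at h4
  obtain ⟨k0, k1, k2, k3, k4⟩ := h4
  simp only [PowerSeries.coeff_one, hQ0] at k0 k1 k2 k3 k4
  norm_num at k1 k2 k3 k4
  have e1 : PowerSeries.coeff 1 Q = 2 := by linear_combination -k1
  rw [e1] at k2 k3 k4
  have e2 : PowerSeries.coeff 2 Q = 5 := by linear_combination -k2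
  rw [e2] at k3 k4
  have e3 : PowerSeries.coeff 3 Q = 10 := by linear_combination -k3
  rw [e3] at k4
  exact ⟨hQ0, e1, e2, e3, by linear_combination -k4⟩

lemma r5_E2 : R5 0 EisensteinSeries.E2 1 (-24) (-72) (-96) (-168) := by
  have s1 : ArithmeticFunction.sigma 1 1 = 1 := by decide
  have s2 : ArithmeticFunction.sigma 1 2 = 3 := by decide
  have s3 : ArithmeticFunction.sigma 1 3 = 4 := by decide
  have s4 : ArithmeticFunction.sigma 1 4 = 7 := by decide
  refine ⟨_, rep_E2, ?_, ?_, ?_, ?_, ?_⟩ <;> rw [E2ps, PowerSeries.coeff_mk] <;> simp only [s1, s2, s3, s4] <;> norm_num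

lemma r5_E : R5 0 Ef 1 (12 / 5) (36 / 5) (48 / 5) (84 / 5) := by
  refine (((r5_E2.V.smul 11).sub r5_E2).smul (1 / 10)).congr ?_ ?_ ?_ ?_ ?_ ?_ <;> norm_num

lemma r5_const (c : ℂ) : R5 0 (fun _ => c) c 0 0 0 0 := by
  have := (r5_one 0).smul c
  simp only [zpow_zero] at this
  have h : (c • fun _ : ℍ => (1 : ℂ)) = fun _ => c := by ext; simp
  rw [h] at this
  refine this.congr ?_ ?_ ?_ ?_ ?_ ?_ <;> simp

lemma r5_lam : R5 (-1) lam 1 7 17 46 116 := by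
  refine ((r5_E.mul r5_Si).add ((r5_const (13 / 5)).shift)).congr ?_ ?_ ?_ ?_ ?_ ?_ <;> norm_num

lemma r5_K : R5 (-2) Kf (-1) (-2) 12 116 597 := by
  refine (r5_lam.D.mul r5_Si).congr ?_ ?_ ?_ ?_ ?_ ?_ <;> norm_num

lemma r5_M : R5 (-2) Mf 1 2 (-12) 126 613 := by
  have h1 := (r5_lam.mul r5_lam)
  rw [← sq] at h1
  have h2 := r5_lam.shift.smul 12
  have h3 := ((r5_const 1).shift.shift).smul 11
  refine ((h1.sub h2).sub h3).congr ?_ ?_ ?_ ?_ ?_ ?_ <;> norm_num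

lemma r5_xx : R5 (-2) xx 1 2 (-12) ((5 : ℂ)) 8 := by
  refine ((r5_M.sub r5_K).smul (1 / 2)).congr ?_ ?_ ?_ ?_ ?_ ?_ <;> norm_num

lemma r5_g2 : R5 (-2) g2 0 0 0 1 5 := by
  refine (((r5_M.add r5_K).smul (1 / 2)).smul (1 / 121)).congr ?_ ?_ ?_ ?_ ?_ ?_ <;> norm_num

lemma R5.lc {k : ℤ} {a b c d e : ℂ} (h : R5 k f a b c d e) (hl : Lo k f) : Lc k a f := by
  obtain ⟨P, hP, h0, -⟩ := h
  exact ⟨P, int_of_rep hl.mem hP, h0, hP⟩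

lemma lc_lam : Lc (-1) 1 lam := r5_lam.lc lo_lam
lemma lc_xx : Lc (-2) 1 xx := r5_xx.lc lo_xx

lemma Rep.bdd' (h : Rep 0 P f) : IsBoundedAtImInfty f := by
  simpa using h.bdd

/-- bounded modular functions are constant -/
lemma const_of_rep (hf : Mod f) (h1 : Rep 0 P f) (h2 : Rep 0 Q (W f)) :
    f = fun _ => PowerSeries.coeff 0 P := by
  obtain ⟨c, rfl⟩ := const_of_bdd hf h1.bdd' h2.bdd'
  have := h1.unique (rep_const c)
  rw [this]
  simp

lemma rep_lower {k l : ℤ} (h : Rep k P f) (hl : l ≤ k) : ∃ Q, Rep l Q f := by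
  obtain ⟨n, rfl⟩ : ∃ n : ℕ, l = k - n := ⟨(k - l).toNat, by omega⟩
  exact ⟨_, h.of_le n⟩

lemma zero_of_rep (hf : Mod f) (h1 : Rep 1 P f) (h2 : Rep 0 Q (W f)) : f = 0 := by
  have h3 := h1.of_le 1
  have := const_of_rep hf h3 h2
  rw [this]
  ext; simp

lemma W_g2 : W g2 = (1 / 121 : ℂ) • xx := by
  have := congrArg W W_xx
  rw [W_W, W_smul] at this
  rw [this, smul_smul]
  norm_num

lemma X_g2 : xx * g2 = lam := by
  rw [← sub_eq_zero]
  have hr := ((r5_xx.mul r5_g2).sub r5_lam.shift.shift.shift).congr (a' := 0) (b' := 0) (c' := 0) (d' := 0) (e₂ := 0)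
    (l := -4) (by norm_num) (by norm_num) (by norm_num) (by norm_num) (by norm_num) (by norm_num)
  have hw : W (xx * g2 - lam) = xx * g2 - lam := by
    rw [W_sub, W_mul, W_xx, W_g2, W_lam, smul_mul_smul_comm, mul_comm g2]
    norm_num
  obtain ⟨Q, hQ⟩ := hr.lo
  norm_num at hQ
  obtain ⟨Q', hQ'⟩ := rep_lower hQ (l := 0) (by norm_num)
  refine zero_of_rep ((mod_xx.mul mod_g2).sub mod_lam) hQ (Q := Q') ?_
  rw [hw]; exact hQ'

lemma X_add : xx + (121 : ℂ) • g2 = lam ^ 2 - (12 : ℂ) • lam - (11 : ℂ) • 1 := by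
  rw [xx, g2, smul_smul, smul_smul, ← Mf]
  norm_num
  ext τ
  simp
  ring

lemma lc_g2 : Lc 1 1 g2 := by
  obtain ⟨P, hP, -⟩ := r5_g2
  have := lo_div lc_xx hP (b := -1) (c := 1) (by rw [X_g2]; exact lc_lam)
  simpa using this

/-- Atkin's function of order three -/
noncomputable def yy : ℍ → ℂ := (lam - (12 : ℂ) • 1) * xx - (121 : ℂ) • 1
/-- normalised image of `yy` -/
noncomputable def g3 : ℍ → ℂ := (1 / 11 : ℂ) • ((lam - (12 : ℂ) • 1) * g2 - 1)
/-- fourth function at the cusp 0 -/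
noncomputable def g4 : ℍ → ℂ := g2 ^ 2 - g3

lemma mod_yy : Mod yy := ((mod_lam.sub (mod_one.smul _)).mul mod_xx).sub (mod_one.smul _)
lemma mod_g3 : Mod g3 := (((mod_lam.sub (mod_one.smul _)).mul mod_g2).sub mod_one).smul _
lemma mod_g4 : Mod g4 := (mod_g2.pow 2).sub mod_g3

lemma W_yy : W yy = (1331 : ℂ) • g3 := by
  rw [yy, g3, W_sub, W_mul, W_sub, W_lam, W_smul, W_smul, W_one, W_xx]
  ext τ
  simp
  ring

lemma W_g3 : W g3 = (1 / 1331 : ℂ) • yy := by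
  have := congrArg W W_yy
  rw [W_W, W_smul] at this
  rw [this, smul_smul]
  norm_num

/-! pointwise relations -/
lemma rXG (τ : ℍ) : xx τ * g2 τ = lam τ := congrFun X_g2 τ
lemma rXadd (τ : ℍ) : xx τ + 121 * g2 τ = lam τ ^ 2 - 12 * lam τ - 11 := by
  simpa using congrFun X_add τ
lemma rY (τ : ℍ) : yy τ = (lam τ - 12) * xx τ - 121 := by simp [yy]
lemma rg3 (τ : ℍ) : 11 * g3 τ = (lam τ - 12) * g2 τ - 1 := by simp [g3]
lemma rg4 (τ : ℍ) : g4 τ = g2 τ ^ 2 - g3 τ := by simp [g4]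
lemma rYG (τ : ℍ) : yy τ * g2 τ = xx τ + 11 := by
  linear_combination g2 τ * rY τ + (lam τ - 12) * rXG τ - rXadd τ
lemma rXg3 (τ : ℍ) : xx τ * g3 τ = 1 + 11 * g2 τ := by
  have : 11 * (xx τ * g3 τ - (1 + 11 * g2 τ)) = 0 := by
    linear_combination xx τ * rg3 τ + (lam τ - 12) * rXG τ - rXadd τ
  have := (mul_eq_zero.1 this).resolve_left (by norm_num)
  linear_combination this
lemma rYg3 (τ : ℍ) : yy τ * g3 τ = lam τ - 1 := by
  have : 11 * (yy τ * g3 τ - (lam τ - 1)) = 0 := by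
    linear_combination yy τ * rg3 τ + (lam τ - 12) * rYG τ - rY τ
  have := (mul_eq_zero.1 this).resolve_left (by norm_num)
  linear_combination this
lemma rYg4 (τ : ℍ) : yy τ * g4 τ = 1 + 11 * g2 τ := by
  linear_combination yy τ * rg4 τ + g2 τ * rYG τ + rXG τ - rYg3 τ

lemma lc_sub_const {k : ℤ} {c : ℂ} (h : Lc k 1 f) (hk : k < 0) (hc : c ∈ O) : Lc k 1 (f - c • 1) := by
  have h2 := (lc_one.lo.smul hc).lc_zero hk
  simpa using h.sub h2

lemma lc_yy : Lc (-3) 1 yy := by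
  have h1 := (lc_sub_const lc_lam (by norm_num) (O_num 12)).mul lc_xx
  norm_num at h1
  exact lc_sub_const h1 (by norm_num) (O_num 121)

lemma lc_one_add : Lc 0 1 (1 + (11 : ℂ) • g2) := by
  have h2 := (lc_g2.lo.smul (O_num 11)).lc_zero (e' := 0) (by norm_num)
  simpa using lc_one.add h2

end X11

end

section

open UpperHalfPlane hiding I
open Complex Function
open scoped Manifold MatrixGroups Topology ModularForm

namespace X11

variable {f g : ℍ → ℂ} {e e' : ℤ} {P Q : PowerSeries ℂ} {c c' : ℂ}

lemma lc_g3 : Lc 2 1 g3 := by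
  obtain ⟨P, -, -, hP⟩ := (lc_sub_const lc_lam (by norm_num) (O_num 12)).mul lc_g2
  norm_num at hP
  have hr := (hP.sub rep_one).smul (1 / 11)
  have h : yy * g3 = lam - (1 : ℂ) • 1 := by
    ext τ; simpa using rYg3 τ
  have := lo_div lc_yy hr (b := -1) (c := 1) (by change Lc _ _ (yy * g3); rw [h]; exact lc_sub_const lc_lam (by norm_num) O.one_mem)
  simpa [g3] using this

lemma lc_g4 : Lc 3 1 g4 := by
  obtain ⟨P, -, hP⟩ := ((lc_g2.pow 2).lo.of_le (e' := 2) (by norm_num)).sub lc_g3.lo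
  have h : yy * g4 = 1 + (11 : ℂ) • g2 := by
    ext τ; simpa using rYg4 τ
  have := lo_div lc_yy hP (b := 0) (c := 1) (by change Lc _ _ (yy * g4); rw [h]; exact lc_one_add)
  simpa [g4] using this

noncomputable def t1 : ℍ → ℂ := (1 / 11 : ℂ) • (g2 * g3 - g4)
lemma rYt1 (τ : ℍ) : yy τ * t1 τ = g3 τ := by
  have : 11 * (yy τ * t1 τ - g3 τ) = 0 := by
    simp only [t1, Pi.smul_apply, Pi.sub_apply, Pi.mul_apply, smul_eq_mul]
    linear_combination g3 τ * rYG τ + rXg3 τ - rYg4 τ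
  have := (mul_eq_zero.1 this).resolve_left (by norm_num)
  linear_combination this

lemma lc_t1 : Lc 5 1 t1 := by
  obtain ⟨P, -, hP⟩ := ((lc_g2.mul lc_g3).lo.of_le (e' := 3) (by norm_num)).sub lc_g4.lo
  have h : yy * t1 = g3 := by
    ext τ; simpa using rYt1 τ
  have := lo_div lc_yy (hP.smul (1 / 11)) (b := 2) (c := 1) (by change Lc 2 1 (yy * t1); rw [h]; exact lc_g3)
  simpa [t1] using this

noncomputable def ph1 : ℍ → ℂ := xx * yy - (11 : ℂ) • xx ^ 2 + (121 : ℂ) • yy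
lemma lc_ph1 : Lc (-5) 1 ph1 := by
  have h1 := lc_xx.mul lc_yy
  have h2 := ((lc_xx.pow 2).lo.smul (O_num 11)).lc_zero (e' := -5) (by norm_num)
  have h3 := (lc_yy.lo.smul (O_num 121)).lc_zero (e' := -5) (by norm_num)
  norm_num at h1
  simpa [ph1] using (h1.sub h2).add h3

lemma mod_ph1 : Mod ph1 := ((mod_xx.mul mod_yy).sub ((mod_xx.pow 2).smul _)).add (mod_yy.smul _)

lemma W_ph1 : W ph1 = (11 ^ 6 : ℂ) • t1 := by
  rw [ph1, W_add, W_sub, W_mul, W_smul, W_smul, W_pow, W_xx, W_yy]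
  ext τ
  simp [t1, g4]
  ring

lemma W_tt : W tt = (1 / 11 ^ 6 : ℂ) • phi := by
  have := congrArg W W_phi
  rw [W_W, W_smul] at this
  rw [this, smul_smul]
  norm_num

lemma ph1_eq : ph1 = phi := by
  obtain ⟨P, -, h0, hP⟩ := lc_ph1.mul lc_tt
  obtain ⟨Q, -, -, hQ⟩ := lc_t1.mul lc_phi
  norm_num at hP hQ h0
  have hw : W (ph1 * tt) = t1 * phi := by
    rw [W_mul, W_ph1, W_tt, smul_mul_smul_comm]; norm_num
  rw [← hw] at hQ
  have h1 := const_of_rep (mod_ph1.mul mod_tt) hP hQ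
  ext τ
  have h2 := congrFun h1 τ
  have h3 := congrFun phi_tt τ
  simp [h0] at h2 h3
  linear_combination phi τ * h2 - ph1 τ * h3

lemma t1_eq : t1 = tt := by
  have := W_ph1
  rw [ph1_eq, W_phi] at this
  exact (smul_right_injective _ (by norm_num : (11 ^ 6 : ℂ) ≠ 0) this).symm

lemma rphi (τ : ℍ) : phi τ = xx τ * yy τ - 11 * xx τ ^ 2 + 121 * yy τ := by
  rw [← ph1_eq]; simp [ph1]
lemma rt (τ : ℍ) : 11 * tt τ = g2 τ * g3 τ - g4 τ := by
  rw [← t1_eq]; simp [t1]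
lemma rYt (τ : ℍ) : yy τ * tt τ = g3 τ := by
  rw [← t1_eq]; exact rYt1 τ

/-! absence of functions with a simple pole -/
lemma Rep.succ (h : Rep e P f) (h0 : PowerSeries.coeff 0 P = 0) : ∃ Q, Rep (e + 1) Q f := by
  obtain ⟨R, rfl⟩ := (PowerSeries.X_dvd_iff).2 (by simpa using h0)
  rw [← pow_one PowerSeries.X, rep_shift] at h
  exact ⟨R, by simpa using h⟩

lemma lam_indep {a b c : ℂ} (h : ∀ τ, a * lam τ ^ 2 + b * lam τ + c = 0) : a = 0 ∧ b = 0 ∧ c = 0 := by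
  have h1 := (r5_lam.mul r5_lam).smul a
  have h2 := r5_lam.shift.smul b
  have h3 := ((r5_const c).shift.shift)
  obtain ⟨P, hP, h0, h1, h2, -⟩ := (h1.add h2).add h3
  have : (a • (lam * lam) + b • lam + fun _ => c) = 0 := by
    ext τ; simp; linear_combination h τ
  rw [this] at hP
  have : P = 0 := hP.unique (fun τ => by simp)
  subst this
  simp at h0 h1 h2
  subst h0
  simp at h1 
  subst h1
  simp at h2
  exact ⟨rfl, rfl, h2.symm⟩

lemma no_simple_pole (hf : Mod f) (h : Rep (-1) P f) (h0 : PowerSeries.coeff 0 P = 1) (hw : Rep 0 Q (W f)) :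
    False := by
  -- normalise so that `W f` vanishes at infinity
  obtain ⟨r, P, Q, mr, hr, r0, hs⟩ : ∃ (r : ℍ → ℂ) (P Q : PowerSeries ℂ), Mod r ∧ Rep (-1) P r ∧
      PowerSeries.coeff 0 P = 1 ∧ Rep 1 Q (W r) := by
    set k := PowerSeries.coeff 0 Q
    have hk := (rep_one.smul k)
    obtain ⟨Q', hQ'⟩ := (hw.sub hk).succ (by simp [k])
    refine ⟨f - k • 1, _, Q', hf.sub (mod_one.smul _), by simpa using h.sub (hk.of_le 1), ?_, ?_⟩
    · rw [PowerSeries.coeff_zero_eq_constantCoeff_apply] at *; simp [h0]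
    · simpa [W_sub, W_smul, W_one] using hQ'
  set s := W r with hs'
  have ms : Mod s := mr.W
  have hws : W s = r := W_W r
  obtain ⟨L, -, l0, hL⟩ := lc_lam
  obtain ⟨X, -, x0, hX⟩ := lc_xx
  obtain ⟨G, -, -, hG⟩ := lc_g2
  -- r + s
  have e1 : ∃ c : ℂ, ∀ τ, r τ + s τ = lam τ + c := by
    obtain ⟨A, hA⟩ := rep_lower hs (l := -1) (by norm_num)
    have hA0 : PowerSeries.coeff 0 A = 0 := by
      have h2 := hs.of_le 2
      norm_num at h2
      rw [hA.unique h2]; simp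
    obtain ⟨B, hB⟩ := ((hr.add hA).sub hL).succ (by
      rw [PowerSeries.coeff_zero_eq_constantCoeff_apply] at *; simp [r0, hA0, l0])
    norm_num at hB
    have hwB : W (r + s - lam) = r + s - lam := by
      rw [W_sub, W_add, W_lam, hws, ← hs', add_comm]
    have := const_of_rep ((mr.add ms).sub mod_lam) hB (hwB.symm ▸ hB)
    refine ⟨PowerSeries.coeff 0 B, fun τ => ?_⟩
    have h3 := congrFun this τ
    simp only [Pi.sub_apply, Pi.add_apply] at h3
    rw [← h3]; ring
  have e2 : ∃ d : ℂ, ∀ τ, r τ * s τ = d := by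
    have hB := hr.mul hs
    norm_num at hB
    have hwB : W (r * s) = r * s := by rw [W_mul, hws, ← hs', mul_comm]
    have := const_of_rep (mr.mul ms) hB (hwB.symm ▸ hB)
    exact ⟨_, fun τ => congrFun this τ⟩
  have e3 : ∃ b : ℂ, ∀ τ, xx τ = r τ ^ 2 + b * r τ := by
    have hr2 := hr.pow 2
    norm_num at hr2
    obtain ⟨A, hA⟩ := (hX.sub hr2).succ (by
      rw [PowerSeries.coeff_zero_eq_constantCoeff_apply] at *; simp [r0, x0])
    norm_num at hA
    set b := PowerSeries.coeff 0 A
    obtain ⟨B, hB⟩ := (hA.sub (hr.smul b)).succ (by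
      rw [PowerSeries.coeff_zero_eq_constantCoeff_apply] at *; simp [r0, b])
    norm_num at hB
    have hwx : W (xx - r ^ 2 - b • r) = (121 : ℂ) • g2 - s ^ 2 - b • s := by
      rw [W_sub, W_sub, W_smul, W_pow, W_xx, ← hs']
    obtain ⟨S2, hS2⟩ := rep_lower (hs.pow 2) (l := 1) (by norm_num)
    have hC := ((hG.smul 121).sub hS2).sub (hs.smul b)
    rw [← hwx] at hC
    obtain ⟨k, hk⟩ := const_of_bdd ((mod_xx.sub (mr.pow 2)).sub (mr.smul b)) hB.bdd'
      ((hC.of_le 1).bdd')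
    have hW0 : W (xx - r ^ 2 - b • r) = 0 := by
      have h5 : W (xx - r ^ 2 - b • r) = fun _ => k := by rw [hk]; rfl
      rw [h5] at hC
      have h6 := hC.of_le 1
      norm_num at h6
      have h7 := h6.unique (rep_const k)
      have h8 := congrArg (PowerSeries.coeff 0) h7
      simp at h8
      rw [h5, ← h8]; rfl
    have h9 := congrArg W hW0
    rw [W_W] at h9
    refine ⟨b, fun τ => ?_⟩
    have := congrFun h9 τ
    simp [W] at this
    linear_combination this
  obtain ⟨c, e1⟩ := e1
  obtain ⟨d, e2⟩ := e2
  obtain ⟨b, e3⟩ := e3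
  have e4 : ∀ τ, 121 * g2 τ = s τ ^ 2 + b * s τ := fun τ => by
    have : W xx τ = s τ ^ 2 + b * s τ := e3 (wf τ)
    rw [W_xx] at this
    simpa using this
  have i1 := lam_indep (a := 0) (b := d * b - 121) (c := d ^ 2 + d * b * c + b ^ 2 * d) (fun τ => by
    linear_combination 121 * rXG τ - 121 * g2 τ * e3 τ - (r τ ^ 2 + b * r τ) * e4 τ
      - d * b * e1 τ - (r τ * s τ + d + b ^ 2) * e2 τ - (b * r τ + b * s τ) * e2 τ)
  have i2 := lam_indep (a := 0) (b := 2 * c + b + 12) (c := c ^ 2 - 2 * d + b * c + 11) (fun τ => by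
    linear_combination rXadd τ - e3 τ - e4 τ - (r τ + s τ + lam τ + c + b) * e1 τ + 2 * e2 τ)
  obtain ⟨-, i3, i4⟩ := i1
  obtain ⟨-, i5, i6⟩ := i2
  have hd : d ≠ 0 := by rintro rfl; norm_num at i3
  have i7 : d + b * c + b ^ 2 = 0 := by
    have : d * (d + b * c + b ^ 2) = 0 := by linear_combination i4
    exact (mul_eq_zero.1 this).resolve_left hd
  have hc : c = -(12 + b) / 2 := by linear_combination i5 / 2
  subst hc
  have hd' : d = 6 * b - b ^ 2 / 2 := by linear_combination i7
  subst hd'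
  have j1 : 3 * b ^ 2 - 48 * b + 188 = 0 := by linear_combination 4 * i6
  have j2 : b = 13 / 2 := by linear_combination (-3 / 2) * i3 - (b / 4 + 1) * j1
  subst j2
  norm_num at j1

end X11

end

section

open UpperHalfPlane hiding I
open Complex Function
open scoped Manifold MatrixGroups Topology ModularForm

namespace X11

variable {f g : ℍ → ℂ} {e e' : ℤ} {P Q : PowerSeries ℂ} {c c' : ℂ}

/-- exponents `0,2,3,4,6` -/
def th0 : ℕ → ℕ
  | 0 => 0 | 1 => 2 | 2 => 3 | 3 => 4 | _ => 6
noncomputable def h0 : ℕ → ℍ → ℂ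
  | 0 => 1 | 1 => g2 | 2 => g3 | 3 => g4 | _ => g3 ^ 2
noncomputable def G0 : ℕ → ℍ → ℂ
  | 0 => 1 | 1 => xx | 2 => yy | 3 => xx ^ 2 - (11 : ℂ) • yy | _ => yy ^ 2

lemma lc_h0 (r : ℕ) (hr : r < 5) : Lc r 1 (h0 r) := by
  interval_cases r
  · exact lc_one
  · exact lc_g2
  · exact lc_g3
  · exact lc_g4
  · simpa [h0] using lc_g3.pow 2

lemma lc_G0 (r : ℕ) (hr : r < 5) : Lc (-(th0 r : ℤ)) 1 (G0 r) := by
  interval_cases r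
  · exact lc_one
  · exact lc_xx
  · exact lc_yy
  · have h1 := lc_xx.pow 2
    have h2 := (lc_yy.lo.smul (O_num 11)).lc_zero (e' := -4) (by norm_num)
    norm_num at h1
    simpa [G0, th0] using h1.sub h2
  · simpa [G0, th0] using lc_yy.pow 2

lemma mod_G0 (r : ℕ) (hr : r < 5) : Mod (G0 r) := by
  interval_cases r
  · exact mod_one
  · exact mod_xx
  · exact mod_yy
  · exact (mod_xx.pow 2).sub (mod_yy.smul _)
  · exact mod_yy.pow 2

lemma W_G0 (r : ℕ) (hr : r < 5) : W (G0 r) = (11 ^ th0 r : ℂ) • h0 r := by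
  interval_cases r
  · simp [G0, th0, h0, W_one]
  · simp only [G0, th0, h0, W_xx]; norm_num
  · simp only [G0, th0, h0, W_yy]; norm_num
  · simp only [G0, th0, h0, W_sub, W_smul, W_pow, W_xx, W_yy]
    ext τ; simp [g4]; ring
  · simp only [G0, th0, h0, W_pow, W_yy]
    ext τ; simp; ring

/-- basis at the cusp 0 -/
noncomputable def hb (e : ℕ) : ℍ → ℂ := tt ^ (e / 5) * h0 (e % 5)
/-- basis at the cusp infinity -/
noncomputable def Gb (e : ℕ) : ℍ → ℂ := phi ^ (e / 5) * G0 (e % 5)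
def th (e : ℕ) : ℕ := 6 * (e / 5) + th0 (e % 5)
def nb (e : ℕ) : ℕ := 5 * (e / 5) + th0 (e % 5)

lemma lc_hb (e : ℕ) : Lc e 1 (hb e) := by
  have := (lc_tt.pow (e / 5)).mul (lc_h0 (e % 5) (Nat.mod_lt _ (by norm_num)))
  rwa [one_mul, show ((e / 5 : ℕ) : ℤ) * 5 + (e % 5 : ℕ) = e by omega] at this

lemma lc_Gb (e : ℕ) : Lc (-(nb e : ℤ)) 1 (Gb e) := by
  have := (lc_phi.pow (e / 5)).mul (lc_G0 (e % 5) (Nat.mod_lt _ (by norm_num)))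
  rwa [one_mul, show ((e / 5 : ℕ) : ℤ) * (-5) + -(th0 (e % 5) : ℤ) = -(nb e : ℤ) by
    simp only [nb]; push_cast; ring] at this

lemma mod_Gb (e : ℕ) : Mod (Gb e) := (mod_phi.pow _).mul (mod_G0 _ (Nat.mod_lt _ (by norm_num)))

lemma W_Gb (e : ℕ) : W (Gb e) = (11 ^ th e : ℂ) • hb e := by
  rw [Gb, W_mul, W_pow, W_phi, W_G0 _ (Nat.mod_lt _ (by norm_num)), hb, th, smul_pow,
    smul_mul_smul_comm, pow_add, pow_mul]

lemma W_hb (e : ℕ) : (11 ^ th e : ℂ) • W (hb e) = Gb e := by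
  rw [← W_smul, ← W_Gb, W_W]

lemma mod_hb (e : ℕ) : Mod (hb e) := by
  have : hb e = ((11 ^ th e : ℂ)⁻¹) • W (Gb e) := by
    rw [W_Gb, smul_smul, inv_mul_cancel₀ (pow_ne_zero _ (by norm_num)), one_smul]
  rw [this]
  exact (mod_Gb e).W.smul _

lemma th_cases (e : ℕ) : (e % 5 = 0 ∧ th e = 6 * (e / 5) ∧ nb e = 5 * (e / 5)) ∨
    (e % 5 = 1 ∧ th e = 6 * (e / 5) + 2 ∧ nb e = 5 * (e / 5) + 2) ∨
    (e % 5 = 2 ∧ th e = 6 * (e / 5) + 3 ∧ nb e = 5 * (e / 5) + 3) ∨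
    (e % 5 = 3 ∧ th e = 6 * (e / 5) + 4 ∧ nb e = 5 * (e / 5) + 4) ∨
    (e % 5 = 4 ∧ th e = 6 * (e / 5) + 6 ∧ nb e = 5 * (e / 5) + 6) := by
  have : e % 5 < 5 := Nat.mod_lt _ (by norm_num)
  unfold th nb
  generalize e % 5 = r at *
  interval_cases r <;> simp [th0]

lemma nb_surj (n : ℕ) (hn : n ≠ 1) : ∃ e, nb e = n ∧ e ≤ n := by
  by_cases h : n % 5 = 1
  · refine ⟨n - 2, ?_, by omega⟩
    have := th_cases (n - 2); omega
  by_cases h : n % 5 = 0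
  · refine ⟨n, ?_, by omega⟩
    have := th_cases n; omega
  · refine ⟨n - 1, ?_, by omega⟩
    have := th_cases (n - 1); omega

/-- finite combinations -/
noncomputable def comb (h : ℕ → ℍ → ℂ) (c : ℕ → ℂ) (N : ℕ) : ℍ → ℂ := ∑ i ∈ Finset.range N, c i • h i

lemma comb_add (h : ℕ → ℍ → ℂ) (c d : ℕ → ℂ) (N : ℕ) : comb h (c + d) N = comb h c N + comb h d N := by
  simp [comb, add_smul, Finset.sum_add_distrib]

lemma comb_single (h : ℕ → ℍ → ℂ) (a : ℂ) {e N : ℕ} (hN : e < N) : comb h (Pi.single e a) N = a • h e := by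
  rw [comb, Finset.sum_eq_single e]
  · simp
  · intro b _ hb; simp [Pi.single_eq_of_ne hb]
  · intro h; simp at h; omega

lemma W_comb (h : ℕ → ℍ → ℂ) (c : ℕ → ℂ) (N : ℕ) : W (comb h c N) = comb (fun e => W (h e)) c N := by
  ext τ; simp [comb, W]

lemma comb_smul (h : ℕ → ℍ → ℂ) (c : ℕ → ℂ) (N : ℕ) (z : ℂ) : z • comb h c N = comb h (z • c) N := by
  simp [comb, Finset.smul_sum, smul_smul]

/-- Decomposition of functions with poles only at infinity. -/
lemma decomp (N : ℕ) : ∀ (f : ℍ → ℂ), Mod f → Lo (-(N : ℤ)) f → (∃ Q, Rep 0 Q (W f)) →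
    ∃ (M : ℕ) (c : ℕ → ℂ), (∀ i, c i ∈ O) ∧ f = comb Gb c M := by
  suffices H : ∀ (f : ℍ → ℂ), Mod f → Lo (-(N : ℤ)) f → (∃ Q, Rep 0 Q (W f)) →
    ∃ (c : ℕ → ℂ), (∀ i, c i ∈ O) ∧ f = comb Gb c (N + 1) by
    intro f h1 h2 h3
    exact ⟨_, H f h1 h2 h3⟩
  induction N using Nat.strong_induction_on with
  | _ N ih =>
  intro f hf hl ⟨Q, hQ⟩
  obtain ⟨c, hc, P, hPi, hc0, hP⟩ := hl.lc
  have hW : ∀ e, ∃ Q, Rep 0 Q (W (Gb e)) := fun e => by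
    rw [W_Gb]
    obtain ⟨R, -, hR⟩ := (lc_hb e).lo.of_le (e' := 0) (by omega)
    exact ⟨_, hR.smul _⟩
  rcases Nat.eq_zero_or_pos N with rfl | hN
  · refine ⟨Pi.single 0 c, ?_, ?_⟩
    · intro i; by_cases h : i = 0
      · subst h; simpa using hc
      · simp [h, O.zero_mem]
    · have := const_of_rep hf (by simpa using hP) hQ
      rw [comb_single _ _ (by norm_num), this, hc0]
      ext τ; simp [Gb, G0]
  by_cases h1 : N = 1
  · subst h1
    by_cases h2 : c = 0
    · subst h2
      have hl : Lo (-((0 : ℕ) : ℤ)) f := by simpa using (show Lc _ 0 f from ⟨P, hPi, hc0, hP⟩).lo_succ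
      obtain ⟨d, hd, hd'⟩ := ih 0 (by norm_num) f hf hl ⟨Q, hQ⟩
      refine ⟨fun i => if i = 0 then d 0 else 0, fun i => ?_, ?_⟩
      · dsimp only; split_ifs; exacts [hd 0, O.zero_mem]
      · rw [hd']; simp [comb]
    · exfalso
      refine no_simple_pole (hf.smul c⁻¹) (by simpa using hP.smul c⁻¹) ?_ (Q := c⁻¹ • Q) (by rw [W_smul]; exact hQ.smul _)
      rw [PowerSeries.coeff_zero_eq_constantCoeff_apply] at *; simp [hc0, h2]
  obtain ⟨e, he, he'⟩ := nb_surj N h1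
  have hl2 : Lo (-(N : ℤ) + 1) (f - c • Gb e) := by
    apply Lc.lo_succ
    have h5 := (lc_Gb e).smul hc
    rw [he] at h5
    simpa using (show Lc _ c f from ⟨P, hPi, hc0, hP⟩).sub h5
  have hl3 : Lo (-((N - 1 : ℕ) : ℤ)) (f - c • Gb e) := by
    convert hl2 using 1; omega
  obtain ⟨d, hd, hd'⟩ := ih (N - 1) (by omega) _ (hf.sub ((mod_Gb e).smul c)) hl3 (by
    obtain ⟨R, hR⟩ := hW e
    exact ⟨_, by rw [W_sub, W_smul]; exact hQ.sub (hR.smul c)⟩)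
  refine ⟨(fun i => if i < N then d i else 0) + Pi.single e c, fun i => ?_, ?_⟩
  · refine O.add_mem ?_ ?_
    · dsimp only; split_ifs; exacts [hd i, O.zero_mem]
    · by_cases h : i = e
      · subst h; simpa using hc
      · simp [h, O.zero_mem]
  · rw [comb_add, comb_single _ _ (by omega), ← sub_eq_iff_eq_add, hd']
    rw [show N - 1 + 1 = N by omega, comb, comb, Finset.sum_range_succ _ N]
    simp only [lt_irrefl, if_false, zero_smul, add_zero]
    exact Finset.sum_congr rfl fun i hi => by rw [if_pos (Finset.mem_range.1 hi)]

/-- Decomposition at the cusp 0. -/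
lemma decomp2 (hf : Mod f) (h1 : Lo 1 f) (k : ℕ) (hk : (11 ^ k : ℂ) • W f ∈ 𝓛) :
    ∃ (M : ℕ) (d : ℕ → ℂ), f = comb hb d M ∧ d 0 = 0 ∧ (∀ i, d i ∈ O) ∧
      (∀ i, ∃ c ∈ O, 11 ^ k * d i = 11 ^ th i * c) := by
  obtain ⟨E, hE⟩ := hk
  have hE' : Lo (-((E.natAbs : ℕ) : ℤ)) ((11 ^ k : ℂ) • W f) := hE.of_le (by omega)
  obtain ⟨P, -, hP⟩ := h1.of_le (e' := 0) (by norm_num)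
  obtain ⟨M, c, hc, hcomb⟩ := decomp _ _ (hf.W.smul (11 ^ k : ℂ)) hE' ⟨_, by
    rw [W_smul, W_W]; exact hP.smul _⟩
  let d : ℕ → ℂ := fun i => if i < M then (11 ^ k : ℂ)⁻¹ * 11 ^ th i * c i else 0
  have hd : f = comb hb d M := by
    have := congrArg W hcomb
    rw [W_smul, W_W, W_comb] at this
    rw [← one_smul ℂ f, ← inv_mul_cancel₀ (show (11 ^ k : ℂ) ≠ 0 from pow_ne_zero _ (by norm_num)), ← smul_smul, this, comb_smul]
    refine Finset.sum_congr rfl fun i hi => ?_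
    simp only [d, if_pos (Finset.mem_range.1 hi), W_Gb, smul_smul, Pi.smul_apply, smul_eq_mul]
    congr 1; ring
  have hinteg : ∀ i, d i ∈ O := by
    intro i
    by_cases hi : i < M
    · have := coeff_int lc_hb d M 0 (by
        have h3 := h1.mem
        rw [hd, comb] at h3
        simpa only [zero_add] using h3) i hi
      simpa using this
    · simp only [d, if_neg hi]; exact O.zero_mem
  refine ⟨M, d, hd, ?_, hinteg, fun i => ?_⟩
  · have hlc : ∀ M, Lc 0 (if 0 < M then d 0 else 0) (comb hb d M) := by
      intro M
      induction M with
      | zero => simpa [comb] using (Lo.zero 1).lc_zero (e' := 0) (by norm_num)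
      | succ n ih =>
        rw [comb, Finset.sum_range_succ]
        rcases Nat.eq_zero_or_pos n with rfl | hn
        · simpa using (lc_hb 0).smul (hinteg 0)
        · simpa [hn, comb] using ih.add (((lc_hb n).lo.smul (hinteg n)).lc_zero (e' := 0) (by omega))
    have h2 := lc_unique (h1.lc_zero (e' := 0) (by norm_num)) (hd ▸ hlc M)
    by_cases hM : 0 < M
    · simpa [hM] using h2.symm
    · simp [d, hM]
  · by_cases hi : i < M
    · refine ⟨c i, hc i, ?_⟩
      simp only [d, if_pos hi]
      rw [mul_assoc, mul_inv_cancel_left₀ (pow_ne_zero _ (by norm_num))]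
    · exact ⟨0, O.zero_mem, by simp [d, hi]⟩

end X11

end

section

open UpperHalfPlane hiding I
open Complex Function
open scoped Manifold MatrixGroups Topology ModularForm

namespace X11

section alg
variable {R : Type*} [CommRing R]

lemma alg_step (U D : R →+ R) (hD : ∀ x y, D (x * y) = x * D y + y * D x) (hUD : ∀ x, U (D x) = 0)
    {b b' G S C : R} (hb : b = 1 + G) (hbb : b * b' = 1) (hDb : D b = S * b) (hC : C * S = G)
    (hC5 : C ^ 5 = b ^ 2) (k : ℕ) : (5 * k + 2 : ℕ) • (U (b ^ (k + 1)) - U (b ^ k)) = 0 := by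
  have hpow : ∀ n : ℕ, D (b ^ n) = n * S * b ^ n := by
    intro n
    induction n with
    | zero => have := hD 1 1; simp at this; simpa using this
    | succ n ih => rw [pow_succ, hD, ih, hDb]; push_cast; ring
  have h1 : D (C ^ 5) = 5 * C ^ 4 * D C := by
    rw [show C ^ 5 = C * (C * (C * (C * C))) by ring]
    simp only [hD]; ring
  have h2 : 5 * D C = 2 * G := by
    rw [hC5, hpow] at h1
    push_cast at h1
    have h3 : C ^ 4 * (5 * D C - 2 * G) = 0 := by
      linear_combination -h1 + 2 * C ^ 4 * hC - 2 * S * hC5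
    have h4 : C ^ 5 * b' ^ 2 = 1 := by
      rw [hC5]; linear_combination (b * b' + 1) * hbb
    linear_combination C * b' ^ 2 * h3 - (5 * D C - 2 * G) * h4
  have h3 : (5 : ℕ) • D (b ^ k * C) = (5 * k + 2 : ℕ) • (b ^ (k + 1) - b ^ k) := by
    rw [hD, hpow]
    simp only [nsmul_eq_mul]
    push_cast
    rw [pow_succ, hb]
    rw [hb] at *
    linear_combination (1 + G) ^ k * h2 + 5 * k * (1 + G) ^ k * hC
  have h4 := congrArg U h3
  rw [map_nsmul, map_nsmul, hUD, smul_zero, map_sub] at h4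
  exact h4.symm

lemma alg_cancel (h11 : (11 : R) = 0) {x : R} (k : ℕ) (m j : ℤ) (h : (5 * k + 2 : ℕ) • x = 0)
    (hm : m * (5 * k + 2) - 11 * j = 1) : x = 0 := by
  have h2 := congrArg (Int.cast : ℤ → R) hm
  push_cast at h2
  rw [nsmul_eq_mul] at h
  push_cast at h
  linear_combination (m : R) * h - j * x * h11 - x * h2

lemma alg_U (h11 : (11 : R) = 0) (U : R →+ R) {b : R} (h1 : U 1 = 1)
    (hV : ∀ x, U (b ^ 11 * x) = b * U x)
    (hs : ∀ k : ℕ, (5 * k + 2 : ℕ) • (U (b ^ (k + 1)) - U (b ^ k)) = 0) (r : ℕ) (hr : r < 11) :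
    U (b ^ r) = if r ≤ 4 then 1 else b := by
  have st : ∀ (k : ℕ) (m j : ℤ), m * (5 * k + 2) - 11 * j = 1 → U (b ^ (k + 1)) = U (b ^ k) :=
    fun k m j h => sub_eq_zero.1 (alg_cancel h11 k m j (hs k) h)
  have e0 : U (b ^ 0) = 1 := by simpa using h1
  have e1 := st 0 6 1 (by norm_num)
  have e2 := st 1 8 5 (by norm_num)
  have e3 := st 2 1 1 (by norm_num)
  have e4 := st 3 2 3 (by norm_num)
  have e11 : U (b ^ 11) = b := by have := hV 1; rwa [mul_one, h1, mul_one] at this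
  have e10 := st 10 (-4) (-19) (by norm_num)
  have e9 := st 9 4 17 (by norm_num)
  have e8 := st 8 5 19 (by norm_num)
  have e7 := st 7 (-8) (-27) (by norm_num)
  have e6 := st 6 (-1) (-3) (by norm_num)
  have e5 := st 5 (-2) (-5) (by norm_num)
  norm_num at *
  interval_cases r <;> simp_all

lemma alg_Uz (U : R →+ R) (β : Rˣ) (hV : ∀ x, U ((β : R) ^ 11 * x) = β * U x)
    (hr : ∀ r : ℕ, r < 11 → U ((β : R) ^ r) = if r ≤ 4 then 1 else (β : R)) (l : ℤ) :
    U ((β ^ l : Rˣ) : R) = ((β ^ ((l + 6) / 11) : Rˣ) : R) := by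
  have hn : ∀ (n : ℕ) x, U (((β ^ (11 * n : ℤ) : Rˣ) : R) * x) = ((β ^ (n : ℤ) : Rˣ) : R) * U x := by
    intro n
    induction n with
    | zero => simp
    | succ n ih =>
      intro x
      have := hV ((β ^ (11 * n : ℤ) : Rˣ) * x)
      rw [ih] at this
      rw [show (11 * ((n + 1 : ℕ) : ℤ)) = ((11 : ℕ) : ℤ) + 11 * n by push_cast; ring, zpow_add, zpow_natCast,
        Nat.cast_succ, add_comm (n : ℤ) 1, zpow_add, zpow_one]
      push_cast
      rw [mul_assoc, this]; ring
  have hz : ∀ (n : ℤ) x, U (((β ^ (11 * n : ℤ) : Rˣ) : R) * x) = ((β ^ (n : ℤ) : Rˣ) : R) * U x := by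
    intro n x
    obtain ⟨k, rfl | rfl⟩ := n.eq_nat_or_neg
    · exact hn k x
    · have := hn k (((β ^ (11 * (-k : ℤ)) : Rˣ) : R) * x)
      rw [← mul_assoc, ← Units.val_mul, ← zpow_add, show (11 * (k : ℤ) + 11 * -k) = 0 by ring] at this
      simp only [zpow_zero, Units.val_one, one_mul] at this
      rw [this, ← mul_assoc, ← Units.val_mul, ← zpow_add]
      simp
  obtain ⟨r, hr1⟩ : ∃ r : ℕ, (r : ℤ) = l % 11 := ⟨(l % 11).toNat, by omega⟩
  have hl : l = 11 * (l / 11) + r := by omega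
  have := hz (l / 11) ((β : R) ^ r)
  rw [← Units.val_pow_eq_pow_val, ← Units.val_mul, ← zpow_natCast, ← zpow_add, ← hl] at this
  rw [this, zpow_natCast, Units.val_pow_eq_pow_val, hr r (by omega)]
  split_ifs with h
  · rw [show (l + 6) / 11 = l / 11 by omega, mul_one]
  · rw [show (l + 6) / 11 = l / 11 + 1 by omega, zpow_add]; simp

/-- span of a range of powers -/
def zspan (β : Rˣ) (a c : ℤ) : AddSubgroup R := AddSubgroup.closure ((fun l : ℤ => ((β ^ l : Rˣ) : R)) '' Set.Icc a c)

lemma mem_zspan (β : Rˣ) {a c l : ℤ} (h1 : a ≤ l) (h2 : l ≤ c) : ((β ^ l : Rˣ) : R) ∈ zspan β a c :=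
  AddSubgroup.subset_closure ⟨l, ⟨h1, h2⟩, rfl⟩

lemma zspan_le (β : Rˣ) {a c : ℤ} {A : AddSubgroup R} (h : ∀ l, a ≤ l → l ≤ c → ((β ^ l : Rˣ) : R) ∈ A) :
    zspan β a c ≤ A := by
  rw [zspan, AddSubgroup.closure_le]
  rintro _ ⟨l, ⟨h1, h2⟩, rfl⟩
  exact h l h1 h2

lemma zspan_mono (β : Rˣ) {a c a' c' : ℤ} (h1 : a' ≤ a) (h2 : c ≤ c') : zspan β a c ≤ zspan β a' c' :=
  zspan_le β fun _ h3 h4 => mem_zspan β (h1.trans h3) (h4.trans h2)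

lemma zspan_mul (β : Rˣ) {a c : ℤ} {x : R} (hx : x ∈ zspan β a c) (l : ℤ) :
    x * ((β ^ l : Rˣ) : R) ∈ zspan β (a + l) (c + l) := by
  have : zspan β a c ≤ (zspan β (a + l) (c + l)).comap (AddMonoidHom.mulRight ((β ^ l : Rˣ) : R)) := by
    refine zspan_le β fun m h1 h2 => ?_
    rw [AddSubgroup.mem_comap, AddMonoidHom.coe_mulRight]
    dsimp only
    rw [← Units.val_mul, ← zpow_add]
    exact mem_zspan β (by omega) (by omega)
  exact this hx

lemma pow_top (β : Rˣ) (e : ℕ) : ((β : R) - 1) ^ e - ((β ^ (e : ℤ) : Rˣ) : R) ∈ zspan β 0 (e - 1) := by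
  induction e with
  | zero => simp
  | succ e ih =>
    have h1 := zspan_mul β ih 1
    have h2 : ((β ^ (e : ℤ) : Rˣ) : R) ∈ zspan β 0 ((e + 1 : ℕ) - 1) := mem_zspan β (by omega) (by omega)
    have h3 := zspan_mono β (le_refl 0) (show (e : ℤ) - 1 ≤ (e + 1 : ℕ) - 1 by omega) ih
    have h4 := zspan_mono β (show (0 : ℤ) ≤ 0 + 1 by omega) (show (e : ℤ) - 1 + 1 ≤ (e + 1 : ℕ) - 1 by omega) h1
    have := AddSubgroup.sub_mem _ (AddSubgroup.sub_mem _ h4 h3) h2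
    convert this using 1
    rw [Nat.cast_succ, zpow_add]
    push_cast
    simp only [zpow_one]
    ring

lemma pow_bot (β : Rˣ) (e : ℕ) : ((β : R) - 1) ^ e - (-1) ^ e ∈ zspan β 1 e := by
  induction e with
  | zero => simp
  | succ e ih =>
    have h1 := zspan_mul β ih 1
    have h2 : ((β ^ (1 : ℤ) : Rˣ) : R) ∈ zspan β 1 ((e + 1 : ℕ)) := mem_zspan β (by omega) (by omega)
    have h3 := zspan_mono β (le_refl 1) (show (e : ℤ) ≤ (e + 1 : ℕ) by omega) ih
    have h4 := zspan_mono β (show (1 : ℤ) ≤ 1 + 1 by omega) (show (e : ℤ) + 1 ≤ (e + 1 : ℕ) by omega) h1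
    have h5 : (-1) ^ e * ((β ^ (1 : ℤ) : Rˣ) : R) ∈ zspan β 1 ((e + 1 : ℕ)) := by
      rcases neg_one_pow_eq_or R e with h | h <;> rw [h]
      · simpa using h2
      · simpa using AddSubgroup.neg_mem _ h2
    have := AddSubgroup.add_mem _ (AddSubgroup.sub_mem _ h4 h3) h5
    convert this using 1
    simp only [zpow_one]
    ring

/-- exponents -/
def fe (e : ℕ) : ℕ := 2 * (e / 5) + (e % 5) / 2

/-- reductions of the basis -/
def eta (β : Rˣ) (e : ℕ) : R := ((β : R) - 1) ^ e * ((β ^ (-(fe e : ℤ)) : Rˣ) : R)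

lemma eta_mem (β : Rˣ) (e : ℕ) : eta β e ∈ zspan β (-(fe e : ℤ)) (e - fe e) := by
  have h1 := zspan_mono β (le_refl 0) (show (e : ℤ) - 1 ≤ e by omega) (pow_top β e)
  have h2 := AddSubgroup.add_mem _ h1 (mem_zspan β (show (0 : ℤ) ≤ e by omega) le_rfl)
  rw [sub_add_cancel] at h2
  have := zspan_mul β h2 (-(fe e : ℤ))
  rw [zero_add, ← sub_eq_add_neg] at this
  exact this

lemma eta_span (β : Rˣ) (E : ℕ) :
    zspan β (-(fe E : ℤ)) (E - fe E) ≤ AddSubgroup.closure (eta β '' Set.Iio (E + 1)) := by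
  induction E with
  | zero =>
    refine zspan_le β fun l h1 h2 => AddSubgroup.subset_closure ⟨0, by simp, ?_⟩
    simp only [fe] at h1 h2
    obtain rfl : l = 0 := by norm_num at h1 h2; omega
    simp [eta, fe]
  | succ E ih =>
    have hmono : AddSubgroup.closure (eta β '' Set.Iio (E + 1)) ≤ AddSubgroup.closure (eta β '' Set.Iio (E + 1 + 1)) :=
      AddSubgroup.closure_mono (Set.image_mono (Set.Iio_subset_Iio (by omega)))
    have hnew : eta β (E + 1) ∈ AddSubgroup.closure (eta β '' Set.Iio (E + 1 + 1)) :=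
      AddSubgroup.subset_closure ⟨E + 1, by simp, rfl⟩
    have hcase : fe (E + 1) = fe E ∨ fe (E + 1) = fe E + 1 := by unfold fe; omega
    refine zspan_le β fun l h1 h2 => ?_
    rcases hcase with hf | hf
    · rw [hf] at h1 h2
      by_cases hl : l ≤ E - fe E
      · exact hmono (ih (mem_zspan β h1 hl))
      · have hl' : l = ((E + 1 : ℕ) : ℤ) + -(fe E : ℤ) := by push_cast at *; omega
        have h3 := zspan_mul β (pow_top β (E + 1)) (-(fe E : ℤ))
        rw [sub_mul, ← Units.val_mul, ← zpow_add, ← hl', ← hf] at h3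
        have h4 := hmono (ih (zspan_mono β (by omega) (by push_cast; omega) h3))
        have := AddSubgroup.sub_mem _ hnew h4
        simpa [eta] using this
    · rw [hf] at h1 h2
      by_cases hl : -(fe E : ℤ) ≤ l
      · exact hmono (ih (mem_zspan β hl (by push_cast at *; omega)))
      · have hl' : l = -(fe (E + 1) : ℤ) := by rw [hf]; push_cast at *; omega
        have h3 := zspan_mul β (pow_bot β (E + 1)) l
        rw [sub_mul] at h3
        have h4 := hmono (ih (zspan_mono β (by push_cast at *; omega) (by push_cast at *; omega) h3))
        have := AddSubgroup.sub_mem _ hnew h4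
        rw [eta, ← hl', sub_sub_cancel] at this
        rcases neg_one_pow_eq_or R (E + 1) with h | h <;> rw [h] at this
        · simpa using this
        · simpa using this

lemma alg_main (U : R →+ R) (β : Rˣ) (hU : ∀ l : ℤ, U ((β ^ l : Rˣ) : R) = ((β ^ ((l + 6) / 11) : Rˣ) : R))
    (e : ℕ) : U (eta β e) ∈ AddSubgroup.closure (eta β '' Set.Iio (max 1 (5 * ((e + 1) / 5) - 1))) := by
  set w := (e + 1) / 5 with hw
  have key : ∀ a c : ℤ, a = -(fe e : ℤ) → c = e - fe e → ∀ E : ℕ, E + 1 = max 1 (5 * w - 1) →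
      (-(fe E : ℤ)) ≤ (a + 6) / 11 → (c + 6) / 11 ≤ E - fe E →
      U (eta β e) ∈ AddSubgroup.closure (eta β '' Set.Iio (E + 1)) := by
    intro a c ha hc E hE h1 h2
    refine eta_span β E ?_
    have h3 : zspan β a c ≤ (zspan β (-(fe E : ℤ)) (E - fe E)).comap U := by
      refine zspan_le β fun l h3 h4 => ?_
      rw [AddSubgroup.mem_comap, hU]
      exact mem_zspan β (by omega) (by omega)
    exact h3 (by rw [ha, hc]; exact eta_mem β e)
  obtain ⟨E, hE⟩ : ∃ E, E + 1 = max 1 (5 * w - 1) := ⟨max 1 (5 * w - 1) - 1, by omega⟩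
  rw [← hE]
  refine key _ _ rfl rfl E hE ?_ ?_ <;> unfold fe <;> omega

end alg
end X11

end

section

open UpperHalfPlane hiding I
open Complex Function
open scoped Manifold MatrixGroups Topology ModularForm

namespace X11
/-- reduction mod 11 -/
abbrev RR : Type := 𝓛 ⧸ (Ideal.span {(11 : 𝓛)})
noncomputable abbrev pr : 𝓛 →+* RR := Ideal.Quotient.mk _

lemma RR_11 : (11 : RR) = 0 := by
  have : pr (11 : 𝓛) = 0 := Ideal.Quotient.eq_zero_iff_mem.2 (Ideal.subset_span rfl)
  rwa [map_ofNat] at this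

noncomputable def lft (F : 𝓛 →+ 𝓛) : RR →+ RR :=
  QuotientAddGroup.lift (Submodule.toAddSubgroup (Ideal.span {(11 : 𝓛)})) ((pr : 𝓛 →+ RR).comp F) (by
    intro x hx
    obtain ⟨y, rfl⟩ := Ideal.mem_span_singleton'.1 hx
    have : y * 11 = (11 : ℕ) • y := by rw [nsmul_eq_mul, mul_comm]; simp
    rw [AddMonoidHom.mem_ker, AddMonoidHom.comp_apply, this, map_nsmul, map_nsmul, nsmul_eq_mul]
    simp [RR_11])

lemma lft_pr (F : 𝓛 →+ 𝓛) (x : 𝓛) : lft F (pr x) = pr (F x) := rfl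

noncomputable def UL : 𝓛 →+ 𝓛 where
  toFun x := ⟨U x.1, L_U x.2⟩
  map_zero' := Subtype.ext (by ext τ; simp [U])
  map_add' x y := Subtype.ext (U_add _ _)

lemma L_mdiff (x : 𝓛) : MDiff x.1 := by
  obtain ⟨e, h⟩ := x.2
  exact h.mdiff

noncomputable def DL : 𝓛 →+ 𝓛 where
  toFun x := ⟨Dq x.1, L_D x.2⟩
  map_zero' := Subtype.ext (Derivative.normalizedDerivOfComplex_const 0)
  map_add' x y := Subtype.ext (Derivative.normalizedDerivOfComplex_add _ _ (L_mdiff x) (L_mdiff y))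

noncomputable def UR : RR →+ RR := lft UL
noncomputable def DR : RR →+ RR := lft DL

lemma DR_mul (x y : RR) : DR (x * y) = x * DR y + y * DR x := by
  obtain ⟨x, rfl⟩ := Ideal.Quotient.mk_surjective x
  obtain ⟨y, rfl⟩ := Ideal.Quotient.mk_surjective y
  have : DL (x * y) = x * DL y + y * DL x := by
    apply Subtype.ext
    have := Derivative.normalizedDerivOfComplex_mul x.1 y.1 (L_mdiff x) (L_mdiff y)
    change Dq (x.1 * y.1) = x.1 * Dq y.1 + y.1 * Dq x.1
    rw [Dq, this, Dq, Dq]; ring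
  have h2 := congrArg pr this
  rw [map_add, pr.map_mul x, pr.map_mul y] at h2
  rw [← map_mul]
  exact h2

lemma UR_DR (x : RR) : UR (DR x) = 0 := by
  obtain ⟨x, rfl⟩ := Ideal.Quotient.mk_surjective x
  have : UL (DL x) = 11 * DL (UL x) := by
    apply Subtype.ext
    obtain ⟨e, P, -, hP⟩ := x.2
    have := U_Dq hP
    change U (Dq x.1) = 11 * Dq (U x.1)
    rw [this]; rfl
  have h2 := congrArg pr this
  rw [map_mul, map_ofNat, RR_11, zero_mul] at h2
  exact h2

lemma pr_V (x : 𝓛) : pr ⟨V x.1, L_V x.2⟩ = pr x ^ 11 := by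
  obtain ⟨h, hh, e⟩ := frob_L x.2
  have : (⟨V x.1, L_V x.2⟩ : 𝓛) - x ^ 11 = 11 * ⟨h, hh⟩ := Subtype.ext (by
    change V x.1 - x.1 ^ 11 = 11 * h
    rw [e]; ext τ; simp)
  have h2 := congrArg pr this
  rw [map_mul, map_ofNat, RR_11, zero_mul, map_sub, map_pow] at h2
  exact sub_eq_zero.1 h2

lemma UR_frob (x y : RR) : UR (x ^ 11 * y) = x * UR y := by
  obtain ⟨x, rfl⟩ := Ideal.Quotient.mk_surjective x
  obtain ⟨y, rfl⟩ := Ideal.Quotient.mk_surjective y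
  have h1 : UL (⟨V x.1, L_V x.2⟩ * y) = x * UL y := by
    apply Subtype.ext
    obtain ⟨e, P, -, hP⟩ := x.2
    exact U_V_mul hP y.1
  have h2 := congrArg pr h1
  rw [pr.map_mul x] at h2
  rw [← pr_V, ← map_mul]
  exact h2

lemma UR_one : UR 1 = 1 := by
  have : UL 1 = 1 := Subtype.ext (by
    change U 1 = 1
    ext τ; simp [U])
  exact congrArg pr this

noncomputable def lX : 𝓛 := ⟨xx, lc_xx.mem⟩
noncomputable def lY : 𝓛 := ⟨yy, lc_yy.mem⟩
noncomputable def lL : 𝓛 := ⟨lam, lc_lam.mem⟩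
noncomputable def lG : 𝓛 := ⟨g2, lc_g2.mem⟩
noncomputable def lG3 : 𝓛 := ⟨g3, lc_g3.mem⟩
noncomputable def lG4 : 𝓛 := ⟨g4, lc_g4.mem⟩
noncomputable def lT : 𝓛 := ⟨tt, lc_tt.mem⟩
noncomputable def lP : 𝓛 := ⟨phi, lc_phi.mem⟩
noncomputable def lS : 𝓛 := ⟨S, lc_S.mem⟩
noncomputable def lSi : 𝓛 := ⟨S⁻¹, lc_Si.mem⟩
noncomputable def lPP : 𝓛 := ⟨PP, lc_PP.mem⟩

lemma pX : pr lX * pr lG = pr lL := by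
  rw [← map_mul]; exact congrArg pr (Subtype.ext (funext rXG))
lemma pg3 : (pr lL - 1) * pr lG = 1 := by
  have : 11 * lG3 = (lL - 12) * lG - 1 := Subtype.ext (funext rg3)
  have := congrArg pr this
  simp only [map_mul, map_sub, map_one, map_ofNat] at this
  linear_combination (pr lG3 + pr lG) * RR_11 - this
lemma pXg3 : pr lX * pr lG3 = 1 := by
  have : lX * lG3 = 1 + 11 * lG := Subtype.ext (funext rXg3)
  have := congrArg pr this
  simp only [map_mul, map_add, map_one, map_ofNat] at this
  linear_combination pr lG * RR_11 + this
lemma pYG : pr lY * pr lG = pr lX := by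
  have : lY * lG = lX + 11 := Subtype.ext (funext rYG)
  have := congrArg pr this
  simp only [map_mul, map_add, map_ofNat] at this
  linear_combination RR_11 + this
lemma pg4 : pr lG4 = pr lG ^ 2 - pr lG3 := by
  have : lG4 = lG ^ 2 - lG3 := Subtype.ext (funext rg4)
  have := congrArg pr this
  simpa only [map_pow, map_sub] using this
lemma pYt : pr lY * pr lT = pr lG3 := by
  rw [← map_mul]; exact congrArg pr (Subtype.ext (funext rYt))
lemma pPT : pr lP * pr lT = 1 := by
  rw [← map_mul, ← map_one pr]; exact congrArg pr (Subtype.ext phi_tt)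
lemma pSSi : pr lS * pr lSi = 1 := by
  rw [← map_mul, ← map_one pr]; exact congrArg pr (Subtype.ext (by
    ext τ; exact mul_inv_cancel₀ (S_ne τ)))

lemma pS5 : pr lS ^ 5 * pr lP = 1 := by
  obtain ⟨i, hi⟩ : ∃ i : 𝓛, (⟨P11, lc_P11.mem⟩ : 𝓛) * i = 1 := 
    ⟨⟨P11⁻¹, (lc_inv lc_P11 P11_ne).mem⟩, Subtype.ext (by ext τ; exact mul_inv_cancel₀ (P11_ne τ))⟩
  have h1 : pr ⟨P11, lc_P11.mem⟩ = pr lPP ^ 11 := pr_V lPP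
  have h2 : (⟨P11, lc_P11.mem⟩ : 𝓛) ^ 2 * (lS ^ 5 * lP) = lPP ^ 22 := Subtype.ext (by
    change P11 ^ 2 * (S ^ 5 * phi) = PP ^ 22
    rw [S_eq, phi_eq]
    ext τ
    have := P11_ne τ
    have := q_ne τ
    simp only [Pi.mul_apply, Pi.pow_apply, Pi.inv_apply]
    rw [show (-5 : ℤ) = -(5 : ℕ) by norm_num, zpow_neg, zpow_natCast, zpow_one]
    field_simp)
  have h3 := congrArg pr h2
  have h4 := congrArg pr hi
  simp only [map_mul, map_pow, map_one] at h3 h4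
  rw [h1] at h3 h4
  have h5 : (pr lPP ^ 11 * pr i) ^ 2 = 1 := by rw [h4, one_pow]
  linear_combination pr i ^ 2 * h3 - (pr lS ^ 5 * pr lP - 1) * h5

lemma pDL : DR (pr lL) = - (pr lS * pr lX) := by
  have h1 : DL lL = -(lS * (lX - 121 * lG)) := Subtype.ext (by
    change Dq lam = -(S * (xx - 121 * g2))
    ext τ
    have hs := S_ne τ
    have : Kf τ = Dq lam τ * (S τ)⁻¹ := rfl
    have h2 : xx τ - 121 * g2 τ = - Kf τ := by simp [xx, g2]; ring
    change Dq lam τ = -(S τ * (xx τ - 121 * g2 τ))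
    rw [h2, this]
    field_simp)
  have h2 := congrArg pr h1
  simp only [map_mul, map_neg, map_sub, map_ofNat] at h2
  change DR (pr lL) = _ at h2
  rw [h2]
  linear_combination 11 * pr lS * pr lG * RR_11

lemma pb3 : pr lG3 * (1 + pr lG) = pr lG ^ 2 := by
  linear_combination pr lG ^ 2 * pXg3 - pr lG3 * pr lG * pX - pr lG3 * pg3

lemma pbT : (1 + pr lG) * pr lT = pr lG3 * pr lG ^ 3 := by
  linear_combination pr lG ^ 3 * pYt - pr lT * (pr lG ^ 2 * pYG + pr lG * pX + pg3)

lemma pb : ∃ b : RRˣ, (b : RR) = 1 + pr lG := by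
  refine ⟨⟨1 + pr lG, 1 - pr lG + pr lG3, ?_, ?_⟩, rfl⟩
  · linear_combination pb3
  · linear_combination pb3

noncomputable def bU : RRˣ := pb.choose
lemma bU_eq : (bU : RR) = 1 + pr lG := pb.choose_spec
lemma DR_one : DR 1 = 0 := by have := DR_mul 1 1; simp at this; simpa using this

lemma pDb : DR (1 + pr lG) = pr lS * (1 + pr lG) := by
  have h1 := congrArg DR pg3
  rw [DR_mul, map_sub, DR_one, pDL] at h1
  rw [map_add, DR_one]
  linear_combination pr lG * h1 - (DR (pr lG)) * pg3 + pr lG * pr lS * pX + pr lS * pg3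

lemma UR_b (l : ℤ) : UR ((bU ^ l : RRˣ) : RR) = ((bU ^ ((l + 6) / 11) : RRˣ) : RR) := by
  have hs := alg_step UR DR DR_mul UR_DR (b := (bU : RR)) (b' := ((bU⁻¹ : RRˣ) : RR)) (G := pr lG) (S := pr lS) (C := pr lG * pr lSi)
    bU_eq (by simp) (by rw [bU_eq]; exact pDb) (by linear_combination pr lG * pSSi) (by
      rw [bU_eq]
      have h1 : pr lSi ^ 5 * pr lS ^ 5 = 1 := by rw [← mul_pow, mul_comm, pSSi, one_pow]
      linear_combination pr lG ^ 5 * pr lP * h1 - pr lG ^ 5 * pr lSi ^ 5 * pS5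
        - pr lP * pr lG ^ 3 * pb3 - pr lP * (1 + pr lG) * pbT + (1 + pr lG) ^ 2 * pPT)
  refine alg_Uz UR bU (fun x => UR_frob _ _) ?_ l
  exact alg_U RR_11 UR UR_one (fun x => UR_frob _ _) hs

lemma bi_mul : (1 + pr lG) * ((bU⁻¹ : RRˣ) : RR) = 1 := by rw [← bU_eq]; simp

lemma eta_G (e : ℕ) : eta bU e = pr lG ^ e * ((bU⁻¹ : RRˣ) : RR) ^ fe e := by
  rw [eta, bU_eq, zpow_neg, zpow_natCast, ← inv_pow, Units.val_pow_eq_pow_val, add_sub_cancel_left]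

lemma pr_hb (e : ℕ) : pr ⟨hb e, (lc_hb e).mem⟩ = eta bU e := by
  set i := ((bU⁻¹ : RRˣ) : RR) with hi
  have hi1 : (1 + pr lG) * i = 1 := bi_mul
  have h3 : pr lG3 = pr lG ^ 2 * i := by
    linear_combination i * pb3 - pr lG3 * hi1
  have h4 : pr lG4 = pr lG ^ 3 * i := by
    rw [pg4, h3]; linear_combination -pr lG ^ 2 * hi1
  have hT : pr lT = pr lG ^ 5 * i ^ 2 := by
    linear_combination i * pbT - pr lT * hi1 + i * pr lG ^ 3 * h3
  have hr : e % 5 < 5 := Nat.mod_lt _ (by norm_num)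
  have hh : pr ⟨h0 (e % 5), (lc_h0 _ hr).mem⟩ = pr lG ^ (e % 5) * i ^ (e % 5 / 2) := by
    generalize e % 5 = r at *
    interval_cases r
    · simp; exact map_one pr
    · simp; rfl
    · simp; exact h3
    · simp; exact h4
    · norm_num
      have : (⟨h0 4, (lc_h0 _ hr).mem⟩ : 𝓛) = lG3 ^ 2 := rfl
      change pr ⟨h0 4, (lc_h0 _ hr).mem⟩ = _
      rw [this, map_pow, h3]; ring
  have : (⟨hb e, (lc_hb e).mem⟩ : 𝓛) = lT ^ (e / 5) * ⟨h0 (e % 5), (lc_h0 _ hr).mem⟩ := rfl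
  rw [this, map_mul, map_pow, hT, hh, eta_G, ← hi]
  conv_rhs => rw [show pr lG ^ e = pr lG ^ (5 * (e / 5) + e % 5) by rw [Nat.div_add_mod], fe, pow_add, pow_add, pow_mul, pow_mul]
  ring

/-- the key congruence -/
lemma U_hb_mod (e : ℕ) : ∃ c : ℕ → ℂ, (∀ i, c i ∈ O) ∧ ∃ s ∈ 𝓛,
    U (hb e) - comb hb c (max 1 (5 * ((e + 1) / 5) - 1)) = (11 : ℂ) • s := by
  have h1 := alg_main UR bU UR_b e
  generalize max 1 (5 * ((e + 1) / 5) - 1) = N at *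
  have h2 : ∀ x ∈ AddSubgroup.closure (eta bU '' Set.Iio N), ∃ c : ℕ → ℤ,
      x = pr (∑ i ∈ Finset.range N, c i • (⟨hb i, (lc_hb i).mem⟩ : 𝓛)) := by
    intro x hx
    induction hx using AddSubgroup.closure_induction with
    | mem x hx =>
      obtain ⟨i, hi, rfl⟩ := hx
      refine ⟨Pi.single i 1, ?_⟩
      rw [Finset.sum_eq_single i]
      · simp only [Pi.single_eq_same, one_smul]; exact (pr_hb i).symm
      · intro j _ hj; simp [hj]
      · intro h; simp at h hi; omega
    | zero => exact ⟨0, by simp⟩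
    | add x y _ _ hx hy =>
      obtain ⟨c, rfl⟩ := hx
      obtain ⟨d, rfl⟩ := hy
      exact ⟨c + d, by rw [← map_add]; simp [add_smul, Finset.sum_add_distrib]⟩
    | neg x _ hx =>
      obtain ⟨c, rfl⟩ := hx
      exact ⟨-c, by rw [← map_neg]; simp⟩
  obtain ⟨c, hc⟩ := h2 _ h1
  refine ⟨fun i => c i, fun i => int_mem_O _, ?_⟩
  rw [← pr_hb] at hc
  have h3 : UL ⟨hb e, (lc_hb e).mem⟩ - ∑ i ∈ Finset.range N, c i • (⟨hb i, (lc_hb i).mem⟩ : 𝓛) ∈ Ideal.span {(11 : 𝓛)} := by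
    rw [← Ideal.Quotient.eq_zero_iff_mem, map_sub, sub_eq_zero]
    exact hc
  obtain ⟨s, hs⟩ := Ideal.mem_span_singleton'.1 h3
  refine ⟨s.1, s.2, ?_⟩
  have h4 := congrArg Subtype.val hs
  ext τ
  have h5 := congrFun h4 τ
  have h6 : ((∑ i ∈ Finset.range N, c i • (⟨hb i, (lc_hb i).mem⟩ : 𝓛) : 𝓛) : ℍ → ℂ) = comb hb (fun i => c i) N := by
    rw [comb, AddSubmonoidClass.coe_finsetSum]
    refine Finset.sum_congr rfl fun i _ => ?_
    ext τ; simp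
  have h7 : (U (hb e) - comb hb (fun i => c i) N) τ = (s.1 * 11) τ := by rw [← h6]; exact h5.symm
  rw [h7]
  simp [mul_comm]

end X11

end

section

open UpperHalfPlane hiding I
open Complex Function
open scoped Manifold MatrixGroups Topology ModularForm

namespace X11

variable {f g : ℍ → ℂ}

def we (e : ℕ) : ℕ := (e + 1) / 5

/-- the lattice -/
def Lam (n : ℕ) : AddSubgroup (ℍ → ℂ) :=
  AddSubgroup.closure {f | ∃ i : ℕ, 1 ≤ i ∧ ∃ x ∈ O, f = (11 ^ (n + we i) * x : ℂ) • hb i}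

lemma Lam_gen {n i m : ℕ} {z x : ℂ} (hi : 1 ≤ i) (hx : x ∈ O) (hz : z = 11 ^ m * x) (hm : n + we i ≤ m) :
    z • hb i ∈ Lam n := by
  refine AddSubgroup.subset_closure ⟨i, hi, 11 ^ (m - (n + we i)) * x, ?_, ?_⟩
  · exact O.mul_mem (O.pow_mem (O_num 11) _) hx
  · rw [hz, ← mul_assoc, ← pow_add]; congr 4; omega

lemma Lam_smul {n m : ℕ} {c z : ℂ} (hc : c ∈ O) (hz : z = 11 ^ m * c) (hf : f ∈ Lam n) : z • f ∈ Lam (n + m) := by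
  induction hf using AddSubgroup.closure_induction with
  | mem f h =>
    obtain ⟨i, hi, x, hx, rfl⟩ := h
    rw [smul_smul]
    exact Lam_gen hi (O.mul_mem hc hx) (m := m + (n + we i)) (by rw [hz]; ring) (by omega)
  | zero => simp
  | add f g _ _ h1 h2 => rw [smul_add]; exact AddSubgroup.add_mem _ h1 h2
  | neg f _ h => rw [smul_neg]; exact AddSubgroup.neg_mem _ h

lemma Lam_smul0 {n : ℕ} {c : ℂ} (hc : c ∈ O) (hf : f ∈ Lam n) : c • f ∈ Lam n :=
  Lam_smul (m := 0) hc (by simp) hf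

lemma Lam_le {m n : ℕ} (h : m ≤ n) : Lam n ≤ Lam m := by
  rw [Lam, AddSubgroup.closure_le]
  rintro _ ⟨i, hi, x, hx, rfl⟩
  exact Lam_gen hi hx rfl (by omega)

lemma Lam_int {n : ℕ} (hf : f ∈ Lam n) : ∃ y, Lo 1 y ∧ f = (11 ^ n : ℂ) • y := by
  induction hf using AddSubgroup.closure_induction with
  | mem f h =>
    obtain ⟨i, hi, x, hx, rfl⟩ := h
    refine ⟨(11 ^ we i * x : ℂ) • hb i, ((lc_hb i).lo.of_le (by omega)).smul ?_, ?_⟩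
    · exact O.mul_mem (O.pow_mem (O_num 11) _) hx
    · rw [smul_smul]; congr 1; ring
  | zero => exact ⟨0, Lo.zero 1, by simp⟩
  | add f g _ _ h1 h2 =>
    obtain ⟨y, hy, rfl⟩ := h1
    obtain ⟨z, hz, rfl⟩ := h2
    exact ⟨y + z, hy.add hz, by rw [smul_add]⟩
  | neg f _ h =>
    obtain ⟨y, hy, rfl⟩ := h
    exact ⟨-y, hy.neg, by rw [smul_neg]⟩

lemma Lam_comb {n M : ℕ} {z : ℂ} {d : ℕ → ℂ} (h0 : d 0 = 0)
    (h : ∀ i < M, 1 ≤ i → ∃ m, n + we i ≤ m ∧ ∃ x ∈ O, z * d i = 11 ^ m * x) : z • comb hb d M ∈ Lam n := by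
  rw [comb, Finset.smul_sum]
  refine AddSubgroup.sum_mem _ fun i hi => ?_
  rcases Nat.eq_zero_or_pos i with rfl | hi'
  · simp [h0]
  · obtain ⟨m, hm, x, hx, e⟩ := h i (Finset.mem_range.1 hi) hi'
    rw [smul_smul]
    exact Lam_gen hi' hx e hm

lemma pow_cancel {a b : ℕ} {x y : ℂ} (h : (11 : ℂ) ^ a * x = 11 ^ b * y) (hab : a ≤ b) : x = 11 ^ (b - a) * y := by
  have h2 : (11 : ℂ) ^ b = 11 ^ a * 11 ^ (b - a) := by rw [← pow_add]; congr 1; omega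
  rw [h2, mul_assoc] at h
  exact mul_left_cancel₀ (pow_ne_zero _ (by norm_num)) h

lemma Lam_of_int (hf : Mod f) (h1 : Lo 1 f) (h : (11 : ℂ) • W f ∈ 𝓛) : f ∈ Lam 1 := by
  obtain ⟨M, d, hd, h0, hO, hc⟩ := decomp2 hf h1 1 (by simpa using h)
  have : (1 : ℂ) • comb hb d M ∈ Lam 1 := by
    refine Lam_comb h0 fun i _ hi => ?_
    obtain ⟨c, hc, e⟩ := hc i
    have ht := th_cases i
    refine ⟨th i - 1, by unfold we; omega, c, hc, ?_⟩
    rw [one_mul]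
    exact pow_cancel e (by omega)
  rw [hd]; simpa using this

lemma th_le (e : ℕ) : th e ≤ 6 * we e + 4 := by
  have := th_cases e; unfold we; omega
lemma le_th (e : ℕ) : 6 * we e ≤ th e := by
  have := th_cases e; unfold we; omega

lemma hb_W (e : ℕ) {k : ℕ} (hk : th e ≤ k) : (11 ^ k : ℂ) • W (hb e) = (11 ^ (k - th e) : ℂ) • Gb e := by
  rw [← W_hb, smul_smul, ← pow_add]; congr 2; omega

lemma comb_ext (d : ℕ → ℂ) {M N : ℕ} (h : M ≤ N) : comb hb d M = comb hb (fun i => if i < M then d i else 0) N := by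
  rw [comb, comb]
  rw [← Finset.sum_subset (Finset.range_mono h)]
  · exact Finset.sum_congr rfl fun i hi => by rw [if_pos (Finset.mem_range.1 hi)]
  · intro i _ hi; rw [if_neg (by simpa using hi)]; simp

lemma U_hb (e : ℕ) (he : 1 ≤ e) : (11 ^ we e : ℂ) • U (hb e) ∈ Lam 1 := by
  set w := we e with hw
  set k := 6 * w + 4 with hk
  have hth : th e ≤ k := th_le e
  have lo_h : Lo 1 (hb e) := (lc_hb e).lo.of_le (by omega)
  -- the eleventh power
  have hlo11 : Lo 1 (hb e ^ 11) := ((lc_hb e).pow 11).lo.of_le (by push_cast; omega)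
  have hp : (11 ^ (w + (10 * k - 1)) : ℂ) • hb e ^ 11 ∈ Lam 1 := by
    obtain ⟨M, d, hd, h0, hO, hc⟩ := decomp2 ((mod_hb e).pow 11) hlo11 (11 * k) (by
      have : (11 ^ (11 * k) : ℂ) • W (hb e ^ 11) = ((11 ^ k : ℂ) • W (hb e)) ^ 11 := by
        rw [smul_pow, W_pow, ← pow_mul, mul_comm]
      rw [this, hb_W e hth]
      exact 𝓛.pow_mem (smul_mem_L (O.pow_mem (O_num 11) _) (lc_Gb e).mem) 11)
    rw [hd]
    refine Lam_comb h0 fun i _ hi => ?_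
    by_cases hu : we i ≤ w + 10 * k - 2
    · exact ⟨_, by omega, d i, hO i, rfl⟩
    · obtain ⟨c, hc, e1⟩ := hc i
      have h2 := le_th i
      refine ⟨w + (10 * k - 1) + (th i - 11 * k), by omega, c, hc, ?_⟩
      rw [pow_cancel e1 (by omega), pow_add _ (w + (10 * k - 1))]; ring
  -- the difference
  set H := U (hb e) - (11 ^ (10 * k - 1) : ℂ) • hb e ^ 11 with hH
  have mH : Mod H := (mod_hb e).U.sub (((mod_hb e).pow 11).smul _)
  have loH : Lo 1 H := lo_h.U_one.sub (hlo11.smul (O.pow_mem (O_num 11) _))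
  have hWH : (11 ^ k : ℂ) • W H ∈ 𝓛 := by
    set F := (11 ^ k : ℂ) • W (hb e) with hF
    have hFL : F ∈ 𝓛 := by
      rw [hF, hb_W e hth]; exact smul_mem_L (O.pow_mem (O_num 11) _) (lc_Gb e).mem
    obtain ⟨s, hs, hfr⟩ := frob_L hFL
    have : (11 ^ k : ℂ) • W H = s + (11 ^ k : ℂ) • V (U (hb e)) - (11 ^ (k - 1) : ℂ) • hb e := by
      ext τ
      have h1 := key_identity (mod_hb e) τ
      have h2 := congrFun hfr τ
      have h3 : V F τ = 11 ^ k * V (W (hb e)) τ := rfl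
      have h4 : F τ = 11 ^ k * W (hb e) τ := rfl
      have h5 : (11 : ℂ) ^ k = 11 * 11 ^ (k - 1) := by rw [← pow_succ']; congr 1
      have h6 : ((11 : ℂ) ^ k) ^ 11 = 11 * (11 ^ k * 11 ^ (10 * k - 1)) := by
        rw [← pow_mul, ← pow_add, ← pow_succ']; congr 1; omega
      simp only [Pi.sub_apply, Pi.pow_apply, Pi.smul_apply, smul_eq_mul] at h2
      rw [h3, h4] at h2
      rw [hH, W_sub, W_smul, W_pow]
      simp only [Pi.sub_apply, Pi.pow_apply, Pi.smul_apply, smul_eq_mul, Pi.add_apply]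
      rw [mul_pow, h6] at h2
      have h7 : (11 : ℂ) * (11 ^ k * (W (U (hb e)) τ - 11 ^ (10 * k - 1) * W (hb e) τ ^ 11)) =
          11 * (s τ + 11 ^ k * V (U (hb e)) τ - 11 ^ (k - 1) * hb e τ) := by
        linear_combination 11 ^ k * h1 + h2 - hb e τ * h5
      exact mul_left_cancel₀ (by norm_num) h7
    rw [this]
    exact 𝓛.sub_mem (𝓛.add_mem hs (smul_mem_L (O.pow_mem (O_num 11) _) (L_V (L_U lo_h.mem))))
      (smul_mem_L (O.pow_mem (O_num 11) _) lo_h.mem)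
  obtain ⟨M, d, hd, h0, hO, hc⟩ := decomp2 mH loH k hWH
  obtain ⟨c, hcO, s, hs, hmod⟩ := U_hb_mod e
  change U (hb e) - comb hb c (max 1 (5 * w - 1)) = _ at hmod
  set N := max 1 (5 * w - 1) with hN
  have hdiv : ∀ i < M, N ≤ i → ∃ x ∈ O, d i = 11 * x := by
    intro i hi hNi
    let δ : ℕ → ℂ := fun i => (1 / 11) * ((if i < M then d i else 0) - (if i < N then c i else 0))
    have h1 : comb hb δ (max M N) = s - (11 ^ (10 * k - 2) : ℂ) • hb e ^ 11 := by
      have h2 : comb hb δ (max M N) = (1 / 11 : ℂ) • (comb hb d M - comb hb c N) := by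
        rw [comb_ext d (le_max_left M N), comb_ext c (le_max_right M N), comb, comb, comb, ← Finset.sum_sub_distrib,
          Finset.smul_sum]
        refine Finset.sum_congr rfl fun i _ => ?_
        rw [← sub_smul, smul_smul]
      have h5 : (11 : ℂ) ^ (10 * k - 1) = 11 * 11 ^ (10 * k - 2) := by rw [← pow_succ']; congr 1
      rw [h2, ← hd, hH, sub_right_comm, hmod, h5]
      ext τ; simp; ring
    have h3 := coeff_int lc_hb δ (max M N) 0 (by
      have : comb hb δ (max M N) ∈ 𝓛 := by
        rw [h1]; exact 𝓛.sub_mem hs (smul_mem_L (O.pow_mem (O_num 11) _) hlo11.mem)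
      simpa only [zero_add, comb] using this) i (by omega)
    rw [zero_add] at h3
    refine ⟨δ i, h3, ?_⟩
    simp only [δ, if_pos hi, if_neg (not_lt.2 hNi)]
    ring
  have hHmem : (11 ^ w : ℂ) • H ∈ Lam 1 := by
    rw [hd]
    refine Lam_comb h0 fun i hi hi1 => ?_
    rcases lt_trichotomy (we i) w with hlt | heq | hgt
    · exact ⟨w, by omega, d i, hO i, rfl⟩
    · obtain ⟨x, hx, e1⟩ := hdiv i hi (by unfold we at heq; omega)
      exact ⟨w + 1, by omega, x, hx, by rw [e1]; ring⟩
    · obtain ⟨c, hc, e1⟩ := hc i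
      have h2 := le_th i
      refine ⟨w + (th i - k), by omega, c, hc, ?_⟩
      rw [pow_cancel e1 (by omega), pow_add _ w]; ring
  have : (11 ^ w : ℂ) • U (hb e) = (11 ^ w : ℂ) • H + (11 ^ (w + (10 * k - 1)) : ℂ) • hb e ^ 11 := by
    rw [hH, smul_sub, smul_smul, ← pow_add, sub_add_cancel]
  rw [this]
  exact AddSubgroup.add_mem _ hHmem hp

lemma U_Lam {n : ℕ} (hf : f ∈ Lam n) : U f ∈ Lam (n + 1) := by
  induction hf using AddSubgroup.closure_induction with
  | mem f h =>
    obtain ⟨i, hi, x, hx, rfl⟩ := h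
    have := Lam_smul (m := n) hx rfl (U_hb i hi)
    rw [U_smul]
    rw [smul_smul, add_comm 1] at this
    convert this using 2
    ring
  | zero =>
    have : U (0 : ℍ → ℂ) = 0 := by ext τ; simp [U]
    rw [this]; exact AddSubgroup.zero_mem _
  | add f g _ _ h1 h2 => rw [U_add]; exact AddSubgroup.add_mem _ h1 h2
  | neg f _ h => rw [U_neg]; exact AddSubgroup.neg_mem _ h

lemma U_int (hf : Mod f) (hl : f ∈ 𝓛) (hw : W f ∈ 𝓛) : (11 : ℂ) • W (U f) ∈ 𝓛 := by
  have : (11 : ℂ) • W (U f) = V (W f) + (11 : ℂ) • V (U f) - f := by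
    ext τ; exact key_identity hf τ
  rw [this]
  exact 𝓛.sub_mem (𝓛.add_mem (L_V hw) (smul_mem_L (O_num 11) (L_V (L_U hl)))) hl

end X11

end

section

open UpperHalfPlane hiding I
open Complex Function
open scoped Manifold MatrixGroups Topology ModularForm

namespace X11

variable {f g : ℍ → ℂ} {e : ℤ} {P Q : PowerSeries ℂ}

/-- normalised invariant function with a simple pole at each cusp -/
noncomputable def jt : ℍ → ℂ := lam - (7 : ℂ) • 1

lemma mod_jt : Mod jt := mod_lam.sub (mod_one.smul _)
lemma W_jt : W jt = jt := by rw [jt, W_sub, W_smul, W_lam, W_one]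
lemma jt_mem : jt ∈ 𝓛 := 𝓛.sub_mem lc_lam.mem (smul_mem_L (O_num 7) lc_one.mem)

lemma jt_lo : Lo 1 (jt - fun τ => q τ ^ (-1 : ℤ)) := by
  have h1 := (r5_lam.sub ((r5_const 7).shift)).sub (r5_one (-1))
  norm_num at h1
  obtain ⟨P, hP, h0, h1, -⟩ := h1
  have e1 : (lam - fun _ => (7 : ℂ)) = jt := by ext τ; simp [jt]
  rw [e1] at hP
  have hl : jt - (fun τ => q τ ^ (-1 : ℤ)) ∈ 𝓛 := 𝓛.sub_mem jt_mem (lc_qpow (-1)).mem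
  have : PowerSeries.X ^ 2 ∣ P := by
    rw [PowerSeries.X_pow_dvd_iff]
    intro m hm
    interval_cases m <;> assumption
  obtain ⟨R, rfl⟩ := this
  rw [rep_shift] at hP
  exact lo_of_rep hl (e := 1) (by simpa using hP)

lemma U_jt : U jt ∈ Lam 1 := by
  refine Lam_of_int mod_jt.U ?_ (U_int mod_jt jt_mem (by rw [W_jt]; exact jt_mem))
  have h := jt_lo.U_one
  rw [U_sub, U_qpow_zero (by norm_num), sub_zero] at h
  exact h

/-- Reduced functions `q^(-m) + b q^(-1) + O(q)`. -/
structure Red (m : ℕ) (b : ℂ) (f : ℍ → ℂ) : Prop where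
  mod : Mod f
  hb : b ∈ O
  w : W f ∈ 𝓛
  lo : Lo 1 (f - (fun τ => q τ ^ (-(m : ℤ))) - b • fun τ => q τ ^ (-1 : ℤ))

lemma Red.mem {m : ℕ} {b : ℂ} (h : Red m b f) : f ∈ 𝓛 := by
  have := 𝓛.add_mem (𝓛.add_mem h.lo.mem (smul_mem_L h.hb (lc_qpow (-1)).mem)) (lc_qpow (-(m : ℤ))).mem
  simpa using this

lemma Red.U_lo {m : ℕ} {b : ℂ} (h : Red m b f) : Lo 1 (U f - U (fun τ => q τ ^ (-(m : ℤ)))) := by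
  have := h.lo.U_one
  rwa [U_sub, U_sub, U_smul, U_qpow_zero (m := -1) (by norm_num), smul_zero, sub_zero] at this

lemma Red.U_prime {m : ℕ} {b : ℂ} (h : Red m b f) (hm : ¬ 11 ∣ m) : U f ∈ Lam 1 := by
  refine Lam_of_int h.mod.U ?_ (U_int h.mod h.mem h.w)
  have := h.U_lo
  rwa [U_qpow_zero (by omega), sub_zero] at this

lemma Red.step {m : ℕ} {b c : ℂ} (h : Red (11 * m) b f) (h' : Red m c g) :
    U f - g - (-c) • jt ∈ Lam 1 := by
  refine Lam_of_int ((h.mod.U.sub h'.mod).sub (mod_jt.smul _)) ?_ ?_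
  · have h1 := (h.U_lo.sub h'.lo).add (jt_lo.smul h'.hb)
    have : (fun τ => q τ ^ (-((11 * m : ℕ) : ℤ))) = fun τ => q τ ^ (11 * (-(m : ℤ))) := by
      ext τ; congr 1; push_cast; ring
    rw [this, U_qpow_mul] at h1
    convert h1 using 1
    ext τ; simp; ring
  · rw [W_sub, W_sub, W_smul, W_jt, smul_sub, smul_sub]
    exact 𝓛.sub_mem (𝓛.sub_mem (U_int h.mod h.mem h.w) (smul_mem_L (O_num 11) h'.w))
      (smul_mem_L (O_num 11) (smul_mem_L (O.neg_mem h'.hb) jt_mem))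

lemma Red.step_one {b : ℂ} (h : Red 11 b f) : U f - jt ∈ Lam 1 := by
  refine Lam_of_int (h.mod.U.sub mod_jt) ?_ ?_
  · have h1 := (h.U_lo.sub jt_lo)
    have : (fun τ => q τ ^ (-((11 : ℕ) : ℤ))) = fun τ => q τ ^ (11 * (-1 : ℤ)) := by
      ext τ; congr 1
    rw [this, U_qpow_mul] at h1
    convert h1 using 1
    ext τ; simp
  · rw [W_sub, W_jt, smul_sub]
    exact 𝓛.sub_mem (U_int h.mod h.mem h.w) (smul_mem_L (O_num 11) jt_mem)

lemma descend {G : ℕ → ℍ → ℂ} {b : ℕ → ℂ} (hG1 : G 1 = 0) (hG : ∀ m, 2 ≤ m → Red m (b m) (G m)) (α : ℕ) :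
    ∀ m, 1 ≤ m → ∃ c ∈ O, U^[α] (G (11 ^ α * m)) - G m - c • jt ∈ Lam 0 := by
  induction α with
  | zero => intro m _; exact ⟨0, O.zero_mem, by simp [(Lam 0).zero_mem]⟩
  | succ α ih =>
    intro m hm
    obtain ⟨c, hc, h⟩ := ih (11 * m) (by omega)
    have h1 := Lam_le (show 0 ≤ 1 by norm_num) (U_Lam h)
    rw [U_sub, U_sub, U_smul, ← Function.iterate_succ_apply' (f := U),
      show 11 ^ α * (11 * m) = 11 ^ (α + 1) * m by ring] at h1
    have h2 : c • U jt ∈ Lam 0 := Lam_le (show 0 ≤ 1 by norm_num) (Lam_smul0 hc U_jt)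
    obtain ⟨d, hd, h3⟩ : ∃ d ∈ O, U (G (11 * m)) - G m - d • jt ∈ Lam 1 := by
      rcases Nat.lt_or_ge m 2 with h | h
      · obtain rfl : m = 1 := by omega
        refine ⟨1, O.one_mem, ?_⟩
        rw [hG1, sub_zero, one_smul]
        exact (hG (11 * 1) (by norm_num)).step_one
      · exact ⟨_, O.neg_mem (hG m h).hb, (hG (11 * m) (by omega)).step (hG m h)⟩
    refine ⟨d, hd, ?_⟩
    have := (Lam 0).add_mem ((Lam 0).add_mem h1 h2) (Lam_le (show 0 ≤ 1 by norm_num) h3)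
    convert this using 1
    abel

lemma final_Lam {G : ℕ → ℍ → ℂ} {b : ℕ → ℂ} (hG1 : G 1 = 0) (hG : ∀ m, 2 ≤ m → Red m (b m) (G m))
    (α k m : ℕ) (hm : 1 ≤ m) (h11 : ¬ 11 ∣ m) :
    U^[α + 1 + k] (G (11 ^ α * m)) ∈ Lam (k + 1) := by
  induction k with
  | zero =>
    rw [add_zero, Function.iterate_succ_apply']
    obtain ⟨c, hc, h⟩ := descend hG1 hG α m hm
    have h1 := U_Lam h
    rw [U_sub, U_sub, U_smul] at h1
    have h3 : U (G m) ∈ Lam 1 := by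
      rcases Nat.lt_or_ge m 2 with h | h
      · obtain rfl : m = 1 := by omega
        rw [hG1]
        have := U_smul 0 0
        simp only [zero_smul] at this
        rw [this]; exact (Lam 1).zero_mem
      · exact (hG m h).U_prime h11
    have := (Lam 1).add_mem ((Lam 1).add_mem h1 (Lam_smul0 hc U_jt)) h3
    convert this using 1
    abel
  | succ k ih =>
    rw [← add_assoc, Function.iterate_succ_apply']
    exact U_Lam ih

lemma Rep.U_iter (β : ℕ) : ∀ {e : ℤ} {P : PowerSeries ℂ} {f : ℍ → ℂ}, Rep (11 ^ β * e) P f →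
    Rep e (PowerSeries.mk fun n => PowerSeries.coeff (11 ^ β * n) P) (X11.U^[β] f) := by
  induction β with
  | zero =>
    intro e P f h
    have : (PowerSeries.mk fun n => PowerSeries.coeff (11 ^ 0 * n) P) = P := by ext n; simp
    rw [this]; simpa using h
  | succ β ih =>
    intro e P f h
    rw [Function.iterate_succ_apply]
    have h1 : Rep (11 * (11 ^ β * e)) P f := by
      rw [← mul_assoc, ← pow_succ']; exact h
    have h2 := ih h1.U
    convert h2 using 1
    ext n
    simp only [PowerSeries.coeff_mk, uPS]
    congr 2; ring

lemma coeff_dvd {m β k n : ℕ} {b : ℕ → ℤ} {a1 : ℂ} (hn : 0 < n)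
    (hrep : Rep 1 (PowerSeries.mk fun n => (b (n + 1) : ℂ))
      (f - (fun τ => q τ ^ (-(m : ℤ))) - a1 • fun τ => q τ ^ (-1 : ℤ)))
    (hm : 1 ≤ m) (hU : U^[β] f ∈ Lam k) : (11 : ℤ) ^ k ∣ b (11 ^ β * n) := by
  obtain ⟨y, ⟨R, hR, hy⟩, hUy⟩ := Lam_int hU
  -- the two expansions of `U^β f`
  have hx : (11 : ℤ) ^ β * (-(m : ℤ)) = 1 - ((11 ^ β * m + 1 : ℕ) : ℤ) := by push_cast; ring
  have r1 := hrep.of_le (11 ^ β * m + 1)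
  have hp : 1 ≤ 11 ^ β := Nat.one_le_pow _ _ (by norm_num)
  have hmm : m ≤ 11 ^ β * m := Nat.le_mul_of_pos_left _ hp
  have r2 := (rep_qpow (-(m : ℤ))).of_le (11 ^ β * m - m)
  have r3 := ((rep_qpow (-1 : ℤ)).of_le (11 ^ β * m - 1)).smul a1
  rw [show -(m : ℤ) - ((11 ^ β * m - m : ℕ) : ℤ) = 1 - ((11 ^ β * m + 1 : ℕ) : ℤ) by omega] at r2
  rw [show (-1 : ℤ) - ((11 ^ β * m - 1 : ℕ) : ℤ) = 1 - ((11 ^ β * m + 1 : ℕ) : ℤ) by omega] at r3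
  have r4 := (r1.add r3).add r2
  rw [sub_add_cancel, sub_add_cancel, ← hx] at r4
  have r5 := r4.U_iter
  rw [hUy] at r5
  have r6 := (hy.of_le (m + 1)).smul (11 ^ k : ℂ)
  rw [show (1 : ℤ) - ((m + 1 : ℕ) : ℤ) = -(m : ℤ) by push_cast; ring] at r6
  have r7 := r5.unique r6
  obtain ⟨n, rfl⟩ : ∃ n', n = n' + 1 := ⟨n - 1, by omega⟩
  have r8 := congrArg (PowerSeries.coeff (n + (m + 1))) r7
  have hsplit : 11 ^ β * (n + (m + 1)) = (11 ^ β * (n + 1) - 1) + (11 ^ β * m + 1) := by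
    have : 1 ≤ 11 ^ β * (n + 1) := Nat.le_mul_of_pos_left _ hp |>.trans' (by omega)
    have e : 11 ^ β * (n + (m + 1)) = 11 ^ β * (n + 1) + 11 ^ β * m := by ring
    omega
  have hpos : 1 ≤ 11 ^ β * (n + 1) := Nat.le_mul_of_pos_left _ hp |>.trans' (by omega)
  have e2 : ¬ (11 ^ β * (n + 1) - 1 + (11 ^ β * m + 1) = 11 ^ β * m - m) := by omega
  have e3 : ¬ (11 ^ β * (n + 1) - 1 + (11 ^ β * m + 1) = 11 ^ β * m - 1) := by omega
  rw [PowerSeries.coeff_mk, hsplit, map_add, map_add, PowerSeries.coeff_X_pow_mul, PowerSeries.coeff_smul,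
    PowerSeries.coeff_smul, mul_one, mul_one, PowerSeries.coeff_X_pow, PowerSeries.coeff_X_pow, if_neg e2,
    if_neg e3, PowerSeries.coeff_X_pow_mul, PowerSeries.coeff_mk, Nat.sub_add_cancel hpos] at r8
  refine dvd_of_O (mem_IntP.1 hR n) ?_
  simpa using r8

lemma rep_F {F : ℂ → ℂ} {a : ℤ → ℤ} {m : ℕ}
    (hexp : ∀ τ : ℂ, 0 < τ.im →
      HasSum (fun n : ℕ+ => (a n : ℂ) * Complex.exp (2 * Real.pi * Complex.I * n * τ))
        (F τ - Complex.exp (-(2 * Real.pi * Complex.I * m * τ)) -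
          (a (-1) : ℂ) * Complex.exp (-(2 * Real.pi * Complex.I * τ)))) :
    Rep 1 (PowerSeries.mk fun n => (a (n + 1 : ℕ) : ℂ))
      ((fun τ : ℍ => F τ) - (fun τ => q τ ^ (-(m : ℤ))) - (a (-1) : ℂ) • fun τ => q τ ^ (-1 : ℤ)) := by
  intro τ
  have h1 := hexp τ τ.im_pos
  rw [← Equiv.pnatEquivNat.symm.hasSum_iff] at h1
  refine hs_congr (h1.mul_right (q τ ^ (-1 : ℤ))) ?_ ?_
  · intro k
    have hq := q_ne τ
    have : Complex.exp (2 * Real.pi * Complex.I * ((k + 1 : ℕ) : ℂ) * τ) = q τ ^ (k + 1) := by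
      rw [q_def, ← Complex.exp_nat_mul]; congr 1; ring
    simp only [PowerSeries.coeff_mk, Function.comp_apply, Equiv.pnatEquivNat_symm_apply, Nat.succPNat_coe,
      Nat.succ_eq_add_one]
    rw [this, pow_succ, zpow_neg_one]
    field_simp
  · have e1 : Complex.exp (-(2 * Real.pi * Complex.I * m * τ)) = q τ ^ (-(m : ℤ)) := by
      rw [q_def, ← Complex.exp_int_mul]; congr 1; push_cast; ring
    have e2 : Complex.exp (-(2 * Real.pi * Complex.I * τ)) = q τ ^ (-1 : ℤ) := by
      rw [q_def, ← Complex.exp_int_mul]; congr 1; push_cast; ring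
    rw [e1, e2]
    simp

lemma red_F {F : ℂ → ℂ} {a : ℤ → ℤ} {m : ℕ} (h : 2 ≤ m)
    (hmod : ∀ A B C D : ℤ, A * D - B * C = 1 → (11 : ℤ) ∣ C →
      ∀ τ : ℂ, 0 < τ.im → F (((A : ℂ) * τ + B) / ((C : ℂ) * τ + D)) = F τ)
    (hrep : Rep 1 (PowerSeries.mk fun n => (a (n + 1 : ℕ) : ℂ))
      ((fun τ : ℍ => F τ) - (fun τ => q τ ^ (-(m : ℤ))) - (a (-1) : ℂ) • fun τ => q τ ^ (-1 : ℤ)))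
    (hcusp0 : ∃ Cb : ℝ, ∀ τ : ℂ, 1 ≤ τ.im → ‖F (-1 / (11 * τ))‖ ≤ Cb) :
    Red m (a (-1)) (fun τ : ℍ => F τ) := by
  have hlo : Lo 1 ((fun τ : ℍ => F τ) - (fun τ => q τ ^ (-(m : ℤ))) - (a (-1) : ℂ) • fun τ => q τ ^ (-1 : ℤ)) :=
    ⟨_, mem_IntP.2 fun k => by rw [PowerSeries.coeff_mk]; exact int_mem_O _, hrep⟩
  have hlo2 : Lo (-(m : ℤ)) (fun τ : ℍ => F τ) := by
    have := ((hlo.of_le (e' := -(m : ℤ)) (by omega)).add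
      (((lc_qpow (-1)).lo.of_le (e' := -(m : ℤ)) (by omega)).smul (int_mem_O (a (-1))))).add (lc_qpow (-(m : ℤ))).lo
    rwa [sub_add_cancel, sub_add_cancel] at this
  have hM : Mod (fun τ : ℍ => F τ) := by
    obtain ⟨P, -, hP⟩ := hlo2
    refine ⟨hP.mdiff, fun A B C D hd hC σ τ hr => ?_⟩
    have hne := denom_ne hd τ
    have hs : (σ : ℂ) = ((A : ℂ) * τ + B) / ((C : ℂ) * τ + D) := by
      rw [eq_div_iff hne]; exact hr
    show F σ = F τ
    rw [hs]; exact hmod A B C D hd hC τ τ.im_pos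
  refine ⟨hM, int_mem_O _, ?_, hlo⟩
  obtain ⟨Cb, hCb⟩ := hcusp0
  have hbd : IsBoundedAtImInfty (fun τ => W (fun τ : ℍ => F τ) τ * q τ ^ (-(0 : ℤ))) := by
    rw [UpperHalfPlane.isBoundedAtImInfty_iff]
    refine ⟨Cb, 1, fun τ hτ => ?_⟩
    rw [neg_zero, zpow_zero, mul_one]
    exact hCb τ hτ
  obtain ⟨M, c, hc, hcomb⟩ := decomp m _ hM hlo2 (rep_exists hM.W.md hM.W.vadd 0 hbd)
  rw [hcomb, W_comb, comb]
  refine 𝓛.sum_mem fun i _ => smul_mem_L (hc i) ?_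
  rw [W_Gb]
  exact smul_mem_L (O.pow_mem (O_num 11) _) (lc_hb i).mem


end X11

end

section

open UpperHalfPlane hiding I
open Complex Function
open scoped Manifold MatrixGroups Topology ModularForm

namespace X11

lemma main_thm (F : ℕ → ℂ → ℂ) (a : ℕ → ℤ → ℤ)
    (hmod : ∀ m : ℕ, 2 ≤ m → ∀ A B C D : ℤ, A * D - B * C = 1 → (11 : ℤ) ∣ C →
      ∀ τ : ℂ, 0 < τ.im →
        F m (((A : ℂ) * τ + B) / ((C : ℂ) * τ + D)) = F m τ)
    (hexp : ∀ m : ℕ, 2 ≤ m → ∀ τ : ℂ, 0 < τ.im →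
      HasSum (fun n : ℕ+ => (a m n : ℂ) * Complex.exp (2 * Real.pi * Complex.I * n * τ))
        (F m τ - Complex.exp (-(2 * Real.pi * Complex.I * m * τ)) -
          (a m (-1) : ℂ) * Complex.exp (-(2 * Real.pi * Complex.I * τ))))
    (hcusp0 : ∀ m : ℕ, 2 ≤ m → ∃ Cb : ℝ, ∀ τ : ℂ, 1 ≤ τ.im →
      ‖F m (-1 / (11 * τ))‖ ≤ Cb)
    (α β m' n : ℕ) (hm' : ¬ 11 ∣ m') (hm : 2 ≤ 11 ^ α * m') (hn : 0 < n) (hβ : α < β) :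
    (11 : ℤ) ^ (β - α) ∣ a (11 ^ α * m') ((11 : ℤ) ^ β * n) := by
  obtain ⟨G, hG1, hGF⟩ : ∃ G : ℕ → ℍ → ℂ, G 1 = 0 ∧ ∀ m, 2 ≤ m → G m = fun τ : ℍ => F m τ :=
    ⟨fun m => if m < 2 then 0 else fun τ => F m τ, if_pos (by norm_num), fun m h => if_neg (by omega)⟩
  have hRed : ∀ m, 2 ≤ m → Red m (a m (-1)) (G m) := by
    intro m h
    rw [hGF m h]
    exact red_F h (hmod m h) (rep_F (hexp m h)) (hcusp0 m h)
  have hm1 : 1 ≤ m' := by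
    rcases Nat.eq_zero_or_pos m' with rfl | h
    · simp at hm
    · exact h
  have key := final_Lam (G := G) (b := fun m => (a m (-1) : ℂ)) hG1 hRed α (β - α - 1) m' hm1 hm'
  rw [show α + 1 + (β - α - 1) = β by omega, show β - α - 1 + 1 = β - α by omega, hGF _ hm] at key
  have hr := rep_F (hexp _ hm)
  generalize 11 ^ α * m' = N at hr hm key ⊢
  have h2 := coeff_dvd (f := fun τ : ℍ => F N τ) (m := N) (β := β) (k := β - α) (n := n)
    (b := fun k : ℕ => a N (k : ℤ)) (a1 := (a N (-1) : ℂ)) hn hr (by omega) key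
  have e : ((11 ^ β * n : ℕ) : ℤ) = (11 : ℤ) ^ β * n := by push_cast; ring
  rw [← e]
  exact h2

end X11

end

/-- Let `F m : ℍ → ℂ` (for `m ≥ 2`) be the reduced-form basis elements `f_{11,m}` of the
space of weight 0 weakly holomorphic modular forms on `Γ₀(11)` holomorphic away from `i∞`,
with integer Fourier coefficients `a m : ℤ → ℤ`, so that
`f_{11,m}(τ) = q^{-m} + a(m,-1) q^{-1} + ∑_{n≥1} a(m,n) qⁿ`.  The hypotheses state
`Γ₀(11)`-invariance, the Fourier expansion, and holomorphy at the cusp `0` (boundedness of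
`F m (-1/(11τ))` as `Im τ → ∞`).  If `m = 11^α m' ≥ 2` with `gcd(11, m') = 1`, then for
all positive integers `n` and all `β > α`,
`a₁₁(11^α m', 11^β n) ≡ 0 (mod 11^{β-α})`. -/
theorem level_eleven_basis_congruence (F : ℕ → ℂ → ℂ) (a : ℕ → ℤ → ℤ)
    (hmod : ∀ m : ℕ, 2 ≤ m → ∀ A B C D : ℤ, A * D - B * C = 1 → (11 : ℤ) ∣ C →
      ∀ τ : ℂ, 0 < τ.im →
        F m (((A : ℂ) * τ + B) / ((C : ℂ) * τ + D)) = F m τ)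
    (hexp : ∀ m : ℕ, 2 ≤ m → ∀ τ : ℂ, 0 < τ.im →
      HasSum (fun n : ℕ+ => (a m n : ℂ) * Complex.exp (2 * Real.pi * Complex.I * n * τ))
        (F m τ - Complex.exp (-(2 * Real.pi * Complex.I * m * τ)) -
          (a m (-1) : ℂ) * Complex.exp (-(2 * Real.pi * Complex.I * τ))))
    (hcusp0 : ∀ m : ℕ, 2 ≤ m → ∃ Cb : ℝ, ∀ τ : ℂ, 1 ≤ τ.im →
      ‖F m (-1 / (11 * τ))‖ ≤ Cb)
    (α β m' n : ℕ) (hm' : ¬ 11 ∣ m') (hm : 2 ≤ 11 ^ α * m') (hn : 0 < n) (hβ : α < β) :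
    (11 : ℤ) ^ (β - α) ∣ a (11 ^ α * m') ((11 : ℤ) ^ β * n) := by
  exact X11.main_thm F a hmod hexp hcusp0 α β m' n hm' hm hn hβ
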